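/- arXiv:1201.2778 — 2 statements merged into one kernel-verified Lean document; each statement's English description precedes it below -/
import Mathlib

section
/- Let γ : ℝ → ℝ³ be a C^∞ curve with γ'(0) ≠ 0, γ''(0) ∈ span{γ'(0)}, dim span{γ'(0), γ''(0), γ'''(0)} = 2, and dim span{γ'(0), γ''(0), γ'''(0), γ''''(0)} = 3 (i.e. γ has type (1,3,4) at 0). Then the tangent map-germ Tan(γ)(s,t) = γ(t) + s·γ'(t) at (0,0) is diffeomorphic (right–left equivalent) to the Mond surface map-germ (u,x) ↦ (u, x³ + ux², (3/4)x⁴ + (2/3)ux³) at 0. -/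
open Filter Topology

/-- Two map-germs `f` at `a` and `g` at `b` are diffeomorphic (right-left equivalent):
there are germs of `C^∞` diffeomorphisms `σ : (E, a) → (E, b)` and
`τ : (F, f a) → (F, g b)` with `g ∘ σ = τ ∘ f` as germs at `a`. -/
def GermEquiv {E F : Type*} [NormedAddCommGroup E] [NormedSpace ℝ E]
    [NormedAddCommGroup F] [NormedSpace ℝ F]
    (f : E → F) (a : E) (g : E → F) (b : E) : Prop :=
  ∃ σ σinv : E → E, ∃ τ τinv : F → F,
    σ a = b ∧ τ (f a) = g b ∧
    ContDiffAt ℝ (⊤ : ℕ∞) σ a ∧ ContDiffAt ℝ (⊤ : ℕ∞) σinv b ∧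
    ContDiffAt ℝ (⊤ : ℕ∞) τ (f a) ∧ ContDiffAt ℝ (⊤ : ℕ∞) τinv (g b) ∧
    (∀ᶠ x in 𝓝 a, σinv (σ x) = x) ∧ (∀ᶠ y in 𝓝 b, σ (σinv y) = y) ∧
    (∀ᶠ z in 𝓝 (f a), τinv (τ z) = z) ∧ (∀ᶠ w in 𝓝 (g b), τ (τinv w) = w) ∧
    (∀ᶠ x in 𝓝 a, g (σ x) = τ (f x))

/-- Derivative bounds for the inverse of an affine map into a commutative Banach algebra. -/
theorem mond_inv_bound {E A : Type*} [NormedAddCommGroup E] [NormedSpace ℝ E]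
    [NormedCommRing A] [NormedAlgebra ℝ A] [CompleteSpace A]
    (ℓ : E →L[ℝ] A) (c : A) (s : Set E) (hs : IsOpen s) (hu : ∀ a ∈ s, IsUnit (c + ℓ a)) :
    ContDiffOn ℝ (⊤ : ℕ∞) (fun a => Ring.inverse (c + ℓ a)) s ∧
    ∀ m : ℕ, ∀ a ∈ s, ‖iteratedFDerivWithin ℝ m (fun a => Ring.inverse (c + ℓ a)) s a‖ ≤
      (m.factorial : ℝ) * ‖ℓ‖ ^ m * ‖Ring.inverse (c + ℓ a)‖ ^ (m + 1) := by
  have hcd : ContDiffOn ℝ (⊤ : ℕ∞) (fun a => Ring.inverse (c + ℓ a)) s := by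
    intro a ha
    obtain ⟨v, hv⟩ := hu a ha
    have h1 : ContDiffAt ℝ (⊤ : ℕ∞) Ring.inverse (c + ℓ a) := by
      rw [← hv]; exact contDiffAt_ringInverse ℝ v
    have h2 : ContDiffAt ℝ (⊤ : ℕ∞) (fun a => c + ℓ a) a := by fun_prop
    exact (h1.comp a h2).contDiffWithinAt
  refine ⟨hcd, ?_⟩
  have hud := hs.uniqueDiffOn (𝕜 := ℝ)
  let L : A →L[ℝ] (E →L[ℝ] A) :=
    -((ContinuousLinearMap.compL ℝ E A A).flip ℓ).comp (ContinuousLinearMap.mul ℝ A)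
  have hL : ‖L‖ ≤ ‖ℓ‖ := by
    refine ContinuousLinearMap.opNorm_le_bound _ (norm_nonneg _) fun b => ?_
    refine ContinuousLinearMap.opNorm_le_bound _ (by positivity) fun v => ?_
    simp only [L, neg_apply, ContinuousLinearMap.comp_apply,
      ContinuousLinearMap.flip_apply, ContinuousLinearMap.compL_apply, norm_neg,
      ContinuousLinearMap.mul_apply']
    calc ‖b * ℓ v‖ ≤ ‖b‖ * ‖ℓ v‖ := norm_mul_le _ _
      _ ≤ ‖b‖ * (‖ℓ‖ * ‖v‖) := by gcongr; exact ℓ.le_opNorm v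
      _ = _ := by ring
  have hder : ∀ a ∈ s, fderivWithin ℝ (fun a => Ring.inverse (c + ℓ a)) s a =
      L (Ring.inverse (c + ℓ a) * Ring.inverse (c + ℓ a)) := by
    intro a ha
    rw [fderivWithin_of_isOpen hs ha]
    obtain ⟨v, hv⟩ := hu a ha
    have h1 := hasFDerivAt_ringInverse (𝕜 := ℝ) v
    rw [hv] at h1
    have h2 : HasFDerivAt (fun a => c + ℓ a) ℓ a := ℓ.hasFDerivAt.const_add c
    have h3 := (h1.comp a h2).fderiv
    have h4 : (Ring.inverse ∘ fun a => c + ℓ a) = (fun a => Ring.inverse (c + ℓ a)) := rfl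
    rw [h4] at h3
    rw [h3]
    ext w
    simp only [L, neg_apply, ContinuousLinearMap.comp_apply,
      ContinuousLinearMap.flip_apply, ContinuousLinearMap.compL_apply,
      ContinuousLinearMap.mul_apply', ContinuousLinearMap.mulLeftRight_apply]
    rw [← hv, Ring.inverse_unit]
    ring
  intro m
  induction m using Nat.strong_induction_on with
  | _ m ih =>
    intro a ha
    rcases m with _ | m
    · simp
    rw [← norm_iteratedFDerivWithin_fderivWithin hud ha,
      iteratedFDerivWithin_congr hder ha]
    have h5 : ContDiffOn ℝ (⊤ : ℕ∞)
      (fun a => Ring.inverse (c + ℓ a) * Ring.inverse (c + ℓ a)) s := hcd.mul hcd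
    have h6 := L.norm_iteratedFDerivWithin_comp_left (f := fun a => Ring.inverse (c + ℓ a) * Ring.inverse (c + ℓ a))
      (h5.contDiffWithinAt ha) hud ha (n := m) (by exact_mod_cast le_top)
    refine h6.trans ?_
    have h7 := norm_iteratedFDerivWithin_mul_le hcd hcd hud ha (n := m) (by exact_mod_cast le_top)
    set F := ‖Ring.inverse (c + ℓ a)‖ with hF
    have h8 : ∑ i ∈ Finset.range (m + 1), (m.choose i : ℝ) *
        ‖iteratedFDerivWithin ℝ i (fun a => Ring.inverse (c + ℓ a)) s a‖ *
        ‖iteratedFDerivWithin ℝ (m - i) (fun a => Ring.inverse (c + ℓ a)) s a‖ ≤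
        ∑ i ∈ Finset.range (m + 1), (m.factorial : ℝ) * ‖ℓ‖ ^ m * F ^ (m + 2) := by
      refine Finset.sum_le_sum fun i hi => ?_
      have hi' : i ≤ m := by simpa [Nat.lt_succ_iff] using hi
      have hm : (m.choose i * i.factorial * (m - i).factorial : ℝ) = m.factorial := by
        exact_mod_cast Nat.choose_mul_factorial_mul_factorial hi'
      calc _ ≤ (m.choose i : ℝ) * ((i.factorial : ℝ) * ‖ℓ‖ ^ i * F ^ (i + 1)) *
            (((m - i).factorial : ℝ) * ‖ℓ‖ ^ (m - i) * F ^ (m - i + 1)) := by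
            gcongr
            · exact ih i (by omega) a ha
            · exact ih (m - i) (by omega) a ha
        _ = (m.choose i * i.factorial * (m - i).factorial : ℝ) * (‖ℓ‖ ^ (i + (m - i))) *
            F ^ ((i + 1) + (m - i + 1)) := by rw [pow_add, pow_add F]; ring
        _ = _ := by
            rw [hm]; congr 2
            · congr 1; omega
            · omega
    calc _ ≤ ‖ℓ‖ * ∑ i ∈ Finset.range (m + 1), (m.factorial : ℝ) * ‖ℓ‖ ^ m * F ^ (m + 2) := by
          gcongr
          exact h7.trans h8
      _ = _ := by
          rw [Finset.sum_const, Finset.card_range, Nat.factorial_succ]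
          push_cast; rw [nsmul_eq_mul]; push_cast; ring

theorem mond_cutoff : ∃ (g : (Fin 4 → ℝ) → ℝ) (G : ℕ → ℝ), (∀ m, 0 ≤ G m) ∧
    ContDiff ℝ (⊤ : ℕ∞) g ∧ (∀ b, g b ≠ 0 → ‖b‖ ≤ 1) ∧
    (∀ (L : ℕ) (m : ℕ) (v a : Fin 4 → ℝ),
      ‖iteratedFDeriv ℝ m (fun a => g ((L : ℝ) • a - v)) a‖ ≤ (L : ℝ) ^ m * G m) ∧
    (∀ (L : ℕ) (b : Fin 4 → ℝ), (∀ i, |b i| ≤ L) →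
      ∑ ν ∈ Fintype.piFinset (fun _ : Fin 4 => Finset.Icc (-(L : ℤ)) L),
        g (b - fun i => (ν i : ℝ)) = 1) := by
  let χ : ℝ → ℝ := fun t => Real.smoothTransition (t + 1) - Real.smoothTransition t
  have hχs : ContDiff ℝ (⊤ : ℕ∞) χ := by
    have := Real.smoothTransition.contDiff (n := (⊤ : ℕ∞))
    exact (this.comp (contDiff_id.add contDiff_const)).sub this
  have hχ0 : ∀ t, χ t ≠ 0 → |t| ≤ 1 := by
    intro t ht
    by_contra hcon
    apply ht
    rcases lt_abs.1 (not_le.1 hcon) with h | h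
    · simp only [χ]
      rw [Real.smoothTransition.one_of_one_le (by linarith),
        Real.smoothTransition.one_of_one_le (by linarith)]; simp
    · simp only [χ]
      rw [Real.smoothTransition.zero_of_nonpos (by linarith),
        Real.smoothTransition.zero_of_nonpos (by linarith)]; simp
  have hχsum : ∀ (L : ℕ) (t : ℝ), |t| ≤ L → ∑ n ∈ Finset.Icc (-(L : ℤ)) L, χ (t - (n : ℝ)) = 1 := by
    intro L t ht
    have key : ∀ M : ℕ, ∑ n ∈ Finset.Icc (-(M : ℤ)) M, χ (t - (n : ℝ)) =
        Real.smoothTransition (t + M + 1) - Real.smoothTransition (t - M) := by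
      intro M
      induction M with
      | zero => simp [χ]
      | succ M ih =>
        have : Finset.Icc (-((M + 1 : ℕ) : ℤ)) ((M + 1 : ℕ) : ℤ) =
            insert (-((M + 1 : ℕ) : ℤ)) (insert ((M + 1 : ℕ) : ℤ) (Finset.Icc (-(M : ℤ)) M)) := by
          ext n; simp only [Finset.mem_Icc, Finset.mem_insert]; push_cast; omega
        rw [this, Finset.sum_insert, Finset.sum_insert, ih]
        · simp only [χ]; push_cast; ring_nf
        · simp
        · simp only [Finset.mem_Icc, Finset.mem_insert]; push_cast; omega
    rw [key L]
    have := abs_le.1 ht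
    rw [Real.smoothTransition.one_of_one_le (by linarith),
        Real.smoothTransition.zero_of_nonpos (by linarith)]; simp
  let g : (Fin 4 → ℝ) → ℝ := fun b => ∏ i, χ (b i)
  have hgs : ContDiff ℝ (⊤ : ℕ∞) g := by
    refine contDiff_prod fun i _ => ?_
    exact hχs.comp (contDiff_apply ℝ ℝ i)
  have hg0 : ∀ b, g b ≠ 0 → ‖b‖ ≤ 1 := by
    intro b hb
    rw [pi_norm_le_iff_of_nonneg zero_le_one]
    intro i
    exact hχ0 _ (Finset.prod_ne_zero_iff.1 hb i (Finset.mem_univ i))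
  have hsupp : HasCompactSupport g := by
    refine HasCompactSupport.intro (isCompact_closedBall (0 : Fin 4 → ℝ) 1) fun b hb => ?_
    by_contra h
    exact hb (by simpa using hg0 b h)
  have hbd : ∀ m : ℕ, ∃ C, ∀ b, ‖iteratedFDeriv ℝ m g b‖ ≤ C := by
    intro m
    have h1 : Continuous (iteratedFDeriv ℝ m g) :=
      hgs.continuous_iteratedFDeriv (by exact_mod_cast le_top)
    exact (hsupp.iteratedFDeriv m).exists_bound_of_continuous h1
  choose G hG using hbd
  refine ⟨g, G, fun m => (norm_nonneg _).trans (hG m 0), hgs, hg0, ?_, ?_⟩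
  · intro L m v a
    have h1 : (fun a => g ((L : ℝ) • a - v)) =
        (fun b => g (b - v)) ∘ ((L : ℝ) • ContinuousLinearMap.id ℝ (Fin 4 → ℝ)) := by
      ext a; simp
    have h2 : ContDiff ℝ (⊤ : ℕ∞) (fun b => g (b - v)) := hgs.comp (contDiff_id.sub contDiff_const)
    rw [h1, ContinuousLinearMap.iteratedFDeriv_comp_right _ h2 a (i := m) (by exact_mod_cast le_top)]
    refine (ContinuousMultilinearMap.norm_compContinuousLinearMap_le _ _).trans ?_
    rw [iteratedFDeriv_comp_sub]
    rw [mul_comm]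
    gcongr
    · rw [Finset.prod_const, Finset.card_univ, Fintype.card_fin]
      gcongr
      rw [norm_smul]
      calc _ ≤ ‖(L : ℝ)‖ * 1 := by gcongr; exact ContinuousLinearMap.norm_id_le
        _ = L := by simp
    · exact hG _ _
  · intro L b hb
    have := Finset.prod_univ_sum (fun _ : Fin 4 => Finset.Icc (-(L : ℤ)) L)
      (fun i n => χ (b i - (n : ℝ)))
    calc _ = ∑ ν ∈ Fintype.piFinset (fun _ : Fin 4 => Finset.Icc (-(L : ℤ)) L),
        ∏ i, χ (b i - (ν i : ℝ)) := rfl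
      _ = ∏ i, ∑ n ∈ Finset.Icc (-(L : ℤ)) L, χ (b i - (n : ℝ)) := this.symm
      _ = 1 := Finset.prod_eq_one fun i _ => hχsum L _ (hb i)

def mondP {R : Type*} [CommRing R] [Algebra ℝ R] (a : Fin 4 → ℝ) (x : R) : R :=
  x ^ 4 + a 3 • x ^ 3 + a 2 • x ^ 2 + a 1 • x + a 0 • (1 : R)

/-- Every complex number is a Joukowski image of a point outside the open unit disc. -/
theorem mond_jouk (r : ℂ) : ∃ z : ℂ, 1 ≤ ‖z‖ ∧ (z + z⁻¹) / 2 = r := by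
  obtain ⟨w, hw⟩ := IsAlgClosed.exists_pow_nat_eq (r ^ 2 - 1) (n := 2) (by norm_num)
  have h1 : (r + w) * (r - w) = 1 := by linear_combination -hw
  have h2 : r + w ≠ 0 := left_ne_zero_of_mul_eq_one h1
  have h3 : r - w ≠ 0 := right_ne_zero_of_mul_eq_one h1
  have h4 : ‖r + w‖ * ‖r - w‖ = 1 := by rw [← norm_mul, h1, norm_one]
  by_cases h : 1 ≤ ‖r + w‖
  · refine ⟨r + w, h, ?_⟩
    rw [inv_eq_of_mul_eq_one_right h1]; ring
  · refine ⟨r - w, ?_, ?_⟩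
    · push Not at h
      by_contra h'
      push Not at h'
      nlinarith [norm_nonneg (r + w), norm_nonneg (r - w), norm_pos_iff.2 h2, norm_pos_iff.2 h3]
    · rw [inv_eq_of_mul_eq_one_left h1]; ring

theorem mond_prod_lower (s : Multiset ℂ) (X : ℂ) (b : ℝ) (hb : 0 ≤ b)
    (h : ∀ r ∈ s, b ≤ ‖X - r‖) : b ^ (Multiset.card s) ≤ ‖(s.map (fun r => X - r)).prod‖ := by
  induction s using Multiset.induction_on with
  | empty => simp
  | cons r s ih =>
    rw [Multiset.card_cons, Multiset.map_cons, Multiset.prod_cons, norm_mul, pow_succ, mul_comm]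
    have h1 := h r (Multiset.mem_cons_self r s)
    have h2 := ih (fun r' hr' => h r' (Multiset.mem_cons_of_mem hr'))
    gcongr

theorem mond_roots (a : Fin 4 → ℝ) : ∃ s : Multiset ℂ, Multiset.card s = 4 ∧
    ∀ X : ℂ, mondP a X = (s.map (fun r => X - r)).prod := by
  open Polynomial in
  let p : ℂ[X] := X ^ 4 + (C (a 3 : ℂ) * X ^ 3 + C (a 2 : ℂ) * X ^ 2 + C (a 1 : ℂ) * X + C (a 0 : ℂ))
  have hdeg : (Polynomial.C (a 3 : ℂ) * Polynomial.X ^ 3 + Polynomial.C (a 2 : ℂ) * Polynomial.X ^ 2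
      + Polynomial.C (a 1 : ℂ) * Polynomial.X + Polynomial.C (a 0 : ℂ)).degree < ((4 : ℕ) : WithBot ℕ) :=
    lt_of_le_of_lt Polynomial.degree_cubic_le (by norm_num)
  have hm : p.Monic := Polynomial.monic_X_pow_add hdeg
  have hn : p.natDegree = 4 := by
    refine Polynomial.natDegree_eq_of_degree_eq_some ?_
    have hlt := hdeg
    rw [← Polynomial.degree_X_pow (R := ℂ) 4] at hlt
    rw [← Polynomial.degree_X_pow (R := ℂ) 4]
    exact Polynomial.degree_add_eq_left_of_degree_lt hlt
  have hs : p.Splits := IsAlgClosed.splits p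
  refine ⟨p.roots, ?_, fun X => ?_⟩
  · rw [← hn]; exact hs.natDegree_eq_card_roots.symm
  · have h1 := hs.eq_prod_roots
    rw [hm.leadingCoeff] at h1
    have h2 := congrArg (Polynomial.eval X) h1
    rw [Polynomial.eval_mul, Polynomial.eval_C, one_mul, Polynomial.eval_multiset_prod,
      Multiset.map_map] at h2
    have h3 : p.eval X = mondP a X := by
      simp [p, mondP]; ring
    rw [← h3, h2]
    simp

theorem mond_level (k : ℕ) (hk : 1 ≤ k) (a : Fin 4 → ℝ) :
    ∃ ρ : ℝ, 1 + 1 / (k : ℝ) ≤ ρ ∧ ρ ≤ 1 + 5 / (k : ℝ) ∧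
      ∀ ζ : ℂ, ‖ζ‖ = ρ → (1 / (24 * (k : ℝ) ^ 2)) ^ 4 ≤ ‖mondP a ((ζ + ζ⁻¹) / 2)‖ := by
  obtain ⟨s, hs4, hs⟩ := mond_roots a
  choose z hz1 hz2 using mond_jouk
  have hk0 : (0 : ℝ) < k := by exact_mod_cast hk
  have hk1 : (1 : ℝ) ≤ k := by exact_mod_cast hk
  have hpig : ∃ j ∈ Finset.Icc (1 : ℕ) 5, ∀ r ∈ s, 1 / (2 * (k : ℝ)) ≤ |1 + (j : ℝ) / k - ‖z r‖| := by
    by_contra hcon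
    push Not at hcon
    choose! R hR1 hR2 using hcon
    have hcard : s.toFinset.card < (Finset.Icc (1 : ℕ) 5).card := by
      refine lt_of_le_of_lt (Multiset.toFinset_card_le s) ?_
      rw [hs4]; simp
    obtain ⟨j, hj, j', hj', hne, heq⟩ := Finset.exists_ne_map_eq_of_card_lt_of_maps_to hcard
      (f := R) (fun j hj => by simpa using hR1 j hj)
    have e1 := abs_lt.1 (hR2 j hj)
    have e2 := abs_lt.1 (hR2 j' hj')
    rw [heq] at e1
    have e3 : |((j : ℝ) - j') / k| < 1 / k := by
      have : (1 : ℝ) / k = 1 / (2 * k) + 1 / (2 * k) := by field_simp; norm_num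
      rw [sub_div, abs_lt, this]
      constructor <;> linarith
    rw [abs_div, abs_of_pos hk0, div_lt_div_iff_of_pos_right hk0] at e3
    have e4 : |(j : ℤ) - j'| < 1 := by exact_mod_cast e3
    rw [Int.abs_lt_one_iff] at e4
    omega
  obtain ⟨j, hj, hjr⟩ := hpig
  rw [Finset.mem_Icc] at hj
  have hj1 : (1 : ℝ) ≤ j := by exact_mod_cast hj.1
  have hj5 : (j : ℝ) ≤ 5 := by exact_mod_cast hj.2
  refine ⟨1 + (j : ℝ) / k, by gcongr, by gcongr, fun ζ hζ => ?_⟩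
  rw [hs, ← hs4]
  refine mond_prod_lower s _ _ (by positivity) fun r hr => ?_
  have hζ0 : ζ ≠ 0 := by
    rw [← norm_pos_iff, hζ]; positivity
  have hz0 : z r ≠ 0 := by
    rw [← norm_pos_iff]; linarith [hz1 r]
  have e' : ∀ w : ℂ, w ≠ 0 →
      (ζ + ζ⁻¹) / 2 - (w + w⁻¹) / 2 = (ζ - w) * (ζ - w⁻¹) / (2 * ζ) := by
    intro w hw
    field_simp
    ring
  have e : (ζ + ζ⁻¹) / 2 - r = (ζ - z r) * (ζ - (z r)⁻¹) / (2 * ζ) := by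
    rw [← e' (z r) hz0, hz2 r]
  have hjk : (j : ℝ) / k ≤ 5 := by
    rw [div_le_iff₀ hk0]; nlinarith
  have hjk1 : 1 / (k : ℝ) ≤ (j : ℝ) / k := by gcongr
  have f1 : 1 / (2 * (k : ℝ)) ≤ ‖ζ - z r‖ := by
    refine (hjr r hr).trans ?_
    rw [← hζ]; exact abs_norm_sub_norm_le _ _
  have f2 : 1 / (k : ℝ) ≤ ‖ζ - (z r)⁻¹‖ := by
    have g1 := norm_sub_norm_le ζ (z r)⁻¹
    have g2 : ‖(z r)⁻¹‖ ≤ 1 := by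
      rw [norm_inv]; exact inv_le_one_of_one_le₀ (hz1 r)
    rw [hζ] at g1
    linarith
  rw [e, norm_div, norm_mul, norm_mul, hζ, Complex.norm_ofNat]
  calc 1 / (24 * (k : ℝ) ^ 2) = (1 / (2 * (k : ℝ))) * (1 / k) / 12 := by field_simp; norm_num
    _ ≤ ‖ζ - z r‖ * ‖ζ - (z r)⁻¹‖ / (2 * (1 + (j : ℝ) / k)) := by
      gcongr; linarith

noncomputable def mondX (ρ θ : ℝ) : ℂ := (circleMap 0 ρ θ + (circleMap 0 ρ θ)⁻¹) / 2

noncomputable def mondW (ρ : ℝ) (k : ℕ) (θ : ℝ) : ℂ :=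
  (1 / (4 * Real.pi)) * ((circleMap 0 ρ θ) ^ (k + 1) * ((1 - ((circleMap 0 ρ θ)⁻¹) ^ 2) / 2))

theorem mond_circle_ne (ρ : ℝ) (hρ : 1 < ρ) (θ : ℝ) : circleMap 0 ρ θ ≠ 0 := by
  have : ‖circleMap 0 ρ θ‖ = ρ := by simp [abs_of_pos (by linarith : 0 < ρ)]
  rw [← norm_pos_iff, this]; linarith

theorem mond_factor (t : ℝ) (ζ : ℂ) (hζ : ζ ≠ 0) :
    (ζ + ζ⁻¹) / 2 - (Real.cos t : ℂ) =
      (ζ - Complex.exp (t * Complex.I)) * (ζ - Complex.exp (-t * Complex.I)) / (2 * ζ) := by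
  rw [Complex.ofReal_cos, Complex.cos]
  have h : Complex.exp (t * Complex.I) * Complex.exp (-t * Complex.I) = 1 := by
    rw [← Complex.exp_add]; simp
  generalize Complex.exp (t * Complex.I) = z at *
  generalize Complex.exp (-t * Complex.I) = z' at *
  field_simp
  linear_combination (-1 : ℂ) * h

theorem mond_norm_exp (t : ℝ) : ‖Complex.exp (t * Complex.I)‖ = 1 ∧
    ‖Complex.exp (-t * Complex.I)‖ = 1 := by
  refine ⟨Complex.norm_exp_ofReal_mul_I t, ?_⟩
  have := Complex.norm_exp_ofReal_mul_I (-t)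
  rwa [Complex.ofReal_neg] at this

theorem mond_X_lower (ρ : ℝ) (hρ : 1 < ρ) (θ t : ℝ) :
    (ρ - 1) ^ 2 / (2 * ρ) ≤ ‖mondX ρ θ - (Real.cos t : ℂ)‖ := by
  have hn : ‖circleMap 0 ρ θ‖ = ρ := by simp [abs_of_pos (by linarith : 0 < ρ)]
  rw [mondX, mond_factor t _ (mond_circle_ne ρ hρ θ), norm_div, norm_mul, norm_mul, hn,
    Complex.norm_ofNat]
  have h1 := norm_sub_norm_le (circleMap 0 ρ θ) (Complex.exp (t * Complex.I))
  have h2 := norm_sub_norm_le (circleMap 0 ρ θ) (Complex.exp (-t * Complex.I))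
  rw [hn, (mond_norm_exp t).1] at h1
  rw [hn, (mond_norm_exp t).2] at h2
  rw [sq]
  have : 0 ≤ ρ - 1 := by linarith
  gcongr

theorem mond_cauchy (ρ : ℝ) (hρ : 1 < ρ) (k : ℕ) (hk : 1 ≤ k) (t : ℝ) :
    ∫ θ in (0 : ℝ)..(2 * Real.pi), mondW ρ k θ * (mondX ρ θ - (Real.cos t : ℂ))⁻¹ =
      (Real.cos (k * t) : ℂ) := by
  have hρ0 : 0 < ρ := by linarith
  have hC : ∀ w : ℂ, ‖w‖ < ρ → (∮ ζ in C(0, ρ), (ζ - w)⁻¹ • ζ ^ k) =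
      (2 * Real.pi * Complex.I : ℂ) • w ^ k := by
    intro w hw
    have hd : DiffContOnCl ℂ (fun ζ : ℂ => ζ ^ k) (Metric.ball 0 ρ) :=
      (differentiable_id.pow k).diffContOnCl
    exact hd.circleIntegral_sub_inv_smul (by simpa using hw)
  have hI : ∀ w : ℂ, ‖w‖ < ρ → CircleIntegrable (fun ζ : ℂ => (ζ - w)⁻¹ • ζ ^ k) 0 ρ := by
    intro w hw
    refine ContinuousOn.circleIntegrable hρ0.le ?_
    have c1 : ContinuousOn (fun ζ : ℂ => (ζ - w)⁻¹) (Metric.sphere 0 ρ) := by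
      refine ContinuousOn.inv₀ (by fun_prop) ?_
      intro ζ hζ h0
      have : ‖ζ‖ = ρ := by simpa using hζ
      rw [sub_eq_zero.1 h0] at this
      linarith
    exact c1.smul (by fun_prop : ContinuousOn (fun ζ : ℂ => ζ ^ k) _)
  obtain ⟨n1, n2⟩ := mond_norm_exp t
  set z := Complex.exp (t * Complex.I) with hz
  set z' := Complex.exp (-t * Complex.I) with hz'
  have e1 := hC z (by linarith)
  have e2 := hC z' (by linarith)
  have e3 := hC 0 (by simpa using hρ0)
  have hsum : (∮ ζ in C(0, ρ), ((ζ - z)⁻¹ • ζ ^ k + (ζ - z')⁻¹ • ζ ^ k - (ζ - 0)⁻¹ • ζ ^ k)) =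
      (2 * Real.pi * Complex.I : ℂ) * (z ^ k + z' ^ k) := by
    have hadd : CircleIntegrable (fun ζ => (ζ - z)⁻¹ • ζ ^ k + (ζ - z')⁻¹ • ζ ^ k) 0 ρ :=
      (hI z (by linarith)).add (hI z' (by linarith))
    rw [circleIntegral.integral_sub hadd
      (hI 0 (by simpa using hρ0)), circleIntegral.integral_add (hI z (by linarith))
      (hI z' (by linarith)), e1, e2, e3]
    rw [zero_pow (by omega)]
    simp only [smul_eq_mul]; ring
  have hcos : (Real.cos (k * t) : ℂ) = (z ^ k + z' ^ k) / 2 := by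
    rw [Complex.ofReal_cos, Complex.cos, hz, hz', ← Complex.exp_nat_mul, ← Complex.exp_nat_mul]
    push_cast
    ring_nf
  have hpi : (Real.pi : ℂ) ≠ 0 := by exact_mod_cast Real.pi_ne_zero
  have hfin : (Real.cos (k * t) : ℂ) = (4 * Real.pi * Complex.I : ℂ)⁻¹ *
      (∮ ζ in C(0, ρ), ((ζ - z)⁻¹ • ζ ^ k + (ζ - z')⁻¹ • ζ ^ k - (ζ - 0)⁻¹ • ζ ^ k)) := by
    rw [hsum, hcos]
    have := Complex.I_ne_zero
    field_simp; norm_num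
  rw [hfin, circleIntegral, ← intervalIntegral.integral_const_mul]
  refine intervalIntegral.integral_congr fun θ _ => ?_
  have hζ := mond_circle_ne ρ hρ θ
  have hn : ‖circleMap 0 ρ θ‖ = ρ := by simp [abs_of_pos hρ0]
  simp only [mondW, mondX, mond_factor t _ hζ, deriv_circleMap, smul_eq_mul, sub_zero]
  rw [← hz, ← hz']
  have hzz : z * z' = 1 := by rw [hz, hz', ← Complex.exp_add]; simp
  set ζ := circleMap 0 ρ θ
  have d1 : ζ - z ≠ 0 := by
    intro h; rw [sub_eq_zero.1 h] at hn; linarith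
  have d2 : ζ - z' ≠ 0 := by
    intro h; rw [sub_eq_zero.1 h] at hn; linarith
  have := Complex.I_ne_zero
  field_simp
  linear_combination (ζ * ζ ^ k) * hzz

def mondR (a J : Fin 4 → ℝ) (x : ℝ) : ℝ :=
  (J 3 + a 3 * J 2 + a 2 * J 1 + a 1 * J 0) + (J 2 + a 3 * J 1 + a 2 * J 0) * x
    + (J 1 + a 3 * J 0) * x ^ 2 + J 0 * x ^ 3

open BoundedContinuousFunction in
theorem mond_bcf_inv (f : ℝ →ᵇ ℂ) (c : ℝ) (hc : 0 < c) (h : ∀ θ, c ≤ ‖f θ‖) :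
    ∃ g : ℝ →ᵇ ℂ, ‖g‖ ≤ 1 / c ∧ ∀ θ, g θ = (f θ)⁻¹ := by
  have hne : ∀ θ, f θ ≠ 0 := fun θ h0 => by
    have := h θ; rw [h0, norm_zero] at this; linarith
  have hb : ∀ θ, ‖(f θ)⁻¹‖ ≤ 1 / c := fun θ => by
    rw [norm_inv, one_div]
    exact inv_anti₀ hc (h θ)
  refine ⟨BoundedContinuousFunction.ofNormedAddCommGroup (fun θ => (f θ)⁻¹)
    (f.continuous.inv₀ hne) (1 / c) hb, ?_, fun θ => rfl⟩
  exact BoundedContinuousFunction.norm_ofNormedAddCommGroup_le _ (by positivity) _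

open BoundedContinuousFunction in
theorem mond_bcf_int : ∃ Λ : (ℝ →ᵇ ℂ) →L[ℝ] ℝ, ‖Λ‖ ≤ 2 * Real.pi ∧
    ∀ f : ℝ →ᵇ ℂ, Λ f = (∫ θ in (0 : ℝ)..(2 * Real.pi), f θ).re := by
  have hi : ∀ f : ℝ →ᵇ ℂ, IntervalIntegrable (fun θ => f θ) MeasureTheory.volume 0 (2 * Real.pi) :=
    fun f => f.continuous.intervalIntegrable _ _
  let Λ0 : (ℝ →ᵇ ℂ) →ₗ[ℝ] ℝ :=
    { toFun := fun f => (∫ θ in (0 : ℝ)..(2 * Real.pi), f θ).re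
      map_add' := fun f g => by
        simp only [BoundedContinuousFunction.add_apply]
        rw [intervalIntegral.integral_add (hi f) (hi g), Complex.add_re]
      map_smul' := fun c f => by
        simp only [BoundedContinuousFunction.smul_apply, RingHom.id_apply]
        rw [intervalIntegral.integral_smul, Complex.real_smul, Complex.re_ofReal_mul, smul_eq_mul] }
  have hb : ∀ f, ‖Λ0 f‖ ≤ (2 * Real.pi) * ‖f‖ := by
    intro f
    have h1 : ‖∫ θ in (0 : ℝ)..(2 * Real.pi), f θ‖ ≤ ‖f‖ * |2 * Real.pi - 0| :=
      intervalIntegral.norm_integral_le_of_norm_le_const fun θ _ => f.norm_coe_le_norm θ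
    rw [sub_zero, abs_of_pos (by positivity)] at h1
    calc ‖Λ0 f‖ ≤ ‖∫ θ in (0 : ℝ)..(2 * Real.pi), f θ‖ := Complex.abs_re_le_norm _
      _ ≤ _ := h1.trans_eq (mul_comm _ _)
  exact ⟨Λ0.mkContinuous _ hb, LinearMap.mkContinuous_norm_le _ (by positivity) _, fun f => rfl⟩

open BoundedContinuousFunction in
theorem mond_bcf_XW (ρ : ℝ) (hρ : 1 < ρ) (k : ℕ) (hk : 1 ≤ k) (hρ2 : ρ ≤ 1 + 5 / k) :
    ∃ X W : ℝ →ᵇ ℂ, ‖X‖ ≤ 4 ∧ ‖W‖ ≤ 6 * Real.exp 5 ∧ (∀ θ, X θ = mondX ρ θ) ∧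
      ∀ θ, W θ = mondW ρ k θ := by
  have hk' : (1 : ℝ) ≤ k := by exact_mod_cast hk
  have h6 : ρ ≤ 6 := by
    have : 5 / (k : ℝ) ≤ 5 := by rw [div_le_iff₀ (by linarith)]; linarith
    linarith
  have hn : ∀ θ, ‖circleMap 0 ρ θ‖ = ρ := fun θ => by
    simp [abs_of_pos (by linarith : 0 < ρ)]
  have hni : ∀ θ, ‖(circleMap 0 ρ θ)⁻¹‖ ≤ 1 := fun θ => by
    rw [norm_inv, hn]; exact inv_le_one_of_one_le₀ hρ.le
  have hcont : Continuous fun θ => circleMap 0 ρ θ := continuous_circleMap 0 ρ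
  have hconti : Continuous fun θ => (circleMap 0 ρ θ)⁻¹ := hcont.inv₀ (mond_circle_ne ρ hρ)
  have hX : ∀ θ, ‖mondX ρ θ‖ ≤ 4 := by
    intro θ
    rw [mondX, norm_div, Complex.norm_ofNat]
    have := norm_add_le (circleMap 0 ρ θ) (circleMap 0 ρ θ)⁻¹
    rw [hn] at this
    linarith [hni θ]
  have hW : ∀ θ, ‖mondW ρ k θ‖ ≤ 6 * Real.exp 5 := by
    intro θ
    rw [mondW, norm_mul, norm_mul, norm_pow, hn, norm_div (_ - _), Complex.norm_ofNat]
    have h1 : ‖(1 / (4 * Real.pi) : ℂ)‖ ≤ 1 := by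
      rw [norm_div, norm_one, norm_mul, Complex.norm_ofNat, Complex.norm_real,
        Real.norm_of_nonneg Real.pi_pos.le, div_le_one (by positivity)]
      linarith [Real.pi_gt_three]
    have h2 : ‖1 - ((circleMap 0 ρ θ)⁻¹) ^ 2‖ / 2 ≤ 1 := by
      have h3 := norm_sub_le (1 : ℂ) (((circleMap 0 ρ θ)⁻¹) ^ 2)
      rw [norm_one, norm_pow] at h3
      have h4 := pow_le_one₀ (norm_nonneg _) (hni θ) (n := 2)
      linarith
    have h5 : ρ ^ k ≤ Real.exp 5 := by
      calc ρ ^ k ≤ (Real.exp (5 / k)) ^ k := by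
            have := Real.add_one_le_exp (5 / (k : ℝ))
            gcongr
            linarith
        _ = Real.exp 5 := by
            rw [← Real.exp_nat_mul]; congr 1; field_simp
    calc _ ≤ 1 * (ρ ^ (k + 1) * 1) := by gcongr
      _ = ρ * ρ ^ k := by ring
      _ ≤ 6 * Real.exp 5 := by gcongr
  have hXc : Continuous (mondX ρ) := by unfold mondX; fun_prop
  have hWc : Continuous (mondW ρ k) := by unfold mondW; fun_prop
  exact ⟨BoundedContinuousFunction.ofNormedAddCommGroup _ hXc 4 hX,
    BoundedContinuousFunction.ofNormedAddCommGroup _ hWc _ hW,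
    BoundedContinuousFunction.norm_ofNormedAddCommGroup_le _ (by norm_num) _,
    BoundedContinuousFunction.norm_ofNormedAddCommGroup_le _ (by positivity) _,
    fun θ => rfl, fun θ => rfl⟩

open BoundedContinuousFunction in
theorem mond_bcf_ell (X : ℝ →ᵇ ℂ) (hX : ‖X‖ ≤ 4) :
    ∃ ℓ : (Fin 4 → ℝ) →L[ℝ] (ℝ →ᵇ ℂ), ‖ℓ‖ ≤ 256 ∧
      (∀ a, X ^ 4 + ℓ a = mondP a X) ∧ ∀ a θ, mondP a X θ = mondP a (X θ) := by
  let ℓ : (Fin 4 → ℝ) →L[ℝ] (ℝ →ᵇ ℂ) :=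
    ∑ i : Fin 4, (ContinuousLinearMap.proj (R := ℝ) (φ := fun _ : Fin 4 => ℝ) i).smulRight
      (X ^ (i : ℕ))
  have hl : ∀ a, ℓ a = ∑ i : Fin 4, a i • X ^ (i : ℕ) := by
    intro a; simp [ℓ]
  refine ⟨ℓ, ?_, ?_, ?_⟩
  · refine ContinuousLinearMap.opNorm_le_bound _ (by norm_num) fun a => ?_
    rw [hl]
    have : ∀ i : Fin 4, ‖a i • X ^ (i : ℕ)‖ ≤ ‖a‖ * 64 := by
      intro i
      rw [norm_smul]
      have h1 := norm_le_pi_norm a i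
      have h2 : ‖X ^ (i : ℕ)‖ ≤ 64 := by
        calc ‖X ^ (i : ℕ)‖ ≤ ‖X‖ ^ (i : ℕ) := norm_pow_le _ _
          _ ≤ 4 ^ (i : ℕ) := by gcongr
          _ ≤ 4 ^ 3 := by gcongr; norm_num; omega
          _ = 64 := by norm_num
      gcongr
    calc _ ≤ ∑ i : Fin 4, ‖a‖ * 64 := norm_sum_le_of_le _ fun i _ => this i
      _ = _ := by simp; ring
  · intro a
    rw [hl, mondP, Fin.sum_univ_four]
    simp
    abel
  · intro a θ
    simp [mondP]

open BoundedContinuousFunction in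
theorem mond_local (k : ℕ) (hk : 1 ≤ k) (a0 : Fin 4 → ℝ) (s : Set (Fin 4 → ℝ))
    (hs : s = Metric.ball a0 (2 / (1024 * 24 ^ 4 * k ^ 8 : ℕ))) :
    ∃ J : (Fin 4 → ℝ) → (Fin 4 → ℝ),
      (∀ m, ContDiffOn ℝ (⊤ : ℕ∞) (fun a => J a m) s) ∧
      (∀ m j, ∀ a ∈ s, ‖iteratedFDerivWithin ℝ j (fun a => J a m) s a‖ ≤
        (2 * Real.pi * (6 * Real.exp 5 * 64)) *
          (j.factorial * 256 ^ j * (2 * 24 ^ 4 * k ^ 8) ^ (j + 1))) ∧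
      ∀ a ∈ s, ∀ t : ℝ, |Real.cos (k * t) - mondR a (J a) (Real.cos t)| ≤
        (2 * Real.pi * (6 * Real.exp 5 * (12 * k ^ 2) * (2 * 24 ^ 4 * k ^ 8))) *
          |mondP a (Real.cos t)| := by
  have hk' : (1 : ℝ) ≤ k := by exact_mod_cast hk
  have hk0 : (0 : ℝ) < k := by linarith
  obtain ⟨ρ, hρ1, hρ2, hρ3⟩ := mond_level k hk a0
  have hρ : 1 < ρ := by
    have : 0 < 1 / (k : ℝ) := by positivity
    linarith
  have hρ6 : ρ ≤ 6 := by
    have : 5 / (k : ℝ) ≤ 5 := by rw [div_le_iff₀ (by linarith)]; linarith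
    linarith
  obtain ⟨Λ, hΛ, hΛe⟩ := mond_bcf_int
  obtain ⟨X, W, hX, hW, hXe, hWe⟩ := mond_bcf_XW ρ hρ k hk hρ2
  obtain ⟨ℓ, hℓ, hℓP, hPX⟩ := mond_bcf_ell X hX
  set B : ℝ := 2 * 24 ^ 4 * k ^ 8 with hB
  have hB0 : 0 < B := by positivity
  have hso : IsOpen s := by rw [hs]; exact Metric.isOpen_ball
  have hlow : ∀ a ∈ s, ∀ θ, 1 / B ≤ ‖(X ^ 4 + ℓ a) θ‖ := by
    intro a ha θ
    have h1 : (1 / (24 * (k : ℝ) ^ 2)) ^ 4 ≤ ‖(X ^ 4 + ℓ a0) θ‖ := by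
      rw [hℓP, hPX, hXe]
      exact hρ3 _ (by simp [abs_of_pos (by linarith : 0 < ρ)])
    have h1' : (1 / (24 * (k : ℝ) ^ 2)) ^ 4 = 2 / B := by
      rw [hB]; field_simp
    rw [h1'] at h1
    have h2 : ‖(ℓ (a0 - a)) θ‖ ≤ 1 / B := by
      have h3 : ‖a0 - a‖ ≤ 2 / (1024 * 24 ^ 4 * k ^ 8 : ℕ) := by
        rw [hs, Metric.mem_ball, dist_comm, dist_eq_norm] at ha
        exact ha.le
      calc ‖(ℓ (a0 - a)) θ‖ ≤ ‖ℓ (a0 - a)‖ := norm_coe_le_norm _ _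
        _ ≤ ‖ℓ‖ * ‖a0 - a‖ := ℓ.le_opNorm _
        _ ≤ 256 * (2 / (1024 * 24 ^ 4 * k ^ 8 : ℕ)) := by gcongr
        _ = 1 / B := by rw [hB]; push_cast; field_simp; norm_num
    have h4 : (X ^ 4 + ℓ a0) θ = (X ^ 4 + ℓ a) θ + (ℓ (a0 - a)) θ := by
      rw [map_sub]; simp
    rw [h4] at h1
    have h5 := norm_add_le ((X ^ 4 + ℓ a) θ) ((ℓ (a0 - a)) θ)
    have h6 : 2 / B = 1 / B + 1 / B := by ring
    linarith
  have hinv : ∀ a ∈ s, IsUnit (X ^ 4 + ℓ a) ∧ ‖Ring.inverse (X ^ 4 + ℓ a)‖ ≤ B ∧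
      ∀ θ, Ring.inverse (X ^ 4 + ℓ a) θ = (mondP a (mondX ρ θ))⁻¹ ∧ mondP a (mondX ρ θ) ≠ 0 := by
    intro a ha
    obtain ⟨g, hg1, hg2⟩ := mond_bcf_inv (X ^ 4 + ℓ a) (1 / B) (by positivity) (hlow a ha)
    have hne : ∀ θ, (X ^ 4 + ℓ a) θ ≠ 0 := fun θ h0 => by
      have := hlow a ha θ
      rw [h0, norm_zero] at this
      have : 0 < 1 / B := by positivity
      linarith
    have hm : (X ^ 4 + ℓ a) * g = 1 := by
      ext θ
      rw [mul_apply, hg2, mul_inv_cancel₀ (hne θ)]; rfl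
    have hu : IsUnit (X ^ 4 + ℓ a) := IsUnit.of_mul_eq_one g hm
    have hgi : Ring.inverse (X ^ 4 + ℓ a) = g := by
      calc Ring.inverse (X ^ 4 + ℓ a) = Ring.inverse (X ^ 4 + ℓ a) * ((X ^ 4 + ℓ a) * g) := by
            rw [hm, mul_one]
        _ = g := by rw [← mul_assoc, Ring.inverse_mul_cancel _ hu, one_mul]
    refine ⟨hu, ?_, fun θ => ⟨?_, ?_⟩⟩
    · rw [hgi]; simpa using hg1
    · rw [hgi, hg2, hℓP, hPX, hXe]
    · have := hne θ
      rwa [hℓP, hPX, hXe] at this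
  obtain ⟨hF1, hF2⟩ := mond_inv_bound ℓ (X ^ 4) s hso fun a ha => (hinv a ha).1
  let M : ℕ → ((ℝ →ᵇ ℂ) →L[ℝ] ℝ) := fun m =>
    Λ.comp (ContinuousLinearMap.mul ℝ (ℝ →ᵇ ℂ) (W * X ^ m))
  have hMn : ∀ m : Fin 4, ‖M m‖ ≤ 2 * Real.pi * (6 * Real.exp 5 * 64) := by
    intro m
    have h2 : ‖X ^ (m : ℕ)‖ ≤ 64 := by
        calc ‖X ^ (m : ℕ)‖ ≤ ‖X‖ ^ (m : ℕ) := norm_pow_le _ _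
          _ ≤ 4 ^ (m : ℕ) := by gcongr
          _ ≤ 4 ^ 3 := by gcongr; norm_num; omega
          _ = 64 := by norm_num
    calc ‖M m‖ ≤ ‖Λ‖ * ‖ContinuousLinearMap.mul ℝ (ℝ →ᵇ ℂ) (W * X ^ (m : ℕ))‖ :=
          ContinuousLinearMap.opNorm_comp_le _ _
      _ ≤ ‖Λ‖ * ‖W * X ^ (m : ℕ)‖ := by
          gcongr; exact ContinuousLinearMap.opNorm_mul_apply_le _ _ _
      _ ≤ ‖Λ‖ * (‖W‖ * ‖X ^ (m : ℕ)‖) := by gcongr; exact norm_mul_le _ _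
      _ ≤ _ := by gcongr
  refine ⟨fun a m => M m (Ring.inverse (X ^ 4 + ℓ a)), ?_, ?_, ?_⟩
  · intro m
    exact (M m).contDiff.comp_contDiffOn hF1
  · intro m j a ha
    have h1 := (M m).norm_iteratedFDerivWithin_comp_left (n := j) ((hF1 a ha)) hso.uniqueDiffOn ha
      (by exact_mod_cast le_top)
    refine h1.trans ?_
    have h2 := hF2 j a ha
    have h3 := (hinv a ha).2.1
    have h4 := hMn m
    calc _ ≤ ‖M m‖ * (j.factorial * ‖ℓ‖ ^ j * ‖Ring.inverse (X ^ 4 + ℓ a)‖ ^ (j + 1)) := by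
          gcongr
      _ ≤ _ := by gcongr
  · intro a ha t
    obtain ⟨-, hb, hFe⟩ := hinv a ha
    set F := Ring.inverse (X ^ 4 + ℓ a) with hF
    have hxl : ∀ θ, 1 / (12 * (k : ℝ) ^ 2) ≤ ‖(X - algebraMap ℝ (ℝ →ᵇ ℂ) (Real.cos t)) θ‖ := by
      intro θ
      have h1 := mond_X_lower ρ hρ θ t
      have h2 : 1 / (12 * (k : ℝ) ^ 2) ≤ (ρ - 1) ^ 2 / (2 * ρ) := by
        have h3 : (1 / (k : ℝ)) ^ 2 ≤ (ρ - 1) ^ 2 := by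
          gcongr; linarith
        calc 1 / (12 * (k : ℝ) ^ 2) = (1 / (k : ℝ)) ^ 2 / 12 := by field_simp
          _ ≤ (ρ - 1) ^ 2 / (2 * ρ) := by
            gcongr; linarith
      refine h2.trans (h1.trans (le_of_eq ?_))
      rw [← hXe]; rfl
    obtain ⟨Y, hY1, hY2⟩ := mond_bcf_inv _ _ (by positivity) hxl
    have hY2' : ∀ θ, Y θ = (mondX ρ θ - (Real.cos t : ℂ))⁻¹ := by
      intro θ; rw [hY2, ← hXe]; rfl
    have hXne : ∀ θ, mondX ρ θ - (Real.cos t : ℂ) ≠ 0 := fun θ h0 => by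
      have h1 := mond_X_lower ρ hρ θ t
      rw [h0, norm_zero] at h1
      have : 0 < (ρ - 1) ^ 2 / (2 * ρ) := by
        have : 0 < ρ - 1 := by linarith
        positivity
      linarith
    set x := Real.cos t with hx
    have hcos : Λ (W * Y) = Real.cos (k * t) := by
      rw [hΛe]
      have := mond_cauchy ρ hρ k hk t
      rw [← Complex.ofReal_re (Real.cos (k * t)), ← this]
      congr 1
      refine intervalIntegral.integral_congr fun θ _ => ?_
      simp only [mul_apply]
      rw [hWe, hY2']
    have key : W * Y - ((W * X ^ 3 * F + a 3 • (W * X ^ 2 * F) + a 2 • (W * X ^ 1 * F) +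
        a 1 • (W * X ^ 0 * F)) +
        x • (W * X ^ 2 * F + a 3 • (W * X ^ 1 * F) + a 2 • (W * X ^ 0 * F)) +
        x ^ 2 • (W * X ^ 1 * F + a 3 • (W * X ^ 0 * F)) + x ^ 3 • (W * X ^ 0 * F)) =
        mondP a x • (W * Y * F) := by
      ext θ
      obtain ⟨e1, e2⟩ := hFe θ
      have e3 := hXne θ
      simp only [BoundedContinuousFunction.mul_apply, BoundedContinuousFunction.sub_apply,
        BoundedContinuousFunction.add_apply, BoundedContinuousFunction.smul_apply,
        BoundedContinuousFunction.pow_apply, hXe, hWe, hY2', e1]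
      generalize hQ : mondP a (mondX ρ θ) = Q at e2 ⊢
      simp only [mondP, Complex.real_smul, smul_eq_mul, mul_one] at hQ ⊢
      push_cast
      field_simp
      rw [← hQ]
      ring
    have key2 := congrArg Λ key
    simp only [map_sub, map_add, map_smul, smul_eq_mul, hcos] at key2
    have hR : mondR a (fun m : Fin 4 => M m F) x = ((Λ (W * X ^ 3 * F) + a 3 * Λ (W * X ^ 2 * F) +
        a 2 * Λ (W * X ^ 1 * F) + a 1 * Λ (W * X ^ 0 * F)) +
        x * (Λ (W * X ^ 2 * F) + a 3 * Λ (W * X ^ 1 * F) + a 2 * Λ (W * X ^ 0 * F)) +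
        x ^ 2 * (Λ (W * X ^ 1 * F) + a 3 * Λ (W * X ^ 0 * F)) + x ^ 3 * Λ (W * X ^ 0 * F)) := by
      have : ∀ m : ℕ, M m F = Λ (W * X ^ m * F) := fun m => rfl
      simp only [mondR, this]
      norm_num
      ring
    rw [hR, key2, abs_mul, mul_comm]
    gcongr
    calc |Λ (W * Y * F)| ≤ ‖Λ‖ * ‖W * Y * F‖ := Λ.le_opNorm _
      _ ≤ ‖Λ‖ * (‖W‖ * ‖Y‖ * ‖F‖) := by
        gcongr
        exact (norm_mul_le _ _).trans (by gcongr; exact norm_mul_le _ _)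
      _ ≤ _ := by
        gcongr
        simpa using hY1

theorem mond_piece {E : Type*} [NormedAddCommGroup E] [NormedSpace ℝ E] (g J : E → ℝ) (s K : Set E)
    (hs : IsOpen s) (hK : IsClosed K) (hKs : K ⊆ s) (hg : ContDiff ℝ (⊤ : ℕ∞) g)
    (hgK : ∀ a, g a ≠ 0 → a ∈ K) (hJ : ContDiffOn ℝ (⊤ : ℕ∞) J s) (G D : ℕ → ℝ)
    (hG : ∀ i a, ‖iteratedFDeriv ℝ i g a‖ ≤ G i) (hG0 : ∀ i, 0 ≤ G i)
    (hD : ∀ i, ∀ a ∈ s, ‖iteratedFDerivWithin ℝ i J s a‖ ≤ D i) (hD0 : ∀ i, 0 ≤ D i) :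
    ContDiff ℝ (⊤ : ℕ∞) (fun a => g a * J a) ∧ ∀ j a, ‖iteratedFDeriv ℝ j (fun a => g a * J a) a‖ ≤
      ∑ i ∈ Finset.range (j + 1), (j.choose i : ℝ) * G i * D (j - i) := by
  have hoff : ∀ a, a ∉ s → (fun a => g a * J a) =ᶠ[𝓝 a] fun _ => 0 := by
    intro a ha
    filter_upwards [hK.isOpen_compl.mem_nhds (fun h => ha (hKs h) : a ∈ Kᶜ)] with b hb
    have : g b = 0 := by
      by_contra h; exact hb (hgK b h)
    rw [this, zero_mul]
  refine ⟨?_, ?_⟩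
  · rw [contDiff_iff_contDiffAt]
    intro a
    by_cases ha : a ∈ s
    · exact hg.contDiffAt.mul (hJ.contDiffAt (hs.mem_nhds ha))
    · exact contDiffAt_const.congr_of_eventuallyEq (hoff a ha)
  · intro j a
    by_cases ha : a ∈ s
    · rw [← iteratedFDerivWithin_of_isOpen j hs ha]
      refine (norm_iteratedFDerivWithin_mul_le (N := ((⊤ : ℕ∞) : WithTop ℕ∞)) hg.contDiffOn hJ
        hs.uniqueDiffOn ha (n := j) (by exact_mod_cast le_top)).trans ?_
      refine Finset.sum_le_sum fun i _ => ?_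
      rw [iteratedFDerivWithin_of_isOpen i hs ha]
      have h1 := hG i a
      have h2 := hD (j - i) a ha
      have h3 := hG0 i
      gcongr
    · rw [((hoff a ha).iteratedFDeriv ℝ j).eq_of_nhds]
      have : iteratedFDeriv ℝ j (fun _ : E => (0 : ℝ)) a = 0 := by
        have := iteratedFDeriv_fun_zero (𝕜 := ℝ) (E := E) (F := ℝ) (n := j)
        exact congrFun this a
      rw [this, norm_zero]
      exact Finset.sum_nonneg fun i _ => mul_nonneg (mul_nonneg (by positivity) (hG0 i)) (hD0 _)

theorem mond_glue : ∃ (C : ℕ → ℝ) (M : ℕ → ℕ) (C' : ℝ) (M' : ℕ), ∀ k : ℕ, 1 ≤ k →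
    ∃ J : (Fin 4 → ℝ) → Fin 4 → ℝ,
      (∀ m, ContDiff ℝ (⊤ : ℕ∞) (fun a => J a m)) ∧
      (∀ m j a, ‖iteratedFDeriv ℝ j (fun a => J a m) a‖ ≤ C j * k ^ M j) ∧
      ∀ a, (∀ i, |a i| ≤ 1) → ∀ t : ℝ, |Real.cos (k * t) - mondR a (J a) (Real.cos t)| ≤
        C' * k ^ M' * |mondP a (Real.cos t)| := by
  obtain ⟨g, G, hG0, hg, hgs, hgb, hgsum⟩ := mond_cutoff
  let c : ℝ := 1024 * 24 ^ 4
  let q : ℝ := 2 * Real.pi * (6 * Real.exp 5 * 64)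
  refine ⟨fun j => (3 * c) ^ 4 * ∑ i ∈ Finset.range (j + 1), (j.choose i : ℝ) * (c ^ i * G i) *
      (q * ((j - i).factorial * 256 ^ (j - i) * (2 * 24 ^ 4) ^ (j - i + 1))), fun j => 8 * j + 40,
      (3 * c) ^ 4 * (G 0 * (2 * Real.pi * (6 * Real.exp 5 * 12 * (2 * 24 ^ 4)))), 42, ?_⟩
  intro k hk
  have hk' : (1 : ℝ) ≤ k := by exact_mod_cast hk
  have hk0 : (0 : ℝ) < k := by linarith
  set L : ℕ := 1024 * 24 ^ 4 * k ^ 8 with hL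
  have hLR : (L : ℝ) = c * k ^ 8 := by simp only [hL, c]; push_cast; norm_num
  have hL1 : (1 : ℝ) ≤ L := by
    have : 1 ≤ L := by rw [hL]; exact Nat.one_le_iff_ne_zero.2 (by positivity)
    exact_mod_cast this
  set I := Fintype.piFinset (fun _ : Fin 4 => Finset.Icc (-(L : ℤ)) L) with hI
  have hcard : (I.card : ℝ) ≤ (3 * c) ^ 4 * k ^ 32 := by
    have : I.card = (2 * L + 1) ^ 4 := by
      rw [hI, Fintype.card_piFinset]
      simp
      congr 1
      omega
    rw [this]
    push_cast
    calc (2 * (L : ℝ) + 1) ^ 4 ≤ (3 * L) ^ 4 := by gcongr; linarith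
      _ = _ := by rw [hLR]; ring
  let ctr : (Fin 4 → ℤ) → (Fin 4 → ℝ) := fun ν i => (ν i : ℝ) / L
  have hloc := fun ν : Fin 4 → ℤ => mond_local k hk (ctr ν) _ rfl
  choose Jl hJ1 hJ2 hJ3 using hloc
  let gl : (Fin 4 → ℤ) → (Fin 4 → ℝ) → ℝ := fun ν a => g ((L : ℝ) • a - fun i => (ν i : ℝ))
  have hgl : ∀ ν a, gl ν a ≠ 0 → a ∈ Metric.closedBall (ctr ν) (1 / L) := by
    intro ν a h
    have h1 := hgs _ h
    rw [Metric.mem_closedBall, dist_eq_norm]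
    have h2 : (L : ℝ) • a - (fun i => (ν i : ℝ)) = (L : ℝ) • (a - ctr ν) := by
      rw [smul_sub]; congr 1
      funext i
      simp only [ctr, Pi.smul_apply, smul_eq_mul]
      field_simp
    rw [h2, norm_smul, Real.norm_of_nonneg (by linarith)] at h1
    rw [le_div_iff₀ (by linarith), mul_comm]; exact h1
  have hsub : ∀ ν, Metric.closedBall (ctr ν) (1 / (L : ℝ)) ⊆
      Metric.ball (ctr ν) (2 / ((1024 * 24 ^ 4 * k ^ 8 : ℕ) : ℝ)) := by
    intro ν
    apply Metric.closedBall_subset_ball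
    rw [← hL]
    gcongr
    norm_num
  have hglc : ∀ ν, ContDiff ℝ (⊤ : ℕ∞) (gl ν) := fun ν =>
    hg.comp (by fun_prop : ContDiff ℝ (⊤ : ℕ∞) fun a : Fin 4 → ℝ =>
      (L : ℝ) • a - fun i => (ν i : ℝ))
  have hpiece := fun ν m => mond_piece (gl ν) (fun a => Jl ν a m) _ _ Metric.isOpen_ball
    Metric.isClosed_closedBall (hsub ν)
    (hglc ν) (hgl ν) (hJ1 ν m)
    (fun i => L ^ i * G i) (fun i => q * (i.factorial * 256 ^ i * (2 * 24 ^ 4 * k ^ 8) ^ (i + 1)))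
    (fun i a => hgb _ _ _ _) (fun i => mul_nonneg (by positivity) (hG0 i))
    (fun i a ha => hJ2 ν m i a ha) (fun i => by positivity)
  refine ⟨fun a m => ∑ ν ∈ I, gl ν a * Jl ν a m, ?_, ?_, ?_⟩
  · intro m
    exact ContDiff.sum fun ν _ => (hpiece ν m).1
  · intro m j a
    have h1 : iteratedFDeriv ℝ j (fun a => ∑ ν ∈ I, gl ν a * Jl ν a m) a =
        ∑ ν ∈ I, iteratedFDeriv ℝ j (fun a => gl ν a * Jl ν a m) a := by
      rw [iteratedFDeriv_fun_sum_apply fun ν _ => ((hpiece ν m).1.of_le (by exact_mod_cast le_top)).contDiffAt]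
    rw [h1]
    refine (norm_sum_le_of_le _ fun ν _ => (hpiece ν m).2 j a).trans ?_
    rw [Finset.sum_const, nsmul_eq_mul]
    have h2 : ∑ i ∈ Finset.range (j + 1), (j.choose i : ℝ) * ((L : ℝ) ^ i * G i) *
        (q * ((j - i).factorial * 256 ^ (j - i) * (2 * 24 ^ 4 * (k : ℝ) ^ 8) ^ (j - i + 1))) =
        (∑ i ∈ Finset.range (j + 1), (j.choose i : ℝ) * (c ^ i * G i) *
      (q * ((j - i).factorial * 256 ^ (j - i) * (2 * 24 ^ 4) ^ (j - i + 1)))) * (k : ℝ) ^ (8 * j + 8) := by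
      rw [Finset.sum_mul]
      refine Finset.sum_congr rfl fun i hi => ?_
      have hij : i ≤ j := by have := Finset.mem_range.1 hi; omega
      obtain ⟨l, rfl⟩ := Nat.exists_eq_add_of_le hij
      rw [hLR, Nat.add_sub_cancel_left]
      rw [mul_pow, mul_pow, ← pow_mul, ← pow_mul]
      ring
    rw [h2]
    have h3 : 0 ≤ (∑ i ∈ Finset.range (j + 1), (j.choose i : ℝ) * (c ^ i * G i) *
      (q * ((j - i).factorial * 256 ^ (j - i) * (2 * 24 ^ 4) ^ (j - i + 1)))) :=
      Finset.sum_nonneg fun i _ => mul_nonneg (mul_nonneg (by positivity)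
        (mul_nonneg (by positivity) (hG0 i))) (by positivity)
    calc _ ≤ ((3 * c) ^ 4 * k ^ 32) * (_ * k ^ (8 * j + 8)) := by gcongr
      _ = _ := by
        have e : (k : ℝ) ^ (8 * j + 40) = k ^ 32 * k ^ (8 * j + 8) := by rw [← pow_add]; ring_nf
        simp only [e]; ring
  · intro a ha t
    have hs := hgsum L ((L : ℝ) • a) (fun i => by
      rw [Pi.smul_apply, smul_eq_mul, abs_mul, abs_of_nonneg (by linarith)]
      nlinarith [ha i])
    have hR : Real.cos (k * t) - mondR a (fun m => ∑ ν ∈ I, gl ν a * Jl ν a m) (Real.cos t) =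
        ∑ ν ∈ I, gl ν a * (Real.cos (k * t) - mondR a (Jl ν a) (Real.cos t)) := by
      simp only [mul_sub, Finset.sum_sub_distrib, ← Finset.sum_mul]
      rw [show ∑ ν ∈ I, gl ν a = 1 from hs, one_mul]
      congr 1
      simp only [mondR, mul_add, Finset.sum_add_distrib, Finset.mul_sum, Finset.sum_mul, add_mul]
      simp only [← mul_assoc, mul_comm, mul_left_comm]
    rw [hR]
    have hterm : ∀ ν ∈ I, ‖gl ν a * (Real.cos (k * t) - mondR a (Jl ν a) (Real.cos t))‖ ≤
        G 0 * ((2 * Real.pi * (6 * Real.exp 5 * (12 * k ^ 2) * (2 * 24 ^ 4 * k ^ 8))) *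
          |mondP a (Real.cos t)|) := by
      intro ν _
      by_cases h0 : gl ν a = 0
      · rw [h0, zero_mul, norm_zero]
        exact mul_nonneg (hG0 0) (by positivity)
      · have h1 := hJ3 ν a (hsub ν (hgl ν a h0)) t
        have h2 := hgb L 0 (fun i => (ν i : ℝ)) a
        rw [norm_iteratedFDeriv_zero, pow_zero, one_mul] at h2
        rw [norm_mul]
        exact mul_le_mul h2 h1 (norm_nonneg _) (hG0 0)
    refine (norm_sum_le_of_le _ hterm).trans ?_
    rw [Finset.sum_const, nsmul_eq_mul]
    have := hG0 0
    calc _ ≤ ((3 * c) ^ 4 * k ^ 32) * _ := by gcongr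
      _ = _ := by ring

theorem mond_fourier_decay (M : ℕ) : ∀ (G : ℝ → ℂ), ContDiff ℝ (⊤ : ℕ∞) G →
    (∀ x, G (x + 2 * Real.pi) = G x) → ∃ K : ℝ, 0 ≤ K ∧ ∀ n : ℤ, n ≠ 0 →
      ‖fourierCoeffOn (lt_add_of_pos_right 0 Real.two_pi_pos) G n‖ ≤ K / |(n : ℝ)| ^ M := by
  induction M with
  | zero =>
    intro G hG hp
    obtain ⟨K, hK⟩ := (isCompact_Icc (a := (0 : ℝ)) (b := 0 + 2 * Real.pi)).exists_bound_of_continuousOn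
      hG.continuous.continuousOn
    have hK0 : 0 ≤ K := (norm_nonneg _).trans (hK 0 (by simp [Real.pi_pos.le]))
    refine ⟨K, hK0, fun n _ => ?_⟩
    rw [fourierCoeffOn_eq_integral, pow_zero, div_one, norm_smul]
    have h1 : ‖∫ x in (0 : ℝ)..(0 + 2 * Real.pi),
        fourier (-n) (x : AddCircle (0 + 2 * Real.pi - 0)) • G x‖ ≤ K * |0 + 2 * Real.pi - 0| := by
      refine intervalIntegral.norm_integral_le_of_norm_le_const fun x hx => ?_
      rw [Set.uIoc_of_le (by linarith [Real.pi_pos])] at hx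
      rw [norm_smul]
      have : ‖(fourier (-n) (x : AddCircle (0 + 2 * Real.pi - 0)) : ℂ)‖ = 1 := by
        rw [fourier_apply]; exact Circle.norm_coe _
      rw [this, one_mul]
      exact hK x ⟨hx.1.le, hx.2⟩
    rw [abs_of_pos (by linarith [Real.pi_pos])] at h1
    have h2 : ‖(1 / (0 + 2 * Real.pi - 0) : ℝ)‖ = 1 / (0 + 2 * Real.pi - 0) :=
      Real.norm_of_nonneg (by simp [Real.pi_pos.le])
    rw [h2]
    have hpi := Real.pi_pos
    calc _ ≤ 1 / (0 + 2 * Real.pi - 0) * (K * (0 + 2 * Real.pi - 0)) := by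
          gcongr; simp [Real.pi_pos.le]
      _ = K := by
          have : (0 + 2 * Real.pi - 0) ≠ 0 := by simp [Real.pi_ne_zero]
          field_simp
  | succ M ih =>
    intro G hG hp
    have hG' : ContDiff ℝ (⊤ : ℕ∞) (deriv G) := (contDiff_infty_iff_deriv.1 hG).2
    have hd : ∀ x, HasDerivAt G (deriv G x) x := fun x =>
      ((contDiff_infty_iff_deriv.1 hG).1 x).hasDerivAt
    obtain ⟨K, hK0, hK⟩ := ih (deriv G) hG' (fun x => by
      have h1 : deriv (fun x => G (x + 2 * Real.pi)) x = deriv G x := by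
        congr 1; funext x; exact hp x
      rwa [deriv_comp_add_const] at h1)
    refine ⟨K, hK0, fun n hn => ?_⟩
    rw [fourierCoeffOn_of_hasDerivAt _ hn (fun x _ => hd x) (hG'.continuous.intervalIntegrable _ _)]
    have h0 : G (0 + 2 * Real.pi) - G 0 = 0 := by rw [hp, sub_self]
    rw [h0, mul_zero, zero_sub, norm_mul, norm_neg, norm_mul]
    have hn' : 0 < |(n : ℝ)| := abs_pos.2 (by exact_mod_cast hn)
    have h2 : ‖(1 / (-2 * Real.pi * Complex.I * n) : ℂ)‖ = 1 / (2 * Real.pi * |(n : ℝ)|) := by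
      rw [norm_div, norm_mul, norm_mul, norm_mul, norm_neg, Complex.norm_I, norm_one,
        Complex.norm_ofNat, Complex.norm_real, Complex.norm_intCast,
        Real.norm_of_nonneg Real.pi_pos.le, mul_one]
    have h3 : ‖(((0 + 2 * Real.pi : ℝ) : ℂ) - ((0 : ℝ) : ℂ))‖ = 2 * Real.pi := by
      rw [← Complex.ofReal_sub, Complex.norm_real, Real.norm_of_nonneg (by simp [Real.pi_pos.le])]
      ring
    rw [h2, h3]
    have hpi := Real.pi_pos
    calc _ ≤ 1 / (2 * Real.pi * |(n : ℝ)|) * (2 * Real.pi * (K / |(n : ℝ)| ^ M)) := by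
          gcongr; exact hK n hn
      _ = _ := by field_simp; ring

theorem mond_cheb (f : ℝ → ℝ) (hf : ContDiff ℝ (⊤ : ℕ∞) f) : ∃ c : ℤ → ℝ,
    (∀ M : ℕ, Summable fun n : ℤ => |c n| * |(n : ℝ)| ^ M) ∧
    ∀ t, HasSum (fun n : ℤ => c n * Real.cos (n.natAbs * t)) (f (Real.cos t)) := by
  have : Fact (0 < 2 * Real.pi) := ⟨Real.two_pi_pos⟩
  let G : ℝ → ℂ := fun t => (f (Real.cos t) : ℂ)
  have hG : ContDiff ℝ (⊤ : ℕ∞) G :=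
    Complex.ofRealCLM.contDiff.comp (hf.comp Real.contDiff_cos)
  have hp : Function.Periodic G (2 * Real.pi) := fun x => by simp [G]
  let Gc : C(AddCircle (2 * Real.pi), ℂ) := ⟨hp.lift, continuous_coinduced_dom.2 hG.continuous⟩
  have hGc : ∀ x : ℝ, Gc (x : AddCircle (2 * Real.pi)) = G x := fun x => rfl
  have hlift : (Gc : AddCircle (2 * Real.pi) → ℂ) = AddCircle.liftIco (2 * Real.pi) 0 G := by
    funext z
    obtain ⟨x, hx, rfl⟩ : ∃ x ∈ Set.Ico (0 : ℝ) (0 + 2 * Real.pi),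
        (x : AddCircle (2 * Real.pi)) = z := by
      have := AddCircle.coe_image_Ico_eq (2 * Real.pi) 0
      have hz : z ∈ (QuotientAddGroup.mk '' Set.Ico (0 : ℝ) (0 + 2 * Real.pi) :
        Set (AddCircle (2 * Real.pi))) := by rw [this]; trivial
      exact hz
    rw [AddCircle.liftIco_coe_apply hx, hGc]
  have hco : ∀ n, fourierCoeff Gc n =
      fourierCoeffOn (lt_add_of_pos_right 0 Real.two_pi_pos) G n := fun n => by
    rw [hlift]; exact fourierCoeff_liftIco_eq G n
  have hsum : ∀ M : ℕ, Summable fun n : ℤ => ‖fourierCoeff Gc n‖ * |(n : ℝ)| ^ M := by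
    intro M
    obtain ⟨K, hK0, hK⟩ := mond_fourier_decay (M + 2) G hG hp
    have hs : Summable fun n : ℤ => K * (1 / (n : ℝ) ^ 2) :=
      (Real.summable_one_div_int_pow.2 (by norm_num)).mul_left K
    refine Summable.of_norm_bounded_eventually hs ?_
    have : ({0} : Set ℤ)ᶜ ∈ (cofinite : Filter ℤ) := (Set.finite_singleton 0).compl_mem_cofinite
    filter_upwards [this] with n hn
    have hn' : 0 < |(n : ℝ)| := abs_pos.2 (by exact_mod_cast hn)
    rw [Real.norm_of_nonneg (by positivity), hco]
    calc _ ≤ K / |(n : ℝ)| ^ (M + 2) * |(n : ℝ)| ^ M := by gcongr; exact hK n hn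
      _ = K * (1 / |(n : ℝ)| ^ 2) := by field_simp; ring
      _ = _ := by rw [sq_abs]
  have hs0 : Summable (fourierCoeff Gc) := by
    refine Summable.of_norm ?_
    simpa using hsum 0
  have hpt := fun x : ℝ => has_pointwise_sum_fourier_series_of_summable hs0
    (x : AddCircle (2 * Real.pi))
  refine ⟨fun n => (fourierCoeff Gc n).re, fun M => ?_, fun t => ?_⟩
  · refine Summable.of_nonneg_of_le (fun n => by positivity) (fun n => ?_) (hsum M)
    gcongr
    exact Complex.abs_re_le_norm _
  · have h1 := ((hpt t).add (hpt (-t))).mul_left (1 / 2 : ℂ)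
    have h2 := Complex.hasSum_re h1
    convert h2 using 1
    · funext n
      rw [fourier_coe_apply, fourier_coe_apply]
      have e1 : (2 * Real.pi * Complex.I * n * t / (2 * Real.pi : ℝ) : ℂ) = (n * t : ℝ) * Complex.I := by
        have : (Real.pi : ℂ) ≠ 0 := by exact_mod_cast Real.pi_ne_zero
        push_cast; field_simp
      have e2 : (2 * Real.pi * Complex.I * n * (-t : ℝ) / (2 * Real.pi : ℝ) : ℂ) =
          (-(n * t) : ℝ) * Complex.I := by
        have : (Real.pi : ℂ) ≠ 0 := by exact_mod_cast Real.pi_ne_zero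
        push_cast; field_simp
      rw [e1, e2]
      have e3 : Real.cos (n.natAbs * t) = Real.cos (n * t) := by
        rcases Int.natAbs_eq n with h | h
        · conv_rhs => rw [h]
          simp
        · conv_rhs => rw [h]
          simp
      rw [e3]
      simp only [smul_eq_mul, Complex.exp_mul_I, ← Complex.ofReal_cos, ← Complex.ofReal_sin]
      rw [Real.cos_neg, Real.sin_neg]
      generalize Real.cos (n * t) = c
      generalize Real.sin (n * t) = s
      simp
      ring
    · rw [hGc, hGc]
      simp only [G, Real.cos_neg]
      rw [← Complex.ofReal_add]
      have : (1 / 2 : ℂ) = ((1 / 2 : ℝ) : ℂ) := by push_cast; rfl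
      rw [this, ← Complex.ofReal_mul, Complex.ofReal_re]
      ring

/-- Division of a smooth function by the generic quartic, with smooth remainder. -/
theorem mond_division (f : ℝ → ℝ) (hf : ContDiff ℝ (⊤ : ℕ∞) f) :
    ∃ (r : Fin 4 → (Fin 4 → ℝ) → ℝ) (C : ℝ), (∀ i, ContDiff ℝ (⊤ : ℕ∞) (r i)) ∧ 0 ≤ C ∧
      ∀ a, (∀ i, |a i| ≤ 1) → ∀ x, |x| ≤ 1 →
        |f x - (r 0 a + r 1 a * x + r 2 a * x ^ 2 + r 3 a * x ^ 3)| ≤ C * |mondP a x| := by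
  obtain ⟨c, hc1, hc2⟩ := mond_cheb f hf
  obtain ⟨C, M, C', M', hglue⟩ := mond_glue
  have hex : ∀ k : ℕ, ∃ J : (Fin 4 → ℝ) → Fin 4 → ℝ,
      (∀ m, ContDiff ℝ (⊤ : ℕ∞) (fun a => J a m)) ∧
      (∀ m j a, ‖iteratedFDeriv ℝ j (fun a => J a m) a‖ ≤ |C j| * k ^ M j) ∧
      ∀ a, (∀ i, |a i| ≤ 1) → ∀ t : ℝ,
        |Real.cos (k * t) - mondR a (J a) (Real.cos t) - (if k = 0 then 1 else 0)| ≤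
        |C'| * k ^ M' * |mondP a (Real.cos t)| := by
    intro k
    by_cases hk : k = 0
    · subst hk
      refine ⟨fun _ _ => 0, fun m => contDiff_const, fun m j a => ?_, fun a _ t => ?_⟩
      · have h := congrFun (iteratedFDeriv_fun_zero (𝕜 := ℝ) (E := Fin 4 → ℝ) (F := ℝ) (n := j)) a
        have h' : iteratedFDeriv ℝ j (fun _ : Fin 4 → ℝ => (0 : ℝ)) a = 0 := h
        rw [h', norm_zero]; positivity
      · simp [mondR]; positivity
    · obtain ⟨J, h1, h2, h3⟩ := hglue k (Nat.one_le_iff_ne_zero.2 hk)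
      refine ⟨J, h1, fun m j a => (h2 m j a).trans (by gcongr; exact le_abs_self _),
        fun a ha t => ?_⟩
      rw [if_neg hk, sub_zero]
      refine (h3 a ha t).trans (by gcongr; exact le_abs_self _)
  choose J hJ1 hJ2 hJ3 using hex
  have habs : ∀ n : ℤ, ((n.natAbs : ℕ) : ℝ) = |(n : ℝ)| := fun n => by
    rw [Nat.cast_natAbs]; push_cast; rfl
  let T : Fin 4 → ℤ → (Fin 4 → ℝ) → ℝ := fun m n a => c n * J n.natAbs a m
  have hTb : ∀ m j n a, ‖iteratedFDeriv ℝ j (T m n) a‖ ≤ |C j| * (|c n| * |(n : ℝ)| ^ M j) := by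
    intro m j n a
    have h1 : iteratedFDeriv ℝ j (T m n) a =
        c n • iteratedFDeriv ℝ j (fun a => J n.natAbs a m) a :=
      iteratedFDeriv_const_smul_apply (a := c n)
        (((hJ1 n.natAbs m).of_le (by exact_mod_cast le_top)).contDiffAt)
    rw [h1, norm_smul, Real.norm_eq_abs]
    have := hJ2 n.natAbs m j a
    rw [habs] at this
    calc _ ≤ |c n| * (|C j| * |(n : ℝ)| ^ M j) := by gcongr
      _ = _ := by ring
  have hTs : ∀ j, Summable fun n : ℤ => |C j| * (|c n| * |(n : ℝ)| ^ M j) := fun j =>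
    (hc1 (M j)).mul_left _
  let S : Fin 4 → (Fin 4 → ℝ) → ℝ := fun m a => ∑' n, T m n a
  have hS : ∀ m, ContDiff ℝ (⊤ : ℕ∞) (S m) := fun m =>
    contDiff_tsum (N := ⊤) (fun n => contDiff_const.mul (hJ1 n.natAbs m))
      (fun j _ => hTs j) (fun j n a _ => hTb m j n a)
  have hSs : ∀ m a, HasSum (fun n => T m n a) (S m a) := by
    intro m a
    refine Summable.hasSum (Summable.of_norm_bounded (hTs 0) fun n => ?_)
    have := hTb m 0 n a
    rwa [norm_iteratedFDeriv_zero] at this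
  let r : Fin 4 → (Fin 4 → ℝ) → ℝ := ![fun a => c 0 + (S 3 a + a 3 * S 2 a + a 2 * S 1 a + a 1 * S 0 a),
    fun a => S 2 a + a 3 * S 1 a + a 2 * S 0 a, fun a => S 1 a + a 3 * S 0 a, S 0]
  refine ⟨r, |C'| * ∑' n : ℤ, |c n| * |(n : ℝ)| ^ M', ?_, ?_, ?_⟩
  · have hp : ∀ i : Fin 4, ContDiff ℝ (⊤ : ℕ∞) (fun a : Fin 4 → ℝ => a i) := fun i => contDiff_apply ℝ ℝ i
    intro i
    fin_cases i
    · exact contDiff_const.add ((((hS 3).add ((hp 3).mul (hS 2))).add ((hp 2).mul (hS 1))).add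
        ((hp 1).mul (hS 0)))
    · exact ((hS 2).add ((hp 3).mul (hS 1))).add ((hp 2).mul (hS 0))
    · exact (hS 1).add ((hp 3).mul (hS 0))
    · exact hS 0
  · exact mul_nonneg (abs_nonneg _) (tsum_nonneg fun n => by positivity)
  · intro a ha x hx
    obtain ⟨t, rfl⟩ : ∃ t, Real.cos t = x := ⟨Real.arccos x, Real.cos_arccos (abs_le.1 hx).1 (abs_le.1 hx).2⟩
    set x := Real.cos t
    have hR : HasSum (fun n : ℤ => c n * mondR a (J n.natAbs a) x) (mondR a (fun m => S m a) x) := by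
      have := ((((hSs 3 a).add ((hSs 2 a).mul_left (a 3))).add ((hSs 1 a).mul_left (a 2))).add
        ((hSs 0 a).mul_left (a 1))).add (((((hSs 2 a).add ((hSs 1 a).mul_left (a 3))).add
        ((hSs 0 a).mul_left (a 2))).mul_right x)) |>.add
        (((hSs 1 a).add ((hSs 0 a).mul_left (a 3))).mul_right (x ^ 2)) |>.add
        ((hSs 0 a).mul_right (x ^ 3))
      convert this using 1
      · funext n
        simp only [mondR, T]
        ring
      · rfl
    have h0 : HasSum (fun n : ℤ => if n = 0 then c 0 else 0) (c 0) := hasSum_ite_eq 0 (c 0)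
    have hd := ((hc2 t).sub hR).sub h0
    have hbd : ∀ n : ℤ, ‖c n * Real.cos (n.natAbs * t) - c n * mondR a (J n.natAbs a) x -
        (if n = 0 then c 0 else 0)‖ ≤ (|C'| * |mondP a x|) * (|c n| * |(n : ℝ)| ^ M') := by
      intro n
      have h1 := hJ3 n.natAbs a ha t
      have h2 : c n * Real.cos (n.natAbs * t) - c n * mondR a (J n.natAbs a) x -
        (if n = 0 then c 0 else 0) = c n * (Real.cos (n.natAbs * t) - mondR a (J n.natAbs a) x -
        (if n.natAbs = 0 then 1 else 0)) := by
        by_cases hn : n = 0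
        · subst hn; simp only [Int.natAbs_zero, if_true]; ring
        · simp [hn]; ring
      rw [h2, norm_mul, Real.norm_eq_abs, Real.norm_eq_abs]
      rw [habs] at h1
      calc _ ≤ |c n| * (|C'| * |(n : ℝ)| ^ M' * |mondP a x|) := by
            gcongr
            rw [habs]; exact h1
        _ = _ := by ring
    have hfin := hd.norm_le_of_bounded ((hc1 M').hasSum.mul_left (|C'| * |mondP a x|)) hbd
    have e : f x - (r 0 a + r 1 a * x + r 2 a * x ^ 2 + r 3 a * x ^ 3) =
        f x - mondR a (fun m => S m a) x - c 0 := by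
      simp only [r, mondR, Matrix.cons_val]; ring
    rw [e]
    rw [Real.norm_eq_abs] at hfin
    refine hfin.trans (le_of_eq ?_)
    ring

theorem mond_division' (f : ℝ → ℝ) (hf : ContDiff ℝ (⊤ : ℕ∞) f) :
    ∃ (r : Fin 4 → (Fin 4 → ℝ) → ℝ) (C : ℝ), (∀ i, ContDiff ℝ (⊤ : ℕ∞) (r i)) ∧ 0 ≤ C ∧
      (∀ a, (∀ i, |a i| ≤ 1) → ∀ x, |x| ≤ 1 →
        |f x - (r 0 a + r 1 a * x + r 2 a * x ^ 2 + r 3 a * x ^ 3)| ≤ C * |mondP a x|) ∧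
      r 0 0 = f 0 ∧ r 1 0 = deriv f 0 := by
  obtain ⟨r, C, hr, hC, h⟩ := mond_division f hf
  have h0 : ∀ x : ℝ, |x| ≤ 1 → |f x - (r 0 0 + r 1 0 * x + r 2 0 * x ^ 2 + r 3 0 * x ^ 3)| ≤
      C * |x| ^ 4 := by
    intro x hx
    have := h 0 (by simp) x hx
    simpa [mondP] using this
  refine ⟨r, C, hr, hC, h, ?_, ?_⟩
  · have := h0 0 (by simp)
    simp at this
    linarith [sub_eq_zero.1 this]
  · have hO : (fun x => f x - (r 0 0 + r 1 0 * x + r 2 0 * x ^ 2 + r 3 0 * x ^ 3)) =O[𝓝 (0 : ℝ)]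
        fun x => ‖x - 0‖ ^ 4 := by
      refine Asymptotics.IsBigO.of_bound C ?_
      filter_upwards [Metric.closedBall_mem_nhds (0 : ℝ) one_pos] with x hx
      have := h0 x (by simpa using hx)
      simpa using this
    have h1 := (hO.hasFDerivAt (by norm_num)).hasDerivAt
    have h2 : HasDerivAt f (deriv f 0) 0 := ((hf.differentiable (by simp)) 0).hasDerivAt
    have hx := hasDerivAt_id (0 : ℝ)
    have h3 := ((((hx.const_mul (r 1 0)).const_add (r 0 0)).add ((hx.pow 2).const_mul (r 2 0))).add
      ((hx.pow 3).const_mul (r 3 0)))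
    have h4 := h2.sub h3
    have := h1.unique h4
    simp at this
    linarith

theorem mond_ift {E W : Type*} [NormedAddCommGroup E] [NormedSpace ℝ E] [CompleteSpace E]
    [NormedAddCommGroup W] [NormedSpace ℝ W] [FiniteDimensional ℝ W]
    (F : E × W → W) (p0 : E) (w0 : W) (hF : ContDiffAt ℝ (⊤ : ℕ∞) F (p0, w0))
    (h0 : F (p0, w0) = 0) (L : W →L[ℝ] W) (hL : HasFDerivAt (fun w => F (p0, w)) L w0)
    (hinj : Function.Injective L) :
    ∃ φ : E → W, φ p0 = w0 ∧ ContDiffAt ℝ (⊤ : ℕ∞) φ p0 ∧ ∀ᶠ p in 𝓝 p0, F (p, φ p) = 0 := by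
  have : CompleteSpace W := FiniteDimensional.complete ℝ W
  have hn : ((⊤ : ℕ∞) : WithTop ℕ∞) ≠ 0 := by simp
  have hd : fderiv ℝ F (p0, w0) ∘L .inr ℝ E W = L := by
    have h1 := (hF.differentiableAt hn).hasFDerivAt
    have h2 : HasFDerivAt (fun w : W => (p0, w)) (ContinuousLinearMap.inr ℝ E W) w0 :=
      hasFDerivAt_prodMk_right p0 w0
    exact (h1.comp w0 h2).unique hL
  have hinv : (fderiv ℝ F (p0, w0) ∘L .inr ℝ E W).IsInvertible := by
    rw [hd]
    refine ⟨(LinearEquiv.ofInjectiveEndo (L : W →ₗ[ℝ] W) hinj).toContinuousLinearEquiv, ?_⟩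
    ext x; rfl
  refine ⟨hF.implicitFunction hn hinv, hF.implicitFunction_apply_self hn hinv,
    hF.contDiffAt_implicitFunction hn hinv, ?_⟩
  have := hF.eventually_apply_implicitFunction hn hinv
  filter_upwards [this] with p hp
  rw [hp, h0]

theorem mond_hasFDerivAt_coord_mul {n : ℕ} (j : Fin n) (g : (Fin n → ℝ) → ℝ)
    (hg : DifferentiableAt ℝ g 0) :
    HasFDerivAt (fun v : Fin n → ℝ => v j * g v)
      (g 0 • (ContinuousLinearMap.proj j : (Fin n → ℝ) →L[ℝ] ℝ)) 0 := by
  have h1 : HasFDerivAt (fun v : Fin n → ℝ => v j)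
    (ContinuousLinearMap.proj j : (Fin n → ℝ) →L[ℝ] ℝ) 0 := hasFDerivAt_apply j 0
  have := h1.mul hg.hasFDerivAt
  simp only [Pi.zero_apply, zero_smul, zero_add] at this
  exact this

/-- the algebra of the Tschirnhaus transformation -/
theorem mond_tsch (a0 a1 a2 a3 x κ μ e1 e2 e3 e4 D N E1 E2 E3 : ℝ)
    (he1 : e1 = -a3) (he2 : e2 = a2) (he3 : e3 = -a1) (he4 : e4 = a0)
    (hP : x ^ 4 + a3 * x ^ 3 + a2 * x ^ 2 + a1 * x + a0 = 0)
    (hP' : 4 * x ^ 3 + 3 * a3 * x ^ 2 + 2 * a2 * x + a1 = 0)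
    (hD : D = 1 + κ * x + μ * x ^ 2)
    (hE3 : E3 = e3 + 4 * κ * e4 + μ * e1 * e4)
    (hE2 : E2 = e2 + 3 * κ * e3 + 6 * κ ^ 2 * e4 + μ * (e1 * e3 - 4 * e4) + 3 * κ * μ * e1 * e4
      + μ ^ 2 * e2 * e4)
    (hE1 : E1 = e1 + e2 * (2 * κ + μ * e1) + e3 * (3 * κ ^ 2 - 3 * μ + μ ^ 2 * e2 + μ ^ 3 * e4
        + 2 * κ * μ * e1)
      + e4 * (4 * κ ^ 3 - 3 * μ ^ 2 * e1 - 8 * κ * μ + 3 * κ ^ 2 * μ * e1 + 2 * κ * μ ^ 2 * e2))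
    (hN : N = 1 + κ * e1 + κ ^ 2 * e2 + κ ^ 3 * e3 + κ ^ 4 * e4 + μ * (e1 ^ 2 - 2 * e2)
      + μ ^ 2 * (e2 ^ 2 - 2 * e1 * e3 + 2 * e4) + μ ^ 3 * (e3 ^ 2 - 2 * e2 * e4) + μ ^ 4 * e4 ^ 2
      + κ * μ * (e1 * e2 - 3 * e3) + κ ^ 2 * μ * (e1 * e3 - 4 * e4) + κ ^ 3 * μ * e1 * e4
      + κ * μ ^ 2 * (e2 * e3 - 3 * e1 * e4) + κ ^ 2 * μ ^ 2 * e2 * e4 + κ * μ ^ 3 * e3 * e4) :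
    4 * N * x ^ 3 - 3 * E1 * x ^ 2 * D + 2 * E2 * x * D ^ 2 - E3 * D ^ 3 = 0 ∧
    N * x ^ 4 - E1 * x ^ 3 * D + E2 * x ^ 2 * D ^ 2 - E3 * x * D ^ 3 + e4 * D ^ 4 = 0 := by
  obtain ⟨b, hb⟩ : ∃ b, a3 = b - 2 * x := ⟨a3 + 2 * x, by ring⟩
  obtain ⟨c, hc⟩ : ∃ c, a2 = c - 2 * x * b + x ^ 2 := ⟨a2 + 2 * x * b - x ^ 2, by ring⟩
  have ha1 : a1 = -2 * x * c + x ^ 2 * b := by subst hb hc; linear_combination hP'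
  have ha0 : a0 = x ^ 2 * c := by subst hb hc ha1; linear_combination hP
  subst hN hE1 hE2 hE3 hD he1 he2 he3 he4 ha0 ha1 hc hb
  constructor <;> ring

/-- double zeros of the family are double roots of the Weierstrass polynomial -/
theorem mond_double_root (Φ : ℝ → ℝ) (a : Fin 4 → ℝ) (x : ℝ) (hx : |x| < 1)
    (hb : ∀ x', |x'| ≤ 1 → |Φ x' - mondP a x'| ≤ (1 / 2) * |mondP a x'|)
    (h0 : Φ x = 0) (h1 : HasDerivAt Φ 0 x) :
    x ^ 4 + a 3 * x ^ 3 + a 2 * x ^ 2 + a 1 * x + a 0 = 0 ∧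
    4 * x ^ 3 + 3 * a 3 * x ^ 2 + 2 * a 2 * x + a 1 = 0 := by
  have hb2 : ∀ x', |x'| ≤ 1 → |mondP a x'| ≤ 2 * |Φ x'| := by
    intro x' hx'
    have h := hb x' hx'
    have h3 : |mondP a x'| ≤ |Φ x'| + |Φ x' - mondP a x'| := by
      have := abs_sub_abs_le_abs_sub (mondP a x') (Φ x')
      rw [abs_sub_comm] at this
      linarith
    linarith
  have hP0 : mondP a x = 0 := by
    have := hb2 x hx.le
    rw [h0] at this
    simp at this
    exact this
  have hPd : HasDerivAt (fun x' : ℝ => mondP a x')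
      (4 * x ^ 3 + 3 * a 3 * x ^ 2 + 2 * a 2 * x + a 1) x := by
    have e : (fun x' : ℝ => mondP a x') =
        fun x' => x' ^ 4 + a 3 * x' ^ 3 + a 2 * x' ^ 2 + a 1 * x' + a 0 := by
      funext x'; simp [mondP]
    rw [e]
    have := (((((hasDerivAt_pow 4 x).add ((hasDerivAt_pow 3 x).const_mul (a 3))).add
      ((hasDerivAt_pow 2 x).const_mul (a 2))).add ((hasDerivAt_id x).const_mul (a 1))).add
      (hasDerivAt_const x (a 0)))
    refine HasDerivAt.congr_deriv (f' := _) this ?_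
    norm_num
    ring
  have hPd0 : HasDerivAt (fun x' : ℝ => mondP a x') 0 x := by
    rw [hasDerivAt_iff_isLittleO] at h1 ⊢
    refine Asymptotics.IsBigO.trans_isLittleO ?_ h1
    refine Asymptotics.IsBigO.of_bound 2 ?_
    have : ∀ᶠ x' in 𝓝 x, |x'| < 1 := continuous_abs.continuousAt.eventually_lt_const hx
    filter_upwards [this] with x' hx'
    simpa [h0, hP0] using hb2 x' hx'.le
  refine ⟨?_, hPd.unique hPd0⟩
  simpa [mondP] using hP0

/-- choice of the Tschirnhaus parameters -/
theorem mond_tsch_params (s w : Fin 4 → (Fin 4 → ℝ) → ℝ) (hs : ∀ i, ContDiff ℝ (⊤ : ℕ∞) (s i))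
    (hw : ∀ i, ContDiff ℝ (⊤ : ℕ∞) (w i)) (s0 : s 0 0 = 0) (s1 : s 1 0 ≠ 0) (w0 : w 0 0 ≠ 0) :
    ∃ κ μ : (Fin 4 → ℝ) → ℝ, ContDiffAt ℝ (⊤ : ℕ∞) κ 0 ∧ ContDiffAt ℝ (⊤ : ℕ∞) μ 0 ∧
      ∀ᶠ a in 𝓝 (0 : Fin 4 → ℝ),
        s 2 a - 3 * κ a * s 1 a + 6 * κ a ^ 2 * s 0 a + μ a * (a 3 * s 1 a - 4 * s 0 a)
          - 3 * κ a * μ a * a 3 * s 0 a + μ a ^ 2 * a 2 * s 0 a = 0 ∧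
        w 2 a - 3 * κ a * w 1 a + 6 * κ a ^ 2 * w 0 a + μ a * (a 3 * w 1 a - 4 * w 0 a)
          - 3 * κ a * μ a * a 3 * w 0 a + μ a ^ 2 * a 2 * w 0 a = 0 := by
  let B : (Fin 4 → (Fin 4 → ℝ) → ℝ) → (Fin 4 → ℝ) × (ℝ × ℝ) → ℝ := fun s q =>
    s 2 q.1 - 3 * q.2.1 * s 1 q.1 + 6 * q.2.1 ^ 2 * s 0 q.1
      + q.2.2 * (q.1 3 * s 1 q.1 - 4 * s 0 q.1)
          - 3 * q.2.1 * q.2.2 * q.1 3 * s 0 q.1 + q.2.2 ^ 2 * q.1 2 * s 0 q.1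
  have hB : ∀ s : Fin 4 → (Fin 4 → ℝ) → ℝ, (∀ i, ContDiff ℝ (⊤ : ℕ∞) (s i)) →
      ContDiff ℝ (⊤ : ℕ∞) (B s) := by
    intro s hs
    have h0 := hs 0
    have h1 := hs 1
    have h2 := hs 2
    simp only [B]
    fun_prop
  let κ0 : ℝ := s 2 0 / (3 * s 1 0)
  let μ0 : ℝ := (w 2 0 - 3 * κ0 * w 1 0 + 6 * κ0 ^ 2 * w 0 0) / (4 * w 0 0)
  let F : (Fin 4 → ℝ) × (ℝ × ℝ) → ℝ × ℝ := fun q => (B s q, B w q)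
  have hF : ContDiff ℝ (⊤ : ℕ∞) F := (hB s hs).prodMk (hB w hw)
  have hF0 : F (0, (κ0, μ0)) = 0 := by
    simp only [F, B, s0, Prod.mk_eq_zero, Pi.zero_apply]
    constructor
    · simp only [κ0]; field_simp; ring
    · simp only [μ0]; field_simp; ring
  let L : ℝ × ℝ →L[ℝ] ℝ × ℝ :=
    ((-3 * s 1 0) • ContinuousLinearMap.fst ℝ ℝ ℝ).prod
      ((-3 * w 1 0 + 12 * κ0 * w 0 0) • ContinuousLinearMap.fst ℝ ℝ ℝ
        + (-4 * w 0 0) • ContinuousLinearMap.snd ℝ ℝ ℝ)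
  have hL : HasFDerivAt (fun k : ℝ × ℝ => F (0, k)) L (κ0, μ0) := by
    have e : (fun k : ℝ × ℝ => F (0, k)) = fun k : ℝ × ℝ =>
        (k.1 * (-3 * s 1 0) + s 2 0,
          (6 * w 0 0) * k.1 ^ 2 + k.1 * (-3 * w 1 0) + k.2 * (-4 * w 0 0) + w 2 0) := by
      funext k
      simp only [F, B, s0, Pi.zero_apply]
      ext <;> simp <;> ring
    rw [e]
    have f1 : HasFDerivAt (fun k : ℝ × ℝ => k.1) (ContinuousLinearMap.fst ℝ ℝ ℝ) (κ0, μ0) :=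
      hasFDerivAt_fst
    have f2 : HasFDerivAt (fun k : ℝ × ℝ => k.2) (ContinuousLinearMap.snd ℝ ℝ ℝ) (κ0, μ0) :=
      hasFDerivAt_snd
    refine HasFDerivAt.prodMk ?_ ?_
    · have := (f1.mul_const (-3 * s 1 0)).add_const (s 2 0)
      exact this
    · have := ((((f1.pow 2).const_mul (6 * w 0 0)).add (f1.mul_const (-3 * w 1 0))).add
        (f2.mul_const (-4 * w 0 0))).add_const (w 2 0)
      refine this.congr_fderiv ?_
      ext <;> simp <;> ring
  have hinj : Function.Injective L := by
    rw [injective_iff_map_eq_zero]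
    rintro ⟨k, m⟩ h
    simp [L, s1] at h
    obtain ⟨h1, h2⟩ := h
    subst h1
    simp [w0] at h2
    simp [h2]
  obtain ⟨φ, -, hφ, hφ'⟩ := mond_ift F 0 (κ0, μ0) hF.contDiffAt hF0 L hL hinj
  refine ⟨fun a => (φ a).1, fun a => (φ a).2, hφ.fst, hφ.snd, ?_⟩
  filter_upwards [hφ'] with a ha
  exact ⟨congrArg Prod.fst ha, congrArg Prod.snd ha⟩

/-- the Weierstrass coefficients -/
theorem mond_weier (s w : Fin 4 → (Fin 4 → ℝ) → ℝ) (hs : ∀ i, ContDiff ℝ (⊤ : ℕ∞) (s i))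
    (hw : ∀ i, ContDiff ℝ (⊤ : ℕ∞) (w i)) :
    ∃ α : (Fin 3 → ℝ) → (Fin 4 → ℝ), α 0 = 0 ∧ ContDiffAt ℝ (⊤ : ℕ∞) α 0 ∧
      ∀ᶠ v in 𝓝 (0 : Fin 3 → ℝ),
        α v 0 = v 1 * s 0 (α v) + v 2 * w 0 (α v) ∧
        α v 1 = v 1 * s 1 (α v) + v 2 * w 1 (α v) ∧
        α v 2 = v 1 * s 2 (α v) + v 2 * w 2 (α v) ∧
        α v 3 = v 0 + v 1 * s 3 (α v) + v 2 * w 3 (α v) := by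
  let c : Fin 4 → ℝ := ![0, 0, 0, 1]
  let F : (Fin 3 → ℝ) × (Fin 4 → ℝ) → (Fin 4 → ℝ) := fun q i =>
    q.2 i - (q.1 0 * c i + q.1 1 * s i q.2 + q.1 2 * w i q.2)
  have hF : ContDiff ℝ (⊤ : ℕ∞) F := by
    rw [contDiff_pi]
    intro i
    have h1 := hs i
    have h2 := hw i
    simp only [F]
    fun_prop
  have hF0 : F (0, 0) = 0 := by
    funext i; simp [F]
  have hL : HasFDerivAt (fun k : Fin 4 → ℝ => F (0, k))
      (ContinuousLinearMap.id ℝ (Fin 4 → ℝ)) 0 := by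
    have e : (fun k : Fin 4 → ℝ => F (0, k)) = fun k => k := by
      funext k i; simp [F]
    rw [e]
    exact hasFDerivAt_id _
  obtain ⟨φ, hφ0, hφ, hφ'⟩ := mond_ift F 0 0 hF.contDiffAt hF0 _ hL (fun _ _ h => h)
  refine ⟨φ, hφ0, hφ, ?_⟩
  filter_upwards [hφ'] with v hv
  have h0 := congrFun hv 0
  have h1 := congrFun hv 1
  have h2 := congrFun hv 2
  have h3 := congrFun hv 3
  simp [F, c] at h0 h1 h2 h3
  refine ⟨?_, ?_, ?_, ?_⟩ <;> linarith

theorem mond_final_alg (x D N E1 E3 e4 : ℝ) (hD : D ≠ 0) (hN : N ≠ 0)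
    (h1 : 4 * N * x ^ 3 - 3 * E1 * x ^ 2 * D + 2 * 0 * x * D ^ 2 - E3 * D ^ 3 = 0)
    (h2 : N * x ^ 4 - E1 * x ^ 3 * D + 0 * x ^ 2 * D ^ 2 - E3 * x * D ^ 3 + e4 * D ^ 4 = 0) :
    E3 / (4 * N) = (x / D) ^ 3 + (-(3 / 4) * E1 / N) * (x / D) ^ 2 ∧
    e4 / (4 * N) = (3 / 4) * (x / D) ^ 4 + (2 / 3) * (-(3 / 4) * E1 / N) * (x / D) ^ 3 := by
  obtain ⟨X, hX⟩ : ∃ X, X = x / D := ⟨_, rfl⟩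
  have hx : x = X * D := by rw [hX]; field_simp
  rw [← hX]
  subst hx
  have h1' : 4 * N * X ^ 3 - 3 * E1 * X ^ 2 - E3 = 0 := by
    have : D ^ 3 * (4 * N * X ^ 3 - 3 * E1 * X ^ 2 - E3) = 0 := by linear_combination h1
    simpa [hD] using this
  have h2' : N * X ^ 4 - E1 * X ^ 3 - E3 * X + e4 = 0 := by
    have : D ^ 4 * (N * X ^ 4 - E1 * X ^ 3 - E3 * X + e4) = 0 := by linear_combination h2
    simpa [hD] using this
  constructor
  · field_simp
    linear_combination - h1'
  · field_simp
    linear_combination h2' - X * h1'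

theorem mond_part2 (s w : ℝ → ℝ) (hs : ContDiff ℝ (⊤ : ℕ∞) s) (hw : ContDiff ℝ (⊤ : ℕ∞) w)
    (s0 : s 0 = 0) (s1 : deriv s 0 ≠ 0) (w0 : w 0 ≠ 0) :
    ∃ (τ : (Fin 3 → ℝ) → (Fin 3 → ℝ)) (κ μ : (Fin 3 → ℝ) → ℝ)
      (L : (Fin 3 → ℝ) →L[ℝ] (Fin 3 → ℝ)),
      ContDiffAt ℝ (⊤ : ℕ∞) τ 0 ∧ ContDiffAt ℝ (⊤ : ℕ∞) κ 0 ∧ ContDiffAt ℝ (⊤ : ℕ∞) μ 0 ∧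
      τ 0 = 0 ∧ HasFDerivAt τ L 0 ∧ Function.Injective L ∧ L ![1, 0, 0] 0 ≠ 0 ∧
      ∀ᶠ v in 𝓝 (0 : Fin 3 → ℝ), ∀ x : ℝ, |x| < 1 → 1 + κ v * x + μ v * x ^ 2 ≠ 0 →
        x ^ 4 + v 0 * x ^ 3 + v 1 * s x + v 2 * w x = 0 →
        HasDerivAt (fun x => x ^ 4 + v 0 * x ^ 3 + v 1 * s x + v 2 * w x) 0 x →
        τ v = ![τ v 0,
          (x / (1 + κ v * x + μ v * x ^ 2)) ^ 3
            + τ v 0 * (x / (1 + κ v * x + μ v * x ^ 2)) ^ 2,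
          (3 / 4) * (x / (1 + κ v * x + μ v * x ^ 2)) ^ 4
            + (2 / 3) * τ v 0 * (x / (1 + κ v * x + μ v * x ^ 2)) ^ 3] := by
  obtain ⟨S, Cs, hS, hCs, hSb, hS0, hS1⟩ := mond_division' s hs
  obtain ⟨W, Cw, hW, hCw, hWb, hW0, -⟩ := mond_division' w hw
  rw [s0] at hS0
  rw [← hS1] at s1
  rw [← hW0] at w0
  obtain ⟨α, hα0, hα, hαeq⟩ := mond_weier S W hS hW
  obtain ⟨κ', μ', hκ', hμ', hbr⟩ := mond_tsch_params S W hS hW hS0 s1 w0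
  have hκ : ContDiffAt ℝ (⊤ : ℕ∞) (fun v => κ' (α v)) 0 :=
    ContDiffAt.comp (g := κ') 0 (by rw [hα0]; exact hκ') hα
  have hμ : ContDiffAt ℝ (⊤ : ℕ∞) (fun v => μ' (α v)) 0 :=
    ContDiffAt.comp (g := μ') 0 (by rw [hα0]; exact hμ') hα
  obtain ⟨κ, hκd⟩ : ∃ κ, κ = fun v => κ' (α v) := ⟨_, rfl⟩
  obtain ⟨μ, hμd⟩ : ∃ μ, μ = fun v => μ' (α v) := ⟨_, rfl⟩
  rw [← hκd] at hκ
  rw [← hμd] at hμ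
  have hg : ∀ i, ContDiffAt ℝ (⊤ : ℕ∞) (fun v => S i (α v)) 0 := fun i =>
    ContDiffAt.comp (g := S i) 0 (hS i).contDiffAt hα
  have hh : ∀ i, ContDiffAt ℝ (⊤ : ℕ∞) (fun v => W i (α v)) 0 := fun i =>
    ContDiffAt.comp (g := W i) 0 (hW i).contDiffAt hα
  have hαi : ∀ i, ContDiffAt ℝ (⊤ : ℕ∞) (fun v => α v i) 0 := fun i =>
    (contDiffAt_pi.1 hα) i
  have hαi0 : ∀ i, α 0 i = 0 := fun i => by rw [hα0]; rfl
  have a0 := hαi 0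
  have a1 := hαi 1
  have a2 := hαi 2
  have a3 := hαi 3
  -- the normalizing factor
  obtain ⟨N, hN⟩ : ∃ N : (Fin 3 → ℝ) → ℝ, N = fun v =>
      1 + κ v * (- α v 3) + κ v ^ 2 * α v 2 + κ v ^ 3 * (- α v 1) + κ v ^ 4 * α v 0
      + μ v * ((- α v 3) ^ 2 - 2 * α v 2)
      + μ v ^ 2 * (α v 2 ^ 2 - 2 * (- α v 3) * (- α v 1) + 2 * α v 0)
      + μ v ^ 3 * ((- α v 1) ^ 2 - 2 * α v 2 * α v 0) + μ v ^ 4 * α v 0 ^ 2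
      + κ v * μ v * ((- α v 3) * α v 2 - 3 * (- α v 1))
      + κ v ^ 2 * μ v * ((- α v 3) * (- α v 1) - 4 * α v 0) + κ v ^ 3 * μ v * (- α v 3) * α v 0
      + κ v * μ v ^ 2 * (α v 2 * (- α v 1) - 3 * (- α v 3) * α v 0)
      + κ v ^ 2 * μ v ^ 2 * α v 2 * α v 0 + κ v * μ v ^ 3 * (- α v 1) * α v 0 := ⟨_, rfl⟩
  have hNc : ContDiffAt ℝ (⊤ : ℕ∞) N 0 := by
    rw [hN]; fun_prop
  have hN0 : N 0 = 1 := by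
    rw [hN]; simp [hαi0]
  have hNne : N 0 ≠ 0 := by rw [hN0]; exact one_ne_zero
  obtain ⟨c2, hc2⟩ : ∃ c : (Fin 3 → ℝ) → ℝ, c = fun v =>
      2 * κ v + μ v * (- α v 3) := ⟨_, rfl⟩
  obtain ⟨c3, hc3⟩ : ∃ c : (Fin 3 → ℝ) → ℝ, c = fun v =>
      3 * κ v ^ 2 - 3 * μ v + μ v ^ 2 * α v 2 + μ v ^ 3 * α v 0
        + 2 * κ v * μ v * (- α v 3) := ⟨_, rfl⟩
  obtain ⟨c4, hc4⟩ : ∃ c : (Fin 3 → ℝ) → ℝ, c = fun v =>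
      4 * κ v ^ 3 - 3 * μ v ^ 2 * (- α v 3) - 8 * κ v * μ v + 3 * κ v ^ 2 * μ v * (- α v 3)
        + 2 * κ v * μ v ^ 2 * α v 2 := ⟨_, rfl⟩
  have hc2c : ContDiffAt ℝ (⊤ : ℕ∞) c2 0 := by rw [hc2]; fun_prop
  have hc3c : ContDiffAt ℝ (⊤ : ℕ∞) c3 0 := by rw [hc3]; fun_prop
  have hc4c : ContDiffAt ℝ (⊤ : ℕ∞) c4 0 := by rw [hc4]; fun_prop
  -- the matrix entries
  let R0 : (Fin 4 → (Fin 3 → ℝ) → ℝ) → (Fin 3 → ℝ) → ℝ := fun S v =>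
    (3 / 4) * (S 3 v - S 2 v * c2 v + S 1 v * c3 v - S 0 v * c4 v) * (N v)⁻¹
  let R1 : (Fin 4 → (Fin 3 → ℝ) → ℝ) → (Fin 3 → ℝ) → ℝ := fun S v =>
    (1 / 4) * (- S 1 v + (4 * κ v - μ v * α v 3) * S 0 v) * (N v)⁻¹
  let R2 : (Fin 4 → (Fin 3 → ℝ) → ℝ) → (Fin 3 → ℝ) → ℝ := fun S v =>
    (1 / 4) * S 0 v * (N v)⁻¹
  have hNi : ContDiffAt ℝ (⊤ : ℕ∞) (fun v => (N v)⁻¹) 0 := hNc.inv hNne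
  have hR : ∀ S : Fin 4 → (Fin 3 → ℝ) → ℝ,
      (∀ i, ContDiffAt ℝ (⊤ : ℕ∞) (S i) 0) →
      ContDiffAt ℝ (⊤ : ℕ∞) (R0 S) 0 ∧ ContDiffAt ℝ (⊤ : ℕ∞) (R1 S) 0 ∧
      ContDiffAt ℝ (⊤ : ℕ∞) (R2 S) 0 := by
    intro S hS
    have h0 := hS 0
    have h1 := hS 1
    have h2 := hS 2
    have h3 := hS 3
    refine ⟨?_, ?_, ?_⟩
    · simp only [R0]; fun_prop
    · simp only [R1]; fun_prop
    · simp only [R2]; fun_prop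
  obtain ⟨hS0c, hS1c, hS2c⟩ := hR (fun i v => S i (α v)) hg
  obtain ⟨hW0c, hW1c, hW2c⟩ := hR (fun i v => W i (α v)) hh
  have hn : ((⊤ : ℕ∞) : WithTop ℕ∞) ≠ 0 := by simp
  let R00 : (Fin 3 → ℝ) → ℝ := fun v => (3 / 4) * (N v)⁻¹
  have hR00 : ContDiffAt ℝ (⊤ : ℕ∞) R00 0 := by simp only [R00]; fun_prop
  let τ : (Fin 3 → ℝ) → (Fin 3 → ℝ) := fun v =>
    ![v 0 * R00 v + v 1 * R0 (fun i v => S i (α v)) v + v 2 * R0 (fun i v => W i (α v)) v, v 1 * R1 (fun i v => S i (α v)) v + v 2 * R1 (fun i v => W i (α v)) v,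
      v 1 * R2 (fun i v => S i (α v)) v + v 2 * R2 (fun i v => W i (α v)) v]
  let P : Fin 3 → ((Fin 3 → ℝ) →L[ℝ] ℝ) := fun j => ContinuousLinearMap.proj j
  let L : (Fin 3 → ℝ) →L[ℝ] (Fin 3 → ℝ) := ContinuousLinearMap.pi
    ![R00 0 • P 0 + R0 (fun i v => S i (α v)) 0 • P 1 + R0 (fun i v => W i (α v)) 0 • P 2, R1 (fun i v => S i (α v)) 0 • P 1 + R1 (fun i v => W i (α v)) 0 • P 2,
      R2 (fun i v => S i (α v)) 0 • P 1 + R2 (fun i v => W i (α v)) 0 • P 2]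
  refine ⟨τ, κ, μ, L, ?_, hκ, hμ, ?_, ?_, ?_, ?_, ?_⟩
  · rw [contDiffAt_pi]
    intro i
    fin_cases i <;> simp [τ] <;> fun_prop
  · funext i
    fin_cases i <;> simp [τ]
  · rw [hasFDerivAt_pi']
    intro i
    have key := fun j (g : (Fin 3 → ℝ) → ℝ) (hg : ContDiffAt ℝ (⊤ : ℕ∞) g 0) =>
      mond_hasFDerivAt_coord_mul j g (hg.differentiableAt hn)
    fin_cases i
    · exact ((key 0 _ hR00).add (key 1 _ hS0c)).add (key 2 _ hW0c)
    · exact (key 1 _ hS1c).add (key 2 _ hW1c)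
    · exact (key 1 _ hS2c).add (key 2 _ hW2c)
  · rw [injective_iff_map_eq_zero]
    intro h hLh
    have l0 := congrFun hLh 0
    have l1 := congrFun hLh 1
    have l2 := congrFun hLh 2
    simp only [L, P, R00, R1, R2, hN0, hα0, hS0, ContinuousLinearMap.coe_pi'] at l0 l1 l2
    simp [w0] at l2
    simp [l2, s1] at l1
    simp [l2, l1] at l0
    funext i
    fin_cases i
    · exact l0
    · exact l1
    · exact l2
  · simp [L, P, R00, hN0]
  · have hαt : Tendsto α (𝓝 0) (𝓝 0) := by
      have := hα.continuousAt.tendsto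
      rwa [hα0] at this
    have hbr' := hαt.eventually hbr
    have hNev : ∀ᶠ v in 𝓝 (0 : Fin 3 → ℝ), N v ≠ 0 := hNc.continuousAt.eventually_ne hNne
    have hsm : ∀ᶠ v in 𝓝 (0 : Fin 3 → ℝ), |v 1| * Cs + |v 2| * Cw < 1 / 2 := by
      have hc : Continuous (fun v : Fin 3 → ℝ => |v 1| * Cs + |v 2| * Cw) := by fun_prop
      exact hc.continuousAt.eventually_lt_const (by simp)
    have hα1 : ∀ᶠ v in 𝓝 (0 : Fin 3 → ℝ), ∀ i, |α v i| < 1 := by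
      rw [eventually_all]
      intro i
      exact (hαi i).continuousAt.abs.eventually_lt_const (by simp [hαi0])
    filter_upwards [hαeq, hbr', hNev, hsm, hα1] with v hv hb hNv hs' hα1
    intro x hx hD h0 h1
    obtain ⟨v0, v1, v2, v3⟩ := hv
    obtain ⟨hb1, hb2⟩ := hb
    have hdr := mond_double_root (fun x => x ^ 4 + v 0 * x ^ 3 + v 1 * s x + v 2 * w x) (α v) x hx
      (by
        intro x' hx'
        have hs1 := hSb (α v) (fun i => (hα1 i).le) x' hx'
        have hw1 := hWb (α v) (fun i => (hα1 i).le) x' hx'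
        have e : x' ^ 4 + v 0 * x' ^ 3 + v 1 * s x' + v 2 * w x' - mondP (α v) x' =
            v 1 * (s x' - (S 0 (α v) + S 1 (α v) * x' + S 2 (α v) * x' ^ 2 + S 3 (α v) * x' ^ 3))
            + v 2 * (w x' - (W 0 (α v) + W 1 (α v) * x' + W 2 (α v) * x' ^ 2
              + W 3 (α v) * x' ^ 3)) := by
          simp only [mondP, smul_eq_mul, mul_one]
          linear_combination - v0 - x' * v1 - x' ^ 2 * v2 - x' ^ 3 * v3
        simp only [e]
        refine (abs_add_le _ _).trans ?_
        rw [abs_mul, abs_mul]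
        have t1 := mul_le_mul_of_nonneg_left hs1 (abs_nonneg (v 1))
        have t2 := mul_le_mul_of_nonneg_left hw1 (abs_nonneg (v 2))
        have t3 := mul_le_mul_of_nonneg_right hs'.le (abs_nonneg (mondP (α v) x'))
        nlinarith) h0 h1
    obtain ⟨t1, t2⟩ := mond_tsch (α v 0) (α v 1) (α v 2) (α v 3) x (κ v) (μ v) _ _ _ _ _ (N v)
      _ _ _ rfl rfl rfl rfl hdr.1 hdr.2 rfl rfl rfl rfl (by rw [hN])
    have hE2 : α v 2 + 3 * κ v * -α v 1 + 6 * κ v ^ 2 * α v 0 + μ v * (-α v 3 * -α v 1 - 4 * α v 0)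
        + 3 * κ v * μ v * -α v 3 * α v 0 + μ v ^ 2 * α v 2 * α v 0 = 0 := by
      rw [← congrFun hκd v, ← congrFun hμd v] at hb1 hb2
      linear_combination v 1 * hb1 + v 2 * hb2 + v2 - 3 * κ v * v1 + 6 * κ v ^ 2 * v0
        + μ v * (α v 3 * v1 - 4 * v0) - 3 * κ v * μ v * α v 3 * v0 + μ v ^ 2 * α v 2 * v0
    rw [hE2] at t1 t2
    obtain ⟨q1, q2⟩ := mond_final_alg _ _ _ _ _ _ hD hNv t1 t2
    have hc2v := congrFun hc2 v
    have hc3v := congrFun hc3 v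
    have hc4v := congrFun hc4 v
    rw [← hc2v, ← hc3v, ← hc4v] at q1 q2
    have z0 : τ v 0 = -(3 / 4) * (-α v 3 + α v 2 * c2 v + -α v 1 * c3 v + α v 0 * c4 v) / N v := by
      simp only [τ, R00, R0, Matrix.cons_val_zero]
      simp only [div_eq_mul_inv]
      linear_combination (-(3 / 4) * (N v)⁻¹) * (v3 - c2 v * v2 + c3 v * v1 - c4 v * v0)
    have z1 : τ v 1 = (-α v 1 + 4 * κ v * α v 0 + μ v * -α v 3 * α v 0) / (4 * N v) := by
      simp only [τ, R1, Matrix.cons_val_one, Matrix.cons_val_zero]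
      simp only [div_eq_mul_inv, mul_inv]
      linear_combination (-(1 / 4) * (N v)⁻¹) * (- v1 + (4 * κ v - μ v * α v 3) * v0)
    have z2 : τ v 2 = α v 0 / (4 * N v) := by
      simp only [τ, R2, Matrix.cons_val]
      simp only [div_eq_mul_inv, mul_inv]
      linear_combination (-(1 / 4) * (N v)⁻¹) * v0
    rw [← z1, ← z0] at q1
    rw [← z2, ← z0] at q2
    funext i
    fin_cases i
    · rfl
    · exact q1
    · exact q2

theorem mond_localinv {E : Type*} [NormedAddCommGroup E] [NormedSpace ℝ E]
    [FiniteDimensional ℝ E] (f : E → E) (a : E) (hf : ContDiffAt ℝ (⊤ : ℕ∞) f a)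
    (L : E →L[ℝ] E) (hL : HasFDerivAt f L a) (hinj : Function.Injective L) :
    ∃ g : E → E, ContDiffAt ℝ (⊤ : ℕ∞) g (f a) ∧ (∀ᶠ x in 𝓝 a, g (f x) = x) ∧
      ∀ᶠ y in 𝓝 (f a), f (g y) = y := by
  have : CompleteSpace E := FiniteDimensional.complete ℝ E
  have hn : ((⊤ : ℕ∞) : WithTop ℕ∞) ≠ 0 := by simp
  let L' := (LinearEquiv.ofInjectiveEndo (L : E →ₗ[ℝ] E) hinj).toContinuousLinearEquiv
  have hL' : HasFDerivAt f (L' : E →L[ℝ] E) a := by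
    convert hL using 1
    ext x; rfl
  refine ⟨hf.localInverse hL' hn, hf.to_localInverse hL' hn, ?_, ?_⟩
  · exact (hf.hasStrictFDerivAt' hL' hn).eventually_left_inverse
  · exact (hf.hasStrictFDerivAt' hL' hn).eventually_right_inverse

theorem mond_localinv1 (f : ℝ → ℝ) (a : ℝ) (hf : ∀ᶠ t in 𝓝 a, ContDiffAt ℝ (⊤ : ℕ∞) f t)
    (hd : deriv f a ≠ 0) :
    ∃ g : ℝ → ℝ, (∀ᶠ y in 𝓝 (f a), ContDiffAt ℝ (⊤ : ℕ∞) g y) ∧ (∀ᶠ x in 𝓝 a, g (f x) = x) := by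
  have hn : ((⊤ : ℕ∞) : WithTop ℕ∞) ≠ 0 := by simp
  have hfa := hf.self_of_nhds
  have hL : HasFDerivAt f
      ((ContinuousLinearEquiv.unitsEquivAut ℝ (Units.mk0 _ hd) : ℝ ≃L[ℝ] ℝ) : ℝ →L[ℝ] ℝ) a :=
    (hfa.differentiableAt hn).hasDerivAt.hasFDerivAt_equiv hd
  have hs := hfa.hasStrictFDerivAt' hL hn
  let e := hs.toOpenPartialHomeomorph f
  have he : (e : ℝ → ℝ) = f := rfl
  refine ⟨e.symm, ?_, hs.eventually_left_inverse⟩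
  have hdc : ∀ᶠ t in 𝓝 a, deriv f t ≠ 0 := by
    have : ContinuousAt (deriv f) a := by
      have h2 : ContDiffAt ℝ 0 (fderiv ℝ f) a :=
        hfa.fderiv_right (m := 0) (by simp)
      have h3 : deriv f = fun t => fderiv ℝ f t 1 := by
        funext t; simp
      rw [h3]
      exact h2.continuousAt.clm_apply continuousAt_const
    exact this.eventually_ne hd
  have hta : Tendsto e.symm (𝓝 (f a)) (𝓝 a) := by
    have := e.tendsto_symm hs.mem_toOpenPartialHomeomorph_source
    exact this
  filter_upwards [hta.eventually (hf.and hdc),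
    e.open_target.mem_nhds hs.image_mem_toOpenPartialHomeomorph_target] with y hy hy2
  exact e.contDiffAt_symm_deriv hy.2 hy2 (hy.1.differentiableAt hn).hasDerivAt hy.1

theorem mond_extend (f : ℝ → ℝ) (hf : ∀ᶠ t in 𝓝 (0 : ℝ), ContDiffAt ℝ (⊤ : ℕ∞) f t) :
    ∃ g : ℝ → ℝ, ContDiff ℝ (⊤ : ℕ∞) g ∧ g =ᶠ[𝓝 0] f := by
  obtain ⟨ε, hε, hb⟩ := Metric.eventually_nhds_iff_ball.1 hf
  let b : ContDiffBump (0 : ℝ) := ⟨ε / 3, ε / 2, by positivity, by linarith⟩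
  refine ⟨fun t => b t * f t, ?_, ?_⟩
  · rw [contDiff_iff_contDiffAt]
    intro x
    by_cases hx : x ∈ Metric.ball (0 : ℝ) ε
    · exact b.contDiff.contDiffAt.mul (hb x hx)
    · have hx2 : x ∉ tsupport b := by
        rw [b.tsupport_eq]
        simp only [Metric.mem_closedBall, Metric.mem_ball] at hx ⊢
        have : b.rOut = ε / 2 := rfl
        rw [this]
        linarith
      have h0 := notMem_tsupport_iff_eventuallyEq.1 hx2
      have : (fun t => b t * f t) =ᶠ[𝓝 x] fun _ => 0 := by
        filter_upwards [h0] with t ht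
        rw [ht]; simp
      exact contDiffAt_const.congr_of_eventuallyEq this
  · filter_upwards [b.eventuallyEq_one] with t ht
    rw [ht]; simp

theorem mond_hadamard_aux (n : ℕ) : ∀ (k : ℕ) (F : ℝ → ℝ), ContDiff ℝ (⊤ : ℕ∞) F →
    ContDiff ℝ n (fun t => ∫ s in (0:ℝ)..1, s ^ k * F (t * s)) := by
  have main : ∀ (k : ℕ) (F : ℝ → ℝ), ContDiff ℝ (⊤ : ℕ∞) F → ∀ t,
      HasDerivAt (fun t => ∫ s in (0:ℝ)..1, s ^ k * F (t * s))
        (∫ s in (0:ℝ)..1, s ^ (k + 1) * deriv F (t * s)) t := by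
    intro k F hF t
    have hF' : Continuous (deriv F) := hF.continuous_deriv (by simp)
    have hFc := hF.continuous
    obtain ⟨C, hC⟩ := (isCompact_Icc (a := -(|t| + 1)) (b := |t| + 1)).exists_bound_of_continuousOn
      hF'.continuousOn
    refine (intervalIntegral.hasDerivAt_integral_of_dominated_loc_of_deriv_le
      (F := fun t s => s ^ k * F (t * s)) (F' := fun t s => s ^ (k + 1) * deriv F (t * s))
      (bound := fun _ => C) (s := Metric.ball t 1) (Metric.ball_mem_nhds t one_pos)
      ?_ ?_ ?_ ?_ ?_ ?_).2
    · refine Eventually.of_forall fun x => ?_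
      exact Continuous.aestronglyMeasurable (by fun_prop)
    · exact Continuous.intervalIntegrable (by fun_prop) _ _
    · exact Continuous.aestronglyMeasurable (by fun_prop)
    · refine Eventually.of_forall fun s hs x hx => ?_
      rw [Set.uIoc_of_le zero_le_one] at hs
      have hs0 := hs.1.le
      have hx1 : |x| ≤ |t| + 1 := by
        rw [Metric.mem_ball, Real.dist_eq] at hx
        have := abs_sub_abs_le_abs_sub x t
        linarith
      have hxs : |x * s| ≤ |t| + 1 := by
        rw [abs_mul, abs_of_nonneg hs0]
        nlinarith [abs_nonneg x, hs.2]
      have h1 := hC (x * s) (abs_le.1 hxs)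
      rw [norm_mul, norm_pow, Real.norm_of_nonneg hs0]
      have h2 : s ^ (k + 1) ≤ 1 := pow_le_one₀ hs0 hs.2
      nlinarith [norm_nonneg (deriv F (x * s)), pow_nonneg hs0 (k + 1)]
    · simp
    · refine Eventually.of_forall fun s hs x hx => ?_
      have h1 : HasDerivAt F (deriv F (x * s)) (x * s) :=
        (hF.differentiable (by simp) _).hasDerivAt
      have h2 := (h1.comp x ((hasDerivAt_id x).mul_const s)).const_mul (s ^ k)
      refine HasDerivAt.congr_deriv h2 ?_
      simp only [one_mul]
      ring
  induction n with
  | zero =>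
    intro k F hF
    rw [Nat.cast_zero, contDiff_zero]
    exact continuous_iff_continuousAt.2 fun t => (main k F hF t).continuousAt
  | succ n ih =>
    intro k F hF
    rw [Nat.cast_add, Nat.cast_one, contDiff_succ_iff_deriv]
    refine ⟨fun t => (main k F hF t).differentiableAt, by simp, ?_⟩
    have e : deriv (fun t => ∫ s in (0:ℝ)..1, s ^ k * F (t * s)) =
        fun t => ∫ s in (0:ℝ)..1, s ^ (k + 1) * deriv F (t * s) :=
      funext fun t => (main k F hF t).deriv
    rw [e]
    exact ih (k + 1) (deriv F) (contDiff_infty_iff_deriv.1 hF).2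

theorem mond_hadamard (f : ℝ → ℝ) (hf : ContDiff ℝ (⊤ : ℕ∞) f) (h0 : f 0 = 0) :
    ∃ g : ℝ → ℝ, ContDiff ℝ (⊤ : ℕ∞) g ∧ ∀ t, f t = t * g t := by
  have hf' : ContDiff ℝ (⊤ : ℕ∞) (deriv f) := (contDiff_infty_iff_deriv.1 hf).2
  refine ⟨fun t => ∫ s in (0:ℝ)..1, s ^ 0 * deriv f (t * s), ?_, ?_⟩
  · rw [contDiff_infty]
    exact fun n => mond_hadamard_aux n 0 (deriv f) hf'
  · intro t
    have : ∫ s in (0:ℝ)..1, t * deriv f (t * s) = f (t * 1) - f (t * 0) := by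
      refine intervalIntegral.integral_eq_sub_of_hasDerivAt (f := fun s => f (t * s)) ?_ ?_
      · intro s _
        have h1 : HasDerivAt f (deriv f (t * s)) (t * s) :=
          (hf.differentiable (by simp) _).hasDerivAt
        have h2 := h1.comp s ((hasDerivAt_id s).const_mul t)
        refine HasDerivAt.congr_deriv h2 ?_
        simp only [mul_one]
        ring
      · have := hf'.continuous
        exact Continuous.intervalIntegrable (by fun_prop) _ _
    rw [intervalIntegral.integral_const_mul] at this
    simp [h0] at this
    simp [this]

/-- derivative of `t^k * f` -/
theorem mond_hd (k : ℕ) (f : ℝ → ℝ) (hf : ContDiff ℝ (⊤ : ℕ∞) f) (t : ℝ) :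
    HasDerivAt (fun t => t ^ (k + 1) * f t) (t ^ k * ((k + 1) * f t + t * deriv f t)) t := by
  have h1 : HasDerivAt f (deriv f t) t := (hf.differentiable (by simp) _).hasDerivAt
  have h2 := (hasDerivAt_pow (k + 1) t).mul h1
  refine HasDerivAt.congr_deriv h2 ?_
  push_cast
  ring

/-- the osculating plane data -/
theorem mond_osc (p q r : ℝ → ℝ) (hp : ContDiff ℝ (⊤ : ℕ∞) p) (hq : ContDiff ℝ (⊤ : ℕ∞) q)
    (hr : ContDiff ℝ (⊤ : ℕ∞) r) (p0 : p 0 ≠ 0) (q0 : q 0 ≠ 0) (r0 : r 0 ≠ 0)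
    (c0 c1 c2 : ℝ → ℝ) (hc0 : c0 = fun t => t * p t) (hc1 : c1 = fun t => t ^ 3 * q t)
    (hc2 : c2 = fun t => t ^ 4 * r t) :
    ∃ A B C D : ℝ → ℝ, ContDiff ℝ (⊤ : ℕ∞) A ∧ ContDiff ℝ (⊤ : ℕ∞) B ∧ ContDiff ℝ (⊤ : ℕ∞) C ∧
      ContDiff ℝ (⊤ : ℕ∞) D ∧ A 0 ≠ 0 ∧ B 0 ≠ 0 ∧ C 0 ≠ 0 ∧ D 0 ≠ 0 ∧
      ∀ v0 v1 v2 t σ, v0 = c0 t + σ * deriv c0 t → v1 = c1 t + σ * deriv c1 t →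
        v2 = c2 t + σ * deriv c2 t →
        t ^ 3 * A t * v0 + t * B t * v1 + C t * v2 + t ^ 4 * D t = 0 ∧
        HasDerivAt (fun t => t ^ 3 * A t * v0 + t * B t * v1 + C t * v2 + t ^ 4 * D t) 0 t := by
  have hp1 : ContDiff ℝ (⊤ : ℕ∞) (deriv p) := (contDiff_infty_iff_deriv.1 hp).2
  have hp2 : ContDiff ℝ (⊤ : ℕ∞) (deriv (deriv p)) := (contDiff_infty_iff_deriv.1 hp1).2
  have hq1 : ContDiff ℝ (⊤ : ℕ∞) (deriv q) := (contDiff_infty_iff_deriv.1 hq).2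
  have hq2 : ContDiff ℝ (⊤ : ℕ∞) (deriv (deriv q)) := (contDiff_infty_iff_deriv.1 hq1).2
  have hr1 : ContDiff ℝ (⊤ : ℕ∞) (deriv r) := (contDiff_infty_iff_deriv.1 hr).2
  have hr2 : ContDiff ℝ (⊤ : ℕ∞) (deriv (deriv r)) := (contDiff_infty_iff_deriv.1 hr1).2
  obtain ⟨P1, hP1⟩ : ∃ f : ℝ → ℝ, f = fun t => p t + t * deriv p t := ⟨_, rfl⟩
  obtain ⟨P2, hP2⟩ : ∃ f : ℝ → ℝ, f = fun t => 2 * deriv p t + t * deriv (deriv p) t := ⟨_, rfl⟩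
  obtain ⟨Q1, hQ1⟩ : ∃ f : ℝ → ℝ, f = fun t => 3 * q t + t * deriv q t := ⟨_, rfl⟩
  obtain ⟨Q2, hQ2⟩ : ∃ f : ℝ → ℝ, f = fun t => 6 * q t + 6 * t * deriv q t
    + t ^ 2 * deriv (deriv q) t := ⟨_, rfl⟩
  obtain ⟨R1, hR1⟩ : ∃ f : ℝ → ℝ, f = fun t => 4 * r t + t * deriv r t := ⟨_, rfl⟩
  obtain ⟨R2, hR2⟩ : ∃ f : ℝ → ℝ, f = fun t => 12 * r t + 8 * t * deriv r t
    + t ^ 2 * deriv (deriv r) t := ⟨_, rfl⟩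
  have sP1 : ContDiff ℝ (⊤ : ℕ∞) P1 := by rw [hP1]; fun_prop
  have sP2 : ContDiff ℝ (⊤ : ℕ∞) P2 := by rw [hP2]; fun_prop
  have sQ1 : ContDiff ℝ (⊤ : ℕ∞) Q1 := by rw [hQ1]; fun_prop
  have sQ2 : ContDiff ℝ (⊤ : ℕ∞) Q2 := by rw [hQ2]; fun_prop
  have sR1 : ContDiff ℝ (⊤ : ℕ∞) R1 := by rw [hR1]; fun_prop
  have sR2 : ContDiff ℝ (⊤ : ℕ∞) R2 := by rw [hR2]; fun_prop
  have d : ∀ f : ℝ → ℝ, ContDiff ℝ (⊤ : ℕ∞) f → ∀ t, HasDerivAt f (deriv f t) t :=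
    fun f hf t => (hf.differentiable (by simp) _).hasDerivAt
  have d00 : ∀ t, HasDerivAt c0 (P1 t) t := by
    intro t
    have h := mond_hd 0 p hp t
    simp only [zero_add, pow_one, pow_zero, Nat.cast_zero, one_mul] at h
    rw [hc0, hP1]; exact h
  have d01 : ∀ t, HasDerivAt P1 (P2 t) t := by
    intro t
    have h := mond_hd 0 _ hp1 t
    simp only [zero_add, pow_one, pow_zero, Nat.cast_zero, one_mul] at h
    rw [hP1, hP2]
    refine HasDerivAt.congr_deriv ((d p hp t).add h) ?_
    ring
  have d10 : ∀ t, HasDerivAt c1 (t ^ 2 * Q1 t) t := by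
    intro t
    have h := mond_hd 2 q hq t
    rw [hc1, hQ1]
    refine HasDerivAt.congr_deriv h ?_
    push_cast; ring
  have d11 : ∀ t, HasDerivAt (fun t => t ^ 2 * Q1 t) (t * Q2 t) t := by
    intro t
    have h := mond_hd 1 Q1 sQ1 t
    have h2 := mond_hd 0 _ hq1 t
    simp only [zero_add, pow_one, pow_zero, Nat.cast_zero, one_mul] at h2
    have h3 : deriv Q1 t = 3 * deriv q t + (deriv q t + t * deriv (deriv q) t) := by
      rw [hQ1]; exact (((d q hq t).const_mul 3).add h2).deriv
    refine HasDerivAt.congr_deriv h ?_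
    rw [h3, hQ1, hQ2]
    push_cast; ring
  have d20 : ∀ t, HasDerivAt c2 (t ^ 3 * R1 t) t := by
    intro t
    have h := mond_hd 3 r hr t
    rw [hc2, hR1]
    refine HasDerivAt.congr_deriv h ?_
    push_cast; ring
  have d21 : ∀ t, HasDerivAt (fun t => t ^ 3 * R1 t) (t ^ 2 * R2 t) t := by
    intro t
    have h := mond_hd 2 R1 sR1 t
    have h2 := mond_hd 0 _ hr1 t
    simp only [zero_add, pow_one, pow_zero, Nat.cast_zero, one_mul] at h2
    have h3 : deriv R1 t = 4 * deriv r t + (deriv r t + t * deriv (deriv r) t) := by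
      rw [hR1]; exact (((d r hr t).const_mul 4).add h2).deriv
    refine HasDerivAt.congr_deriv h ?_
    rw [h3, hR1, hR2]
    push_cast; ring
  obtain ⟨A, hA⟩ : ∃ f : ℝ → ℝ, f = fun t => Q1 t * R2 t - R1 t * Q2 t := ⟨_, rfl⟩
  obtain ⟨B, hB⟩ : ∃ f : ℝ → ℝ, f = fun t => t * R1 t * P2 t - P1 t * R2 t := ⟨_, rfl⟩
  obtain ⟨C, hC⟩ : ∃ f : ℝ → ℝ, f = fun t => P1 t * Q2 t - t * Q1 t * P2 t := ⟨_, rfl⟩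
  obtain ⟨D, hD⟩ : ∃ f : ℝ → ℝ, f = fun t => - (A t * p t + B t * q t + C t * r t) := ⟨_, rfl⟩
  have sA : ContDiff ℝ (⊤ : ℕ∞) A := by rw [hA]; fun_prop
  have sB : ContDiff ℝ (⊤ : ℕ∞) B := by rw [hB]; fun_prop
  have sC : ContDiff ℝ (⊤ : ℕ∞) C := by rw [hC]; fun_prop
  have sD : ContDiff ℝ (⊤ : ℕ∞) D := by rw [hD]; fun_prop
  have zA : A 0 = 12 * q 0 * r 0 := by simp only [hA, hQ1, hQ2, hR1, hR2]; ring
  have zB : B 0 = -12 * p 0 * r 0 := by simp only [hB, hP1, hR2]; ring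
  have zC : C 0 = 6 * p 0 * q 0 := by simp only [hC, hP1, hQ2]; ring
  have zD : D 0 = -6 * p 0 * q 0 * r 0 := by simp only [hD, zA, zB, zC]; ring
  refine ⟨A, B, C, D, sA, sB, sC, sD, by simp [zA, q0, r0], by simp [zB, p0, r0],
    by simp [zC, p0, q0], by simp [zD, p0, q0, r0], ?_⟩
  intro v0 v1 v2 t σ hv0 hv1 hv2
  rw [(d00 t).deriv] at hv0
  rw [(d10 t).deriv] at hv1
  rw [(d20 t).deriv] at hv2
  -- the incidence identities
  have i0 : ∀ t, t ^ 3 * A t * c0 t + t * B t * c1 t + C t * c2 t + t ^ 4 * D t = 0 := by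
    intro t; simp only [hD, hc0, hc1, hc2]; ring
  have i1 : ∀ t, t ^ 3 * A t * P1 t + t * B t * (t ^ 2 * Q1 t) + C t * (t ^ 3 * R1 t) = 0 := by
    intro t; simp only [hA, hB, hC]; ring
  have i2 : ∀ t, t ^ 3 * A t * P2 t + t * B t * (t * Q2 t) + C t * (t ^ 2 * R2 t) = 0 := by
    intro t; simp only [hA, hB, hC]; ring
  obtain ⟨n0, hn0⟩ : ∃ n : ℝ → ℝ, n = fun t => t ^ 3 * A t := ⟨_, rfl⟩
  obtain ⟨n1, hn1⟩ : ∃ n : ℝ → ℝ, n = fun t => t * B t := ⟨_, rfl⟩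
  obtain ⟨n3, hn3⟩ : ∃ n : ℝ → ℝ, n = fun t => t ^ 4 * D t := ⟨_, rfl⟩
  have e0 := d n0 (by rw [hn0]; fun_prop) t
  have e1 := d n1 (by rw [hn1]; fun_prop) t
  have e2 := d C sC t
  have e3 := d n3 (by rw [hn3]; fun_prop) t
  have f0 : HasDerivAt (fun _ : ℝ => (0 : ℝ)) _ t :=
    ((((e0.mul (d00 t)).add (e1.mul (d10 t))).add (e2.mul (d20 t))).add e3).congr_of_eventuallyEq
      (Eventually.of_forall fun t => by
        have := i0 t
        simp [hn0, hn1, hn3]; linarith)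
  have f1 : HasDerivAt (fun _ : ℝ => (0 : ℝ)) _ t :=
    (((e0.mul (d01 t)).add (e1.mul (d11 t))).add (e2.mul (d21 t))).congr_of_eventuallyEq
      (Eventually.of_forall fun t => by
        have := i1 t
        simp [hn0, hn1]; linarith)
  have g0 := f0.unique (hasDerivAt_const t (0 : ℝ))
  have g1 := f1.unique (hasDerivAt_const t (0 : ℝ))
  have j1 : n0 t * P1 t + n1 t * (t ^ 2 * Q1 t) + C t * (t ^ 3 * R1 t) = 0 := by
    rw [hn0, hn1]; exact i1 t
  have j2 : n0 t * P2 t + n1 t * (t * Q2 t) + C t * (t ^ 2 * R2 t) = 0 := by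
    rw [hn0, hn1]; exact i2 t
  constructor
  · subst hv0 hv1 hv2
    linear_combination i0 t + σ * i1 t
  · have e : (fun t => t ^ 3 * A t * v0 + t * B t * v1 + C t * v2 + t ^ 4 * D t) =
        fun t => n0 t * v0 + n1 t * v1 + C t * v2 + n3 t := by
      rw [hn0, hn1, hn3]
    rw [e]
    refine HasDerivAt.congr_deriv
      ((((e0.mul_const v0).add (e1.mul_const v1)).add (e2.mul_const v2)).add e3) ?_
    subst hv0 hv1 hv2
    linear_combination g0 - j1 + σ * (g1 - j2)

theorem mond_part3 (p q r : ℝ → ℝ) (hp : ContDiff ℝ (⊤ : ℕ∞) p) (hq : ContDiff ℝ (⊤ : ℕ∞) q)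
    (hr : ContDiff ℝ (⊤ : ℕ∞) r) (p0 : p 0 ≠ 0) (q0 : q 0 ≠ 0) (r0 : r 0 ≠ 0)
    (c0 c1 c2 : ℝ → ℝ) (hc0 : c0 = fun t => t * p t) (hc1 : c1 = fun t => t ^ 3 * q t)
    (hc2 : c2 = fun t => t ^ 4 * r t) :
    ∃ s w X : ℝ → ℝ, ContDiff ℝ (⊤ : ℕ∞) s ∧ ContDiff ℝ (⊤ : ℕ∞) w ∧ s 0 = 0 ∧ deriv s 0 ≠ 0 ∧
      w 0 ≠ 0 ∧ ContDiffAt ℝ (⊤ : ℕ∞) X 0 ∧ X 0 = 0 ∧ deriv X 0 ≠ 0 ∧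
      ∀ᶠ t in 𝓝 (0 : ℝ), ∀ σ v0 v1 v2 : ℝ, v0 = c0 t + σ * deriv c0 t →
        v1 = c1 t + σ * deriv c1 t → v2 = c2 t + σ * deriv c2 t →
        X t ^ 4 + v0 * X t ^ 3 + v1 * s (X t) + v2 * w (X t) = 0 ∧
        HasDerivAt (fun x => x ^ 4 + v0 * x ^ 3 + v1 * s x + v2 * w x) 0 (X t) := by
  obtain ⟨A, B, C, D, hA, hB, hC, hD, A0, B0, C0, D0, key⟩ :=
    mond_osc p q r hp hq hr p0 q0 r0 c0 c1 c2 hc0 hc1 hc2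
  have hn : ((⊤ : ℕ∞) : WithTop ℕ∞) ≠ 0 := by simp
  have hAev : ∀ᶠ t in 𝓝 (0 : ℝ), A t ≠ 0 := hA.continuous.continuousAt.eventually_ne A0
  obtain ⟨X, hX⟩ : ∃ X : ℝ → ℝ, X = fun t => t * (D t * (A t)⁻¹) := ⟨_, rfl⟩
  obtain ⟨ρ, hρ⟩ : ∃ ρ : ℝ → ℝ, ρ = fun t => D t ^ 3 * ((A t)⁻¹) ^ 4 := ⟨_, rfl⟩
  have hAi : ∀ᶠ t in 𝓝 (0 : ℝ), ContDiffAt ℝ (⊤ : ℕ∞) (fun t => (A t)⁻¹) t := by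
    filter_upwards [hAev] with t ht
    exact hA.contDiffAt.inv ht
  have hXc : ∀ᶠ t in 𝓝 (0 : ℝ), ContDiffAt ℝ (⊤ : ℕ∞) X t := by
    filter_upwards [hAi] with t ht
    rw [hX]; fun_prop
  have hρc : ∀ᶠ t in 𝓝 (0 : ℝ), ContDiffAt ℝ (⊤ : ℕ∞) ρ t := by
    filter_upwards [hAi] with t ht
    rw [hρ]; fun_prop
  have X0 : X 0 = 0 := by rw [hX]; simp
  have ρ0 : ρ 0 ≠ 0 := by rw [hρ]; simp [A0, D0]
  have coordD : ∀ g : ℝ → ℝ, DifferentiableAt ℝ g 0 → HasDerivAt (fun t => t * g t) (g 0) 0 := by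
    intro g hg
    refine HasDerivAt.congr_deriv ((hasDerivAt_id (0 : ℝ)).mul hg.hasDerivAt) ?_
    simp
  have hXd : deriv X 0 ≠ 0 := by
    have h := coordD (fun t => D t * (A t)⁻¹)
      ((hD.contDiffAt.mul hAi.self_of_nhds).differentiableAt hn)
    rw [hX, h.deriv]
    exact mul_ne_zero D0 (inv_ne_zero A0)
  have hXdev : ∀ᶠ t in 𝓝 (0 : ℝ), deriv X t ≠ 0 := by
    have : ContinuousAt (deriv X) 0 := by
      have h2 : ContDiffAt ℝ 0 (fderiv ℝ X) 0 :=
        hXc.self_of_nhds.fderiv_right (m := 0) (by simp)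
      have h3 : deriv X = fun t => fderiv ℝ X t 1 := by
        funext t; simp
      rw [h3]
      exact h2.continuousAt.clm_apply continuousAt_const
    exact this.eventually_ne hXd
  obtain ⟨θ, hθ, hθX⟩ := mond_localinv1 X 0 hXc hXd
  have hθ0 : θ 0 = 0 := by
    have := hθX.self_of_nhds
    rwa [X0] at this
  rw [X0] at hθ
  have hθt : Tendsto θ (𝓝 0) (𝓝 0) := by
    have := hθ.self_of_nhds.continuousAt.tendsto
    rwa [hθ0] at this
  have ext : ∀ f : ℝ → ℝ, (∀ᶠ t in 𝓝 (0 : ℝ), ContDiffAt ℝ (⊤ : ℕ∞) f t) →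
      ∃ g : ℝ → ℝ, ContDiff ℝ (⊤ : ℕ∞) g ∧ ∀ᶠ t in 𝓝 (0 : ℝ), g (X t) = f t := by
    intro f hf
    obtain ⟨g, hg, hgf⟩ := mond_extend (fun y => f (θ y)) (by
      filter_upwards [hθ, hθt.eventually hf] with y h1 h2
      exact ContDiffAt.comp (g := f) y h2 h1)
    refine ⟨g, hg, ?_⟩
    have hXt : Tendsto X (𝓝 0) (𝓝 0) := by
      have := hXc.self_of_nhds.continuousAt.tendsto
      rwa [X0] at this
    filter_upwards [hXt.eventually hgf, hθX] with t h1 h2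
    rw [h1, h2]
  obtain ⟨s, hs, hsX⟩ := ext (fun t => t * (ρ t * B t)) (by
    filter_upwards [hρc] with t ht
    have := hB.contDiffAt (x := t)
    fun_prop)
  obtain ⟨w, hw, hwX⟩ := ext (fun t => ρ t * C t) (by
    filter_upwards [hρc] with t ht
    have := hC.contDiffAt (x := t)
    fun_prop)
  refine ⟨s, w, X, hs, hw, ?_, ?_, ?_, hXc.self_of_nhds, X0, hXd, ?_⟩
  · have := hsX.self_of_nhds
    simpa [X0] using this
  · intro h0
    have h1 := coordD (fun t => ρ t * B t)
      ((hρc.self_of_nhds.mul hB.contDiffAt).differentiableAt hn)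
    have h2 : HasDerivAt s 0 (X 0) := by
      have h5 := (hs.differentiable (by simp) 0).hasDerivAt
      rw [h0] at h5
      rw [X0]; exact h5
    have h3 := h2.comp 0 (hXc.self_of_nhds.differentiableAt hn).hasDerivAt
    have h4 := (h3.congr_of_eventuallyEq (f := s ∘ X) (EventuallyEq.symm hsX)).unique h1
    rw [zero_mul] at h4
    exact mul_ne_zero ρ0 B0 h4.symm
  · have := hwX.self_of_nhds
    rw [X0] at this
    rw [this]
    exact mul_ne_zero ρ0 C0
  · filter_upwards [(hsX.and (hwX.and hAev)).eventually_nhds, hXc, hρc, hXdev] with t h1 h2 h3 h4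
    intro σ v0 v1 v2 hv0 hv1 hv2
    obtain ⟨k1, k2⟩ := key v0 v1 v2 t σ hv0 hv1 hv2
    have hcomp : ∀ᶠ t' in 𝓝 t, X t' ^ 4 + v0 * X t' ^ 3 + v1 * s (X t') + v2 * w (X t') =
        ρ t' * (t' ^ 3 * A t' * v0 + t' * B t' * v1 + C t' * v2 + t' ^ 4 * D t') := by
      filter_upwards [h1] with t' ⟨a1, a2, a3⟩
      rw [a1, a2]
      simp only [hX, hρ]
      field_simp
      ring
    refine ⟨?_, ?_⟩
    · rw [hcomp.self_of_nhds, k1, mul_zero]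
    · have hdiff : DifferentiableAt ℝ (fun x => x ^ 4 + v0 * x ^ 3 + v1 * s x + v2 * w x) (X t) := by
        have a1 := hs.differentiable (by simp) (X t)
        have a2 := hw.differentiable (by simp) (X t)
        fun_prop
      have b1 := hdiff.hasDerivAt.comp t (h2.differentiableAt hn).hasDerivAt
      have b2 := (h3.differentiableAt hn).hasDerivAt.mul k2
      rw [k1, mul_zero, mul_zero, add_zero] at b2
      have b3 := (b2.congr_of_eventuallyEq hcomp).unique b1
      have b4 := mul_eq_zero.1 b3.symm
      have b5 := b4.resolve_right h4
      have b6 := hdiff.hasDerivAt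
      rw [b5] at b6
      exact b6

theorem mond_iter_t_mul (g : ℝ → ℝ) (hg : ContDiff ℝ (⊤ : ℕ∞) g) (k : ℕ) :
    iteratedDeriv (k + 1) (fun t => t * g t) =
      fun t => t * iteratedDeriv (k + 1) g t + (k + 1) * iteratedDeriv k g t := by
  have hd : ∀ k t, HasDerivAt (iteratedDeriv k g) (iteratedDeriv (k + 1) g t) t := by
    intro k t
    rw [iteratedDeriv_succ]
    have h := hg.differentiable_iteratedDeriv k (by exact_mod_cast ENat.natCast_lt_top k)
    exact (h t).hasDerivAt
  induction k with
  | zero =>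
    funext t
    rw [zero_add, iteratedDeriv_one]
    have h0 := hd 0 t
    rw [iteratedDeriv_zero] at h0 ⊢
    have := ((hasDerivAt_id t).mul h0).deriv
    simp only [id, one_mul, zero_add] at this
    refine Eq.trans this ?_
    push_cast; ring
  | succ k ih =>
    funext t
    rw [iteratedDeriv_succ, ih]
    have := (((hasDerivAt_id t).mul (hd (k + 1) t)).add ((hd k t).const_mul ((k : ℝ) + 1))).deriv
    refine Eq.trans this ?_
    simp only [id, one_mul]
    push_cast; ring

theorem mond_hadamard_iter (n : ℕ) : ∀ (f : ℝ → ℝ), ContDiff ℝ (⊤ : ℕ∞) f →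
    (∀ k < n, iteratedDeriv k f 0 = 0) → iteratedDeriv n f 0 ≠ 0 →
    ∃ g : ℝ → ℝ, ContDiff ℝ (⊤ : ℕ∞) g ∧ (f = fun t => t ^ n * g t) ∧ g 0 ≠ 0 := by
  induction n with
  | zero =>
    intro f hf _ h
    exact ⟨f, hf, by simp, by simpa using h⟩
  | succ n ih =>
    intro f hf h0 h1
    obtain ⟨g, hg, hfg⟩ := mond_hadamard f hf (by simpa using h0 0 (by simp))
    have e : f = fun t => t * g t := funext hfg
    have key := mond_iter_t_mul g hg
    rw [← e] at key
    obtain ⟨g2, hg2, hgg, hg20⟩ := ih g hg (by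
      intro k hk
      have h := h0 (k + 1) (by omega)
      rw [key k] at h
      simp only [zero_mul, zero_add] at h
      exact (mul_eq_zero.1 h).resolve_left (by positivity)) (by
      intro h
      rw [key n] at h1
      simp [h] at h1)
    refine ⟨g2, hg2, ?_, hg20⟩
    rw [e, hgg]
    funext t
    ring

theorem mond_iter_clm {n : ℕ} (γ : ℝ → Fin 3 → ℝ) (hγ : ContDiff ℝ (⊤ : ℕ∞) γ)
    (ℓ : (Fin 3 → ℝ) →L[ℝ] ℝ) (c : Fin 3 → ℝ) (k : ℕ) (hk : k = n + 1) :
    iteratedDeriv k (fun t => ℓ (γ t - c)) = fun t => ℓ (iteratedDeriv k γ t) := by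
  subst hk
  have hd : ∀ k t, HasDerivAt (iteratedDeriv k γ) (iteratedDeriv (k + 1) γ t) t := by
    intro k t
    rw [iteratedDeriv_succ]
    have h := hγ.differentiable_iteratedDeriv k (by exact_mod_cast ENat.natCast_lt_top k)
    exact (h t).hasDerivAt
  induction n with
  | zero =>
    funext t
    rw [zero_add, iteratedDeriv_one]
    have h0 := hd 0 t
    rw [iteratedDeriv_zero] at h0
    exact (ℓ.hasFDerivAt.comp_hasDerivAt t (h0.sub_const c)).deriv
  | succ n ih =>
    funext t
    rw [iteratedDeriv_succ, ih]
    exact (ℓ.hasFDerivAt.comp_hasDerivAt t (hd (n + 1) t)).deriv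

/-- adapted linear coordinates -/
theorem mond_coords (g1 g2 g3 g4 : Fin 3 → ℝ)
    (h2 : g2 ∈ Submodule.span ℝ ({g1} : Set (Fin 3 → ℝ)))
    (h4 : Module.finrank ℝ ↥(Submodule.span ℝ ({g1, g2, g3, g4} : Set (Fin 3 → ℝ))) = 3) :
    ∃ T : (Fin 3 → ℝ) ≃L[ℝ] (Fin 3 → ℝ), T g1 = ![1, 0, 0] ∧ T g2 1 = 0 ∧ T g2 2 = 0 ∧
      T g3 = ![0, 1, 0] ∧ T g4 = ![0, 0, 1] := by
  let b : Fin 3 → (Fin 3 → ℝ) := ![g1, g3, g4]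
  have hsp : Submodule.span ℝ ({g1, g2, g3, g4} : Set (Fin 3 → ℝ)) ≤
      Submodule.span ℝ (Set.range b) := by
    have m1 : g1 ∈ Submodule.span ℝ (Set.range b) := Submodule.subset_span ⟨0, rfl⟩
    rw [Submodule.span_le]
    intro x hx
    simp only [Set.mem_insert_iff, Set.mem_singleton_iff] at hx
    rcases hx with rfl | rfl | rfl | rfl
    · exact m1
    · exact (Submodule.span_le.2 (by simpa using m1)) h2
    · exact Submodule.subset_span ⟨1, rfl⟩
    · exact Submodule.subset_span ⟨2, rfl⟩
  have htop : ⊤ ≤ Submodule.span ℝ (Set.range b) := by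
    have := Submodule.eq_top_of_finrank_eq (K := ℝ) (V := Fin 3 → ℝ) (h4.trans (by simp))
    rw [← this]; exact hsp
  have hli : LinearIndependent ℝ b :=
    linearIndependent_of_top_le_span_of_card_eq_finrank htop (by simp)
  let bb : Module.Basis (Fin 3) ℝ (Fin 3 → ℝ) := Module.Basis.mk hli htop
  have hb : ∀ i, bb.equivFun (b i) = Pi.single i 1 := by
    intro i
    have : b i = bb i := by simp [bb]
    rw [this]
    funext j
    simp [Pi.single_apply, Finsupp.single_apply, eq_comm]
  refine ⟨bb.equivFun.toContinuousLinearEquiv, ?_⟩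
  have t1 : bb.equivFun g1 = ![1, 0, 0] := by
    refine (hb 0).trans ?_
    funext j; fin_cases j <;> simp
  have t3 : bb.equivFun g3 = ![0, 1, 0] := by
    refine (hb 1).trans ?_
    funext j; fin_cases j <;> simp
  have t4 : bb.equivFun g4 = ![0, 0, 1] := by
    refine (hb 2).trans ?_
    funext j; fin_cases j <;> simp
  obtain ⟨c, hc⟩ := Submodule.mem_span_singleton.1 h2
  have t2 : bb.equivFun g2 = c • ![1, 0, 0] := by
    rw [← hc, map_smul, t1]
  refine ⟨t1, ?_, ?_, t3, t4⟩
  · exact (congrFun t2 1).trans (by simp)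
  · exact (congrFun t2 2).trans (by simp)

theorem mond_main
    (γ : ℝ → Fin 3 → ℝ) (hγ : ContDiff ℝ (⊤ : ℕ∞) γ)
    (T : (Fin 3 → ℝ) ≃L[ℝ] (Fin 3 → ℝ)) (T1 : T (iteratedDeriv 1 γ 0) = ![1, 0, 0])
    (T21 : T (iteratedDeriv 2 γ 0) 1 = 0) (T22 : T (iteratedDeriv 2 γ 0) 2 = 0)
    (T3 : T (iteratedDeriv 3 γ 0) = ![0, 1, 0]) (T4 : T (iteratedDeriv 4 γ 0) = ![0, 0, 1]) :
    GermEquiv (fun p : ℝ × ℝ => γ p.2 + p.1 • deriv γ p.2) (0 : ℝ × ℝ)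
      (fun p : ℝ × ℝ =>
        ![p.1, p.2 ^ 3 + p.1 * p.2 ^ 2, (3/4) * p.2 ^ 4 + (2/3) * p.1 * p.2 ^ 3]) (0 : ℝ × ℝ) := by
  have hn : ((⊤ : ℕ∞) : WithTop ℕ∞) ≠ 0 := by simp
  have hγ' : ContDiff ℝ (⊤ : ℕ∞) (deriv γ) := (contDiff_infty_iff_deriv.1 hγ).2
  -- coordinates of the curve
  let ℓ : Fin 3 → ((Fin 3 → ℝ) →L[ℝ] ℝ) := fun i =>
    (ContinuousLinearMap.proj i : (Fin 3 → ℝ) →L[ℝ] ℝ).comp (T : (Fin 3 → ℝ) →L[ℝ] (Fin 3 → ℝ))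
  have hℓ : ∀ i z, ℓ i z = T z i := fun i z => rfl
  obtain ⟨c, hc⟩ : ∃ c : Fin 3 → ℝ → ℝ, c = fun i t => ℓ i (γ t - γ 0) := ⟨_, rfl⟩
  have hcs : ∀ i, ContDiff ℝ (⊤ : ℕ∞) (c i) := by
    intro i
    rw [hc]
    exact (ℓ i).contDiff.comp (hγ.sub contDiff_const)
  have hc0 : ∀ i, iteratedDeriv 0 (c i) 0 = 0 := by
    intro i; rw [iteratedDeriv_zero, hc]; simp
  have hck : ∀ i k, iteratedDeriv (k + 1) (c i) = fun t => T (iteratedDeriv (k + 1) γ t) i := by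
    intro i k
    rw [hc]
    exact mond_iter_clm γ hγ (ℓ i) (γ 0) (k + 1) rfl
  have hcd : ∀ i t, deriv (c i) t = T (deriv γ t) i := by
    intro i t
    have := congrFun (hck i 0) t
    rwa [zero_add, iteratedDeriv_one, iteratedDeriv_one] at this
  obtain ⟨p, hp, hpc, hp0⟩ := mond_hadamard_iter 1 (c 0) (hcs 0)
    (by intro k hk; interval_cases k; exact hc0 0)
    (by rw [hck 0 0]; simp only [zero_add, T1]; simp)
  obtain ⟨q, hq, hqc, hq0⟩ := mond_hadamard_iter 3 (c 1) (hcs 1)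
    (by
      intro k hk
      interval_cases k
      · exact hc0 1
      · rw [hck 1 0]; simp only [zero_add, T1]; simp
      · rw [hck 1 1]; exact T21)
    (by rw [hck 1 2]; simp only [Nat.reduceAdd, T3]; simp)
  obtain ⟨r, hr, hrc, hr0⟩ := mond_hadamard_iter 4 (c 2) (hcs 2)
    (by
      intro k hk
      interval_cases k
      · exact hc0 2
      · rw [hck 2 0]; simp only [zero_add, T1]; simp
      · rw [hck 2 1]; exact T22
      · rw [hck 2 2]; simp only [Nat.reduceAdd, T3]; simp)
    (by rw [hck 2 3]; simp only [Nat.reduceAdd, T4]; simp)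
  obtain ⟨s, w, X, hs, hw, s0, s1, w0, hX, X0, X1, hdz⟩ := mond_part3 p q r hp hq hr hp0 hq0 hr0
    (c 0) (c 1) (c 2) (by rw [hpc]; simp) hqc hrc
  obtain ⟨τ, κ, μ, L, hτ, hκ, hμ, τ0, hL, hLinj, hL0, hfin⟩ := mond_part2 s w hs hw s0 s1 w0
  rw [iteratedDeriv_one] at T1
  -- the tangent map in coordinates
  obtain ⟨V, hV⟩ : ∃ V : ℝ × ℝ → (Fin 3 → ℝ), V = fun p =>
    T (γ p.2 + p.1 • deriv γ p.2 - γ 0) := ⟨_, rfl⟩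
  have hVs : ContDiff ℝ (⊤ : ℕ∞) V := by
    rw [hV]
    exact T.contDiff.comp (((hγ.comp contDiff_snd).add
      (contDiff_fst.smul (hγ'.comp contDiff_snd))).sub contDiff_const)
  have hV0 : V 0 = 0 := by rw [hV]; simp
  have hVi : ∀ p i, V p i = c i p.2 + p.1 * deriv (c i) p.2 := by
    intro p i
    rw [hcd, hV, hc]
    simp only [hℓ]
    rw [add_sub_right_comm, map_add, map_smul]
    rfl
  have hVt : Tendsto V (𝓝 0) (𝓝 0) := by
    have := hVs.continuous.tendsto 0
    rwa [hV0] at this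
  have hVd : fderiv ℝ V 0 (1, 0) = ![1, 0, 0] ∧ fderiv ℝ V 0 (0, 1) = ![1, 0, 0] := by
    have h := (hVs.differentiable hn 0).hasFDerivAt
    constructor
    · have h1 : HasDerivAt (fun x : ℝ => (x, (0 : ℝ))) ((1 : ℝ), (0 : ℝ)) 0 :=
        (hasDerivAt_id _).prodMk (hasDerivAt_const _ _)
      have h2 := HasFDerivAt.comp_hasDerivAt (l := V) (f := fun x : ℝ => (x, (0 : ℝ))) (0 : ℝ) h h1
      have e : V ∘ (fun x : ℝ => (x, (0 : ℝ))) = fun x => x • (![1, 0, 0] : Fin 3 → ℝ) := by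
        funext x
        simp only [Function.comp, hV, add_sub_cancel_left, map_smul, T1]
      rw [e] at h2
      have h3 := (hasDerivAt_id (0 : ℝ)).smul_const (![1, 0, 0] : Fin 3 → ℝ)
      rw [one_smul] at h3
      exact h2.unique h3
    · have h1 : HasDerivAt (fun x : ℝ => ((0 : ℝ), x)) ((0 : ℝ), (1 : ℝ)) 0 :=
        (hasDerivAt_const _ _).prodMk (hasDerivAt_id _)
      have h2 := HasFDerivAt.comp_hasDerivAt (l := V) (0 : ℝ) h h1
      have e : V ∘ (fun x : ℝ => ((0 : ℝ), x)) = fun x => T (γ x - γ 0) := by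
        funext x
        simp only [Function.comp, hV, zero_smul, add_zero]
      rw [e] at h2
      have h3 := (T : (Fin 3 → ℝ) →L[ℝ] (Fin 3 → ℝ)).hasFDerivAt.comp_hasDerivAt (0 : ℝ)
        ((hγ.differentiable hn 0).hasDerivAt.sub_const (γ 0))
      have h4 := h2.unique h3
      rw [h4]; exact T1
  -- the source diffeomorphism
  obtain ⟨κ', hκ'⟩ : ∃ f : ℝ × ℝ → ℝ, f = fun p => κ (V p) := ⟨_, rfl⟩
  obtain ⟨μ', hμ'⟩ : ∃ f : ℝ × ℝ → ℝ, f = fun p => μ (V p) := ⟨_, rfl⟩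
  obtain ⟨Y, hY⟩ : ∃ f : ℝ × ℝ → ℝ, f = fun p => X p.2 := ⟨_, rfl⟩
  obtain ⟨U, hU⟩ : ∃ f : ℝ × ℝ → ℝ, f = fun p => τ (V p) 0 := ⟨_, rfl⟩
  obtain ⟨dn, hdn⟩ : ∃ f : ℝ × ℝ → ℝ, f = fun p => 1 + κ' p * Y p + μ' p * Y p ^ 2 := ⟨_, rfl⟩
  have hκs : ContDiffAt ℝ (⊤ : ℕ∞) κ' 0 := by
    rw [hκ']
    exact ContDiffAt.comp (g := κ) 0 (by rw [hV0]; exact hκ) hVs.contDiffAt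
  have hμs : ContDiffAt ℝ (⊤ : ℕ∞) μ' 0 := by
    rw [hμ']
    exact ContDiffAt.comp (g := μ) 0 (by rw [hV0]; exact hμ) hVs.contDiffAt
  have hYs : ContDiffAt ℝ (⊤ : ℕ∞) Y 0 := by
    rw [hY]
    exact ContDiffAt.comp (g := X) (0 : ℝ × ℝ) hX contDiffAt_snd
  have hτV : ContDiffAt ℝ (⊤ : ℕ∞) (fun p => τ (V p)) 0 :=
    ContDiffAt.comp (g := τ) 0 (by rw [hV0]; exact hτ) hVs.contDiffAt
  have hUs : ContDiffAt ℝ (⊤ : ℕ∞) U 0 := by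
    rw [hU]
    exact contDiffAt_pi.1 hτV 0
  have hdns : ContDiffAt ℝ (⊤ : ℕ∞) dn 0 := by
    rw [hdn]; fun_prop
  have Y0 : Y 0 = 0 := by rw [hY]; exact X0
  have dn0 : dn 0 = 1 := by rw [hdn]; simp [Y0]
  have dnne : dn 0 ≠ 0 := by rw [dn0]; exact one_ne_zero
  have hdni : ContDiffAt ℝ (⊤ : ℕ∞) (fun p => (dn p)⁻¹) 0 := hdns.inv dnne
  have U0 : U 0 = 0 := by rw [hU]; simp only [hV0, τ0]; rfl
  let σ : ℝ × ℝ → ℝ × ℝ := fun p => (U p, Y p * (dn p)⁻¹)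
  have σ0 : σ 0 = 0 := by simp [σ, U0, Y0]
  have hσ : ContDiffAt ℝ (⊤ : ℕ∞) σ 0 := hUs.prodMk (hYs.mul hdni)
  have hUd : HasFDerivAt U ((ContinuousLinearMap.proj (0 : Fin 3)).comp
      (L.comp (fderiv ℝ V 0))) 0 := by
    have h := (hVs.differentiable hn 0).hasFDerivAt
    have h1 : HasFDerivAt τ L (V 0) := by rw [hV0]; exact hL
    have h2 := h1.comp 0 h
    have h3 := hasFDerivAt_pi'.1 h2 0
    rw [hU]; exact h3
  have hYd : HasFDerivAt Y (deriv X 0 • ContinuousLinearMap.snd ℝ ℝ ℝ) 0 := by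
    rw [hY]
    exact HasDerivAt.comp_hasFDerivAt (h₂ := X) (0 : ℝ × ℝ)
      (hX.differentiableAt hn).hasDerivAt hasFDerivAt_snd
  have hZd : HasFDerivAt (fun p => Y p * (dn p)⁻¹) (deriv X 0 • ContinuousLinearMap.snd ℝ ℝ ℝ) 0 := by
    have h := hYd.mul (hdni.differentiableAt hn).hasFDerivAt
    rw [Y0, zero_smul, zero_add, dn0, inv_one, one_smul] at h
    exact h
  have hσd := hUd.prodMk hZd
  obtain ⟨σinv, hσi, hσl, hσr⟩ := mond_localinv σ 0 hσ _ hσd (by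
    rw [injective_iff_map_eq_zero]
    rintro ⟨a, b⟩ hab
    have h2 := congrArg Prod.snd hab
    have h1 := congrArg Prod.fst hab
    simp [X1] at h2
    subst h2
    have e : ((a, 0) : ℝ × ℝ) = a • ((1, 0) : ℝ × ℝ) := by simp
    simp only [e, map_smul] at h1
    simp [hVd.1, hL0] at h1
    rw [h1]; rfl)
  -- the target diffeomorphism
  let τ' : (Fin 3 → ℝ) → (Fin 3 → ℝ) := fun z => τ (T (z - γ 0))
  have hTd : HasFDerivAt (fun z => T (z - γ 0)) (T : (Fin 3 → ℝ) →L[ℝ] (Fin 3 → ℝ)) (γ 0) :=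
    (T : (Fin 3 → ℝ) →L[ℝ] (Fin 3 → ℝ)).hasFDerivAt.comp (γ 0)
      ((hasFDerivAt_id (γ 0)).sub_const (γ 0))
  have hT0 : T (γ 0 - γ 0) = 0 := by simp
  have hτ's : ContDiffAt ℝ (⊤ : ℕ∞) τ' (γ 0) :=
    ContDiffAt.comp (g := τ) (γ 0) (by rw [hT0]; exact hτ)
      (T.contDiff.comp (contDiff_id.sub contDiff_const)).contDiffAt
  have hτ'd : HasFDerivAt τ' (L.comp (T : (Fin 3 → ℝ) →L[ℝ] (Fin 3 → ℝ))) (γ 0) :=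
    HasFDerivAt.comp (g := τ) (γ 0) (by rw [hT0]; exact hL) hTd
  obtain ⟨τinv, hτi, hτl, hτr⟩ := mond_localinv τ' (γ 0) hτ's _ hτ'd
    (hLinj.comp T.injective)
  have τ'0 : τ' (γ 0) = 0 := by simp only [τ', hT0, τ0]
  have f0 : (fun p : ℝ × ℝ => γ p.2 + p.1 • deriv γ p.2) 0 = γ 0 := by simp
  have g0 : (fun p : ℝ × ℝ =>
        (![p.1, p.2 ^ 3 + p.1 * p.2 ^ 2, (3/4) * p.2 ^ 4 + (2/3) * p.1 * p.2 ^ 3] : Fin 3 → ℝ)) 0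
        = 0 := by
    funext i; fin_cases i <;> simp
  rw [τ'0] at hτi hτr
  rw [σ0] at hσi hσr
  refine ⟨σ, σinv, τ', τinv, σ0, ?_, hσ, hσi, ?_, ?_, hσl, hσr, ?_, ?_, ?_⟩
  · rw [f0, g0, τ'0]
  · rw [f0]; exact hτ's
  · rw [g0]; exact hτi
  · rw [f0]; exact hτl
  · rw [g0]; exact hτr
  · have e1 : ∀ᶠ p in 𝓝 (0 : ℝ × ℝ), |Y p| < 1 :=
      hYs.continuousAt.abs.eventually_lt_const (by simp [Y0])
    have e2 : ∀ᶠ p in 𝓝 (0 : ℝ × ℝ), dn p ≠ 0 := hdns.continuousAt.eventually_ne dnne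
    have e3 := hVt.eventually hfin
    have e4 := (continuous_snd.tendsto (0 : ℝ × ℝ)).eventually hdz
    filter_upwards [e1, e2, e3, e4] with p h1 h2 h3 h4
    obtain ⟨k1, k2⟩ := h4 p.1 (V p 0) (V p 1) (V p 2) (hVi p 0) (hVi p 1) (hVi p 2)
    rw [hdn, hκ', hμ', hY] at h2
    rw [hY] at h1
    have h5 := h3 (X p.2) h1 h2 k1 k2
    have h6 : τ' (γ p.2 + p.1 • deriv γ p.2) = τ (V p) := by rw [hV]
    rw [h6, h5]
    simp only [σ, hU, hdn, hκ', hμ', hY, div_eq_mul_inv]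

/-- The tangent variety to a curve `γ` of type `(1,3,4)` at `0` is locally diffeomorphic
to the Mond surface `(u, x) ↦ (u, x³ + ux², (3/4)x⁴ + (2/3)ux³)`. -/
theorem tangent_variety_type_134_Mond_surface
    (γ : ℝ → Fin 3 → ℝ) (hγ : ContDiff ℝ (⊤ : ℕ∞) γ)
    (h1 : deriv γ 0 ≠ 0)
    (h2 : iteratedDeriv 2 γ 0 ∈ Submodule.span ℝ ({iteratedDeriv 1 γ 0} : Set (Fin 3 → ℝ)))
    (h3 : Module.finrank ℝ ↥(Submodule.span ℝ
      ({iteratedDeriv 1 γ 0, iteratedDeriv 2 γ 0, iteratedDeriv 3 γ 0} : Set (Fin 3 → ℝ))) = 2)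
    (h4 : Module.finrank ℝ ↥(Submodule.span ℝ
      ({iteratedDeriv 1 γ 0, iteratedDeriv 2 γ 0, iteratedDeriv 3 γ 0,
        iteratedDeriv 4 γ 0} : Set (Fin 3 → ℝ))) = 3) :
    GermEquiv (fun p : ℝ × ℝ => γ p.2 + p.1 • deriv γ p.2) (0 : ℝ × ℝ)
      (fun p : ℝ × ℝ =>
        ![p.1, p.2 ^ 3 + p.1 * p.2 ^ 2, (3/4) * p.2 ^ 4 + (2/3) * p.1 * p.2 ^ 3]) (0 : ℝ × ℝ) := by
  obtain ⟨T, T1, T21, T22, T3, T4⟩ := mond_coords _ _ _ _ h2 h4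
  exact mond_main γ hγ T T1 T21 T22 T3 T4
end

section
/- Let m ≥ 4 and let γ : ℝ → ℝ^m be a C^∞ curve of finite type at 0 such that γ'(0), γ''(0), γ'''(0) are linearly independent (i.e. γ has type (1,2,3,a₄,…,a_m) at 0). Then the tangent map-germ Tan(γ)(s,t) = γ(t) + s·γ'(t) at (0,0) is diffeomorphic (right–left equivalent) to the higher-codimensional cuspidal edge map-germ (u,x) ↦ (u, x², x³, 0, …, 0) : (ℝ², 0) → (ℝ^m, 0). -/
open Filter Topology

open MeasureTheory in
noncomputable def Jint (φ : ℕ → ℝ → ℝ) (c : ℝ → ℂ) (k : ℕ) (p : ℝ × ℝ) : ℂ :=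
  ∫ η : ℝ, c η * (Complex.exp (Complex.I * ((η * p.1 : ℝ) : ℂ)) * ((φ k (η ^ 2 * p.2) : ℝ) : ℂ))

def NiceC (c : ℝ → ℂ) : Prop :=
  Continuous c ∧ ∀ j : ℕ, MeasureTheory.Integrable (fun η : ℝ => (η : ℂ) ^ j * c η)

lemma NiceC.mul {c : ℝ → ℂ} (h : NiceC c) (a : ℂ) (i : ℕ) :
    NiceC (fun η => a * (η : ℂ) ^ i * c η) := by
  refine ⟨by have := h.1; fun_prop, fun j => ?_⟩
  refine ((h.2 (j + i)).const_mul a).congr (Eventually.of_forall fun η => ?_)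
  simp only; ring

lemma Jint_norm_bound (φ : ℕ → ℝ → ℝ) (k : ℕ) (M : ℝ) (hM : ∀ y, |φ k y| ≤ M) (c : ℂ) (η u y : ℝ) :
    ‖c * (Complex.exp (Complex.I * ((η * u : ℝ) : ℂ)) * ((φ k (η ^ 2 * y) : ℝ) : ℂ))‖
      ≤ ‖c‖ * M := by
  rw [norm_mul, norm_mul, mul_comm Complex.I, Complex.norm_exp_ofReal_mul_I, one_mul,
    Complex.norm_real]
  exact mul_le_mul_of_nonneg_left (hM _) (norm_nonneg _)

lemma Jint_integrable (φ : ℕ → ℝ → ℝ) (hd : ∀ k y, HasDerivAt (φ k) (φ (k + 1) y) y)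
    (hb : ∀ k, ∃ M : ℝ, ∀ y, |φ k y| ≤ M) (c : ℝ → ℂ) (hc : NiceC c) (k : ℕ) (p : ℝ × ℝ) :
    MeasureTheory.Integrable (fun η : ℝ =>
      c η * (Complex.exp (Complex.I * ((η * p.1 : ℝ) : ℂ)) * ((φ k (η ^ 2 * p.2) : ℝ) : ℂ))) := by
  obtain ⟨M, hM⟩ := hb k
  have hφ : Continuous (φ k) := continuous_iff_continuousAt.2 fun y => (hd k y).continuousAt
  have h0 : MeasureTheory.Integrable c := by simpa using hc.2 0
  have hc1 := hc.1
  refine (h0.norm.mul_const M).mono' ?_ (Eventually.of_forall fun η => ?_)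
  · exact Continuous.aestronglyMeasurable (by fun_prop)
  · exact Jint_norm_bound φ k M hM _ _ _ _

lemma Jint_hasFDerivAt (φ : ℕ → ℝ → ℝ) (hd : ∀ k y, HasDerivAt (φ k) (φ (k + 1) y) y)
    (hb : ∀ k, ∃ M : ℝ, ∀ y, |φ k y| ≤ M) (c : ℝ → ℂ) (hc : NiceC c) (k : ℕ) (p : ℝ × ℝ) :
    HasFDerivAt (Jint φ c k)
      (Jint φ (fun η => Complex.I * (η : ℂ) ^ 1 * c η) k p •
          (Complex.ofRealCLM.comp (ContinuousLinearMap.fst ℝ ℝ ℝ)) +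
        Jint φ (fun η => 1 * (η : ℂ) ^ 2 * c η) (k + 1) p •
          (Complex.ofRealCLM.comp (ContinuousLinearMap.snd ℝ ℝ ℝ))) p := by
  have i1 := Jint_integrable φ hd hb _ (hc.mul Complex.I 1) k
  have i2 := Jint_integrable φ hd hb _ (hc.mul 1 2) (k + 1)
  obtain ⟨M, hM⟩ := hb k
  obtain ⟨N, hN⟩ := hb (k + 1)
  set L1 := (Complex.ofRealCLM.comp (ContinuousLinearMap.fst ℝ ℝ ℝ))
  set L2 := (Complex.ofRealCLM.comp (ContinuousLinearMap.snd ℝ ℝ ℝ))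
  unfold Jint
  have s1 := integral_smul_const (μ := MeasureTheory.volume) (𝕜 := ℂ) (fun η : ℝ =>
    Complex.I * (η : ℂ) ^ 1 * c η *
      (Complex.exp (Complex.I * ((η * p.1 : ℝ) : ℂ)) * ((φ k (η ^ 2 * p.2) : ℝ) : ℂ))) L1
  have s2 := integral_smul_const (μ := MeasureTheory.volume) (𝕜 := ℂ) (fun η : ℝ =>
    1 * (η : ℂ) ^ 2 * c η *
      (Complex.exp (Complex.I * ((η * p.1 : ℝ) : ℂ)) * ((φ (k + 1) (η ^ 2 * p.2) : ℝ) : ℂ))) L2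
  beta_reduce
  rw [← s1, ← s2, ← MeasureTheory.integral_add
    ((i1 p).smul_const L1) ((i2 p).smul_const L2)]
  refine hasFDerivAt_integral_of_dominated_of_fderiv_le (s := Set.univ)
    (bound := fun η : ℝ => ‖Complex.I * (η : ℂ) ^ 1 * c η‖ * M * ‖L1‖ +
      ‖1 * (η : ℂ) ^ 2 * c η‖ * N * ‖L2‖)
    (F' := fun (p : ℝ × ℝ) (η : ℝ) => (Complex.I * (η : ℂ) ^ 1 * c η *
      (Complex.exp (Complex.I * ((η * p.1 : ℝ) : ℂ)) * ((φ k (η ^ 2 * p.2) : ℝ) : ℂ))) • L1 +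
      (1 * (η : ℂ) ^ 2 * c η *
      (Complex.exp (Complex.I * ((η * p.1 : ℝ) : ℂ)) * ((φ (k + 1) (η ^ 2 * p.2) : ℝ) : ℂ))) • L2)
    univ_mem ?_ ?_ ?_ ?_ ?_ ?_
  · exact Eventually.of_forall fun q => (Jint_integrable φ hd hb c hc k q).aestronglyMeasurable
  · exact Jint_integrable φ hd hb c hc k p
  · exact (((i1 p).smul_const L1).add ((i2 p).smul_const L2)).aestronglyMeasurable
  · refine Eventually.of_forall fun η q _ => ?_
    refine (norm_add_le _ _).trans ?_
    rw [norm_smul, norm_smul]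
    have a := Jint_norm_bound φ k M hM (Complex.I * (η : ℂ) ^ 1 * c η) η q.1 q.2
    have b := Jint_norm_bound φ (k + 1) N hN (1 * (η : ℂ) ^ 2 * c η) η q.1 q.2
    gcongr
  · have a : MeasureTheory.Integrable (fun η : ℝ => Complex.I * (η : ℂ) ^ 1 * c η) := by
      simpa using (hc.mul Complex.I 1).2 0
    have b : MeasureTheory.Integrable (fun η : ℝ => 1 * (η : ℂ) ^ 2 * c η) := by
      simpa using (hc.mul 1 2).2 0
    exact ((a.norm.mul_const M).mul_const _).add ((b.norm.mul_const N).mul_const _)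
  · refine Eventually.of_forall fun η q _ => ?_
    have e1 : HasFDerivAt (fun q : ℝ × ℝ => ((η * q.1 : ℝ) : ℂ)) ((η : ℂ) • L1) q := by
      have := ((η : ℂ) • L1).hasFDerivAt (x := q)
      convert this using 1
      ext q
      simp [L1]
    have e2 : HasFDerivAt (fun q : ℝ × ℝ => η ^ 2 * q.2)
        (η ^ 2 • ContinuousLinearMap.snd ℝ ℝ ℝ) q := by
      have := (η ^ 2 • ContinuousLinearMap.snd ℝ ℝ ℝ).hasFDerivAt (x := q)
      convert this using 1
      ext q
      simp
    have e3 := ((e1.const_mul Complex.I).cexp.mul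
      (Complex.ofRealCLM.hasFDerivAt.comp q ((hd k (η ^ 2 * q.2)).hasFDerivAt.comp q e2))).const_mul (c η)
    refine e3.congr_fderiv ?_
    ext <;> simp [L1, L2] <;> ring

lemma Jint_contDiff (φ : ℕ → ℝ → ℝ) (hd : ∀ k y, HasDerivAt (φ k) (φ (k + 1) y) y)
    (hb : ∀ k, ∃ M : ℝ, ∀ y, |φ k y| ≤ M) (c : ℝ → ℂ) (hc : NiceC c) (k : ℕ) :
    ContDiff ℝ (⊤ : ℕ∞) (Jint φ c k) := by
  rw [contDiff_infty]
  intro n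
  induction n generalizing c k with
  | zero =>
    have : Continuous (Jint φ c k) :=
      continuous_iff_continuousAt.2 fun p => (Jint_hasFDerivAt φ hd hb c hc k p).continuousAt
    exact_mod_cast contDiff_zero.2 this
  | succ n ih =>
    have := contDiff_succ_iff_hasFDerivAt (𝕜 := ℝ) (f := Jint φ c k) (n := n)
    push_cast
    rw [this]
    refine ⟨_, ?_, Jint_hasFDerivAt φ hd hb c hc k⟩
    exact ((ih _ (hc.mul Complex.I 1) k).smul contDiff_const).add
      ((ih _ (hc.mul 1 2) (k + 1)).smul contDiff_const)


lemma exists_cosSqrt : ∃ C : ℝ → ℝ, ContDiff ℝ (⊤ : ℕ∞) C ∧ ∀ θ : ℝ, C (θ ^ 2) = Real.cos θ := by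
  let c : ℕ → ℝ := fun n => (-1) ^ n / ((2 * n).factorial : ℝ)
  have hr : (FormalMultilinearSeries.ofScalars ℝ c).radius = ⊤ := by
    apply FormalMultilinearSeries.ofScalars_radius_eq_top_of_tendsto
    · refine Eventually.of_forall fun n => ?_
      simp only [c]
      positivity
    · have h : ∀ n : ℕ, ‖c n.succ‖ / ‖c n‖ = 1 / ((2 * (n : ℝ) + 2) * (2 * n + 1)) := by
        intro n
        have e : 2 * n.succ = 2 * n + 1 + 1 := by simp; ring
        have : ((2 * n).factorial : ℝ) ≠ 0 := by positivity
        simp only [c, e, Nat.factorial_succ, norm_div, norm_pow, norm_neg, norm_one, one_pow]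
        push_cast
        rw [Real.norm_of_nonneg (by positivity), Real.norm_of_nonneg (by positivity)]
        field_simp
        ring
      simp_rw [h]
      refine squeeze_zero (fun n => by positivity) (fun n => ?_) tendsto_one_div_add_atTop_nhds_zero_nat
      have : (0 : ℝ) ≤ n := by positivity
      apply one_div_le_one_div_of_le (by positivity)
      nlinarith
  refine ⟨(FormalMultilinearSeries.ofScalars ℝ c).sum, ?_, ?_⟩
  · have h := (FormalMultilinearSeries.ofScalars ℝ c).hasFPowerSeriesOnBall (by rw [hr]; simp)
    have h2 := h.analyticOnNhd
    rw [hr] at h2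
    rw [← contDiffOn_univ]
    refine AnalyticOn.contDiffOn ?_ uniqueDiffOn_univ
    intro x _
    exact (h2 x (by simp)).analyticWithinAt
  · intro θ
    have := FormalMultilinearSeries.ofScalars_sum_eq c (θ ^ 2)
    rw [FormalMultilinearSeries.ofScalarsSum] at this
    rw [this, ← (Real.hasSum_cos θ).tsum_eq]
    congr 1
    ext n
    simp only [c, smul_eq_mul, ← pow_mul]
    ring

lemma exists_phi : ∃ φ : ℕ → ℝ → ℝ,
    (∀ k y, HasDerivAt (φ k) (φ (k + 1) y) y) ∧ (∀ k, ∃ M : ℝ, ∀ y, |φ k y| ≤ M) ∧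
    (∀ θ, φ 0 (θ ^ 2) = Real.cos θ) ∧ (∀ θ, 2 * θ * φ 1 (θ ^ 2) = - Real.sin θ) ∧
    (∀ θ, 4 * θ ^ 2 * φ 2 (θ ^ 2) + 2 * φ 1 (θ ^ 2) + φ 0 (θ ^ 2) = 0) := by
  obtain ⟨C, hC, hcos⟩ := exists_cosSqrt
  let ψ : ℝ → ℝ := fun y => Real.smoothTransition (y + 1) * C y
  have hψ : ContDiff ℝ (⊤ : ℕ∞) ψ := by
    refine ContDiff.mul ?_ hC
    exact Real.smoothTransition.contDiff.comp (contDiff_id.add contDiff_const)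
  let φ : ℕ → ℝ → ℝ := fun k => iteratedDeriv k ψ
  have hd : ∀ k y, HasDerivAt (φ k) (φ (k + 1) y) y := by
    intro k y
    have h : DifferentiableAt ℝ (iteratedDeriv k ψ) y :=
      (hψ.differentiable_iteratedDeriv k (by exact_mod_cast WithTop.coe_lt_top _)).differentiableAt
    have := h.hasDerivAt
    simpa only [φ, iteratedDeriv_succ] using this
  have h0 : ∀ θ, φ 0 (θ ^ 2) = Real.cos θ := by
    intro θ
    simp only [φ, iteratedDeriv_zero, ψ]
    rw [Real.smoothTransition.one_of_one_le (by nlinarith [sq_nonneg θ]), one_mul, hcos]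
  have hsq : ∀ θ : ℝ, HasDerivAt (fun θ : ℝ => θ ^ 2) (2 * θ) θ := by
    intro θ; simpa using hasDerivAt_pow 2 θ
  have h1 : ∀ θ, 2 * θ * φ 1 (θ ^ 2) = - Real.sin θ := by
    intro θ
    have a := (hd 0 (θ ^ 2)).comp θ (hsq θ)
    have b : HasDerivAt (φ 0 ∘ fun θ : ℝ => θ ^ 2) (- Real.sin θ) θ := by
      have : (φ 0 ∘ fun θ : ℝ => θ ^ 2) = Real.cos := funext h0
      rw [this]; exact Real.hasDerivAt_cos θ
    have := a.unique b
    rw [← this]; ring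
  have h2 : ∀ θ, 4 * θ ^ 2 * φ 2 (θ ^ 2) + 2 * φ 1 (θ ^ 2) + φ 0 (θ ^ 2) = 0 := by
    intro θ
    have a := ((hasDerivAt_id θ).const_mul 2).mul ((hd 1 (θ ^ 2)).comp θ (hsq θ))
    have b : HasDerivAt ((fun y => 2 * id y) * (φ 1 ∘ fun θ : ℝ => θ ^ 2)) (- Real.cos θ) θ := by
      have : ((fun y => 2 * id y) * (φ 1 ∘ fun θ : ℝ => θ ^ 2)) = fun θ => - Real.sin θ := funext h1
      rw [this]; exact (Real.hasDerivAt_sin θ).neg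
    have := a.unique b
    simp at this
    rw [h0]; linear_combination this
  have hode : ∀ k : ℕ, ∀ y, 0 < y →
      4 * y * φ (k + 2) y + (2 + 4 * k) * φ (k + 1) y + φ k y = 0 := by
    intro k
    induction k with
    | zero =>
      intro y hy
      have := h2 (Real.sqrt y)
      rw [Real.sq_sqrt hy.le] at this
      simpa using this
    | succ k ih =>
      intro y hy
      have a := ((((hasDerivAt_id y).const_mul 4).mul (hd (k + 2) y)).add
        ((hd (k + 1) y).const_mul (2 + 4 * (k : ℝ)))).add (hd k y)
      have b := a.congr_of_eventuallyEq (f₁ := fun _ => (0 : ℝ)) (by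
        filter_upwards [lt_mem_nhds hy] with z hz
        exact (ih z hz).symm)
      have := b.unique (hasDerivAt_const y (0 : ℝ))
      simp at this
      push_cast
      rw [show k + 1 + 2 = k + 2 + 1 by ring, show k + 1 + 1 = k + 2 by ring]
      linear_combination this
  have hbig : ∀ k, ∃ M : ℝ, ∀ y, 1 ≤ y → |φ k y| ≤ M := by
    have key : ∀ k, (∃ M : ℝ, ∀ y, 1 ≤ y → |φ k y| ≤ M) ∧
        (∃ M : ℝ, ∀ y, 1 ≤ y → |φ (k + 1) y| ≤ M) := by
      intro k
      induction k with
      | zero =>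
        refine ⟨⟨1, fun y hy => ?_⟩, ⟨1, fun y hy => ?_⟩⟩
        · have := h0 (Real.sqrt y)
          rw [Real.sq_sqrt (by linarith)] at this
          rw [this]; exact Real.abs_cos_le_one _
        · have := h1 (Real.sqrt y)
          rw [Real.sq_sqrt (by linarith)] at this
          have hs : 1 ≤ Real.sqrt y := by rw [Real.one_le_sqrt]; exact hy
          have h3 : |2 * Real.sqrt y * φ 1 y| ≤ 1 := by
            rw [this, abs_neg]; exact Real.abs_sin_le_one _
          rw [abs_mul, abs_of_nonneg (by positivity)] at h3
          simp only [zero_add]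
          nlinarith [abs_nonneg (φ 1 y)]
      | succ k ih =>
        obtain ⟨⟨M, hM⟩, ⟨N, hN⟩⟩ := ih
        refine ⟨⟨N, hN⟩, ⟨(2 + 4 * k) * N + M, fun y hy => ?_⟩⟩
        have h4 := hode k y (by linarith)
        have h5 : |4 * y * φ (k + 2) y| ≤ (2 + 4 * k) * N + M := by
          rw [show 4 * y * φ (k + 2) y = -((2 + 4 * k) * φ (k + 1) y + φ k y) by linarith, abs_neg]
          refine (abs_add_le _ _).trans (add_le_add ?_ (hM y hy))
          rw [abs_mul, abs_of_nonneg (by positivity)]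
          exact mul_le_mul_of_nonneg_left (hN y hy) (by positivity)
        rw [abs_mul, abs_of_nonneg (by linarith)] at h5
        rw [show k + 1 + 1 = k + 2 by ring]
        nlinarith [abs_nonneg (φ (k + 2) y)]
    exact fun k => (key k).1
  refine ⟨φ, hd, fun k => ?_, h0, h1, h2⟩
  obtain ⟨M, hM⟩ := hbig k
  have hc : Continuous (φ k) := continuous_iff_continuousAt.2 fun y => (hd k y).continuousAt
  obtain ⟨N, hN⟩ := isCompact_Icc.exists_bound_of_continuousOn
    (hc.continuousOn (s := Set.Icc (-2 : ℝ) 1))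
  have hN0 : 0 ≤ N := (norm_nonneg _).trans (hN 0 (by constructor <;> norm_num))
  refine ⟨max M N, fun y => ?_⟩
  rcases le_total 1 y with h | h
  · exact (hM y h).trans (le_max_left _ _)
  rcases le_or_gt (-2) y with h' | h'
  · exact (hN y ⟨h', h⟩).trans (le_max_right _ _)
  · have : φ k y = 0 := by
      have e : ψ =ᶠ[𝓝 y] fun _ => 0 := by
        filter_upwards [gt_mem_nhds h'] with z hz
        simp only [ψ]
        rw [Real.smoothTransition.zero_of_nonpos (by linarith), zero_mul]
      simp only [φ]
      rw [e.iteratedDeriv_eq k]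
      simp
    rw [this, abs_zero]
    exact hN0.trans (le_max_right _ _)


open SchwartzMap FourierTransform in
lemma exists_niceC (h : 𝓢(ℝ, ℂ)) : ∃ c : ℝ → ℂ, NiceC c ∧
    ∀ t : ℝ, h t = ∫ η : ℝ, c η * Complex.exp (Complex.I * ((η * t : ℝ) : ℂ)) := by
  set g : 𝓢(ℝ, ℂ) := 𝓕 h with hg
  have hpi : (2 * Real.pi) ≠ 0 := by positivity
  have hinv : ∀ t, h t = ∫ v : ℝ, Complex.exp (2 * Real.pi * (v * t : ℝ) * Complex.I) * g v := by
    intro t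
    have e : h = 𝓕⁻ g := by simp [hg]
    conv_lhs => rw [e]
    rw [SchwartzMap.fourierInv_coe, Real.fourierInv_eq']
    congr 1
    ext v
    simp [mul_comm v t]
  refine ⟨fun η => ((2 * Real.pi)⁻¹ : ℝ) * g ((2 * Real.pi)⁻¹ * η), ⟨?_, fun j => ?_⟩, fun t => ?_⟩
  · have := g.continuous
    fun_prop
  · have a : MeasureTheory.Integrable (fun x : ℝ => (x : ℂ) ^ j * g x) := by
      refine (g.integrable_pow_mul MeasureTheory.volume j).mono' ?_ ?_
      · have := g.continuous
        exact Continuous.aestronglyMeasurable (by fun_prop)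
      · refine Eventually.of_forall fun x => ?_
        simp
    have b := (a.comp_mul_left' (inv_ne_zero hpi)).const_mul
      (((2 * Real.pi)⁻¹ : ℝ) * ((2 * Real.pi : ℝ) : ℂ) ^ j)
    refine b.congr (Eventually.of_forall fun η => ?_)
    have k : ((2 * Real.pi : ℝ) : ℂ) ^ j * (((2 * Real.pi)⁻¹ * η : ℝ) : ℂ) ^ j = (η : ℂ) ^ j := by
      rw [← mul_pow, ← Complex.ofReal_mul, mul_inv_cancel_left₀ hpi]
    simp only
    rw [← k]
    ring
  · rw [hinv]
    have := MeasureTheory.Measure.integral_comp_mul_left (fun η : ℝ =>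
      g ((2 * Real.pi)⁻¹ * η) * Complex.exp (Complex.I * ((η * t : ℝ) : ℂ))) (2 * Real.pi)
    rw [abs_of_pos (by positivity)] at this
    rw [show (fun η : ℝ => (((2 * Real.pi)⁻¹ : ℝ) : ℂ) * g ((2 * Real.pi)⁻¹ * η) *
      Complex.exp (Complex.I * ((η * t : ℝ) : ℂ))) = fun η : ℝ => (2 * Real.pi)⁻¹ •
      (g ((2 * Real.pi)⁻¹ * η) * Complex.exp (Complex.I * ((η * t : ℝ) : ℂ))) from by
        ext η; rw [Complex.real_smul]; ring, MeasureTheory.integral_smul, ← this]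
    congr 1
    ext v
    rw [← mul_assoc, inv_mul_cancel₀ hpi, one_mul, mul_comm (g v)]
    congr 2
    push_cast
    ring

lemma fold_complex (h : SchwartzMap ℝ ℂ) : ∃ A B : ℝ × ℝ → ℂ,
    ContDiff ℝ (⊤ : ℕ∞) A ∧ ContDiff ℝ (⊤ : ℕ∞) B ∧
    ∀ u s : ℝ, h (u - s) + s * deriv h (u - s) = A (u, s ^ 2) + s ^ 3 * B (u, s ^ 2) := by
  obtain ⟨φ, hd, hb, h0, h1, h2⟩ := exists_phi
  obtain ⟨c, hc, hrep⟩ := exists_niceC h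
  have hφ0 : φ 0 0 = 1 := by simpa using h0 0
  have hJ : ∀ t, h t = Jint φ c 0 (t, 0) := by
    intro t
    rw [hrep, Jint]
    simp [hφ0]
  have hJ' : ∀ t, deriv h t = Jint φ (fun η => Complex.I * (η : ℂ) ^ 1 * c η) 0 (t, 0) := by
    intro t
    have a := (Jint_hasFDerivAt φ hd hb c hc 0 (t, 0)).comp_hasDerivAt t
      ((hasDerivAt_id t).prodMk (hasDerivAt_const t (0 : ℝ)))
    have e : (h : ℝ → ℂ) = Jint φ c 0 ∘ fun x => (id x, (0 : ℝ)) := funext hJ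
    rw [e, a.deriv]
    simp
  refine ⟨fun p => Jint φ c 0 p + ((-2 * p.2 : ℝ) : ℂ) * Jint φ (fun η => 1 * (η : ℂ) ^ 2 * c η) 1 p,
    Jint φ (fun η => (-4 * Complex.I) * (η : ℂ) ^ 3 * c η) 2, ?_, ?_, ?_⟩
  · refine (Jint_contDiff φ hd hb c hc 0).add (ContDiff.mul ?_ (Jint_contDiff φ hd hb _ (hc.mul 1 2) 1))
    exact Complex.ofRealCLM.contDiff.comp (contDiff_const.mul contDiff_snd)
  · exact Jint_contDiff φ hd hb _ (hc.mul _ 3) 2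
  · intro u s
    rw [hJ, hJ']
    have i1 := Jint_integrable φ hd hb c hc 0 (u - s, 0)
    have i2 := Jint_integrable φ hd hb _ (hc.mul Complex.I 1) 0 (u - s, 0)
    have i3 := Jint_integrable φ hd hb c hc 0 (u, s ^ 2)
    have i4 := Jint_integrable φ hd hb _ (hc.mul 1 2) 1 (u, s ^ 2)
    have i5 := Jint_integrable φ hd hb _ (hc.mul (-4 * Complex.I) 3) 2 (u, s ^ 2)
    have i34 := i3.add (i4.const_mul ((-2 * s ^ 2 : ℝ) : ℂ))
    simp only [Pi.add_def] at i34
    simp only [Jint]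
    dsimp only at i1 i2 i3 i4 i5 i34
    rw [← MeasureTheory.integral_const_mul, ← MeasureTheory.integral_const_mul,
      ← MeasureTheory.integral_const_mul, ← MeasureTheory.integral_add i1 (i2.const_mul _),
      ← MeasureTheory.integral_add i3 (i4.const_mul _),
      ← MeasureTheory.integral_add i34 (i5.const_mul _)]
    congr 1
    ext η
    have k0 := h0 (η * s)
    have k1 := h1 (η * s)
    have k2 := h2 (η * s)
    rw [mul_pow] at k0 k1 k2
    have ex : Complex.exp (Complex.I * ((η * (u - s) : ℝ) : ℂ)) =
        Complex.exp (Complex.I * ((η * u : ℝ) : ℂ)) *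
          (((Real.cos (η * s) : ℝ) : ℂ) - ((Real.sin (η * s) : ℝ) : ℂ) * Complex.I) := by
      rw [show Complex.I * ((η * (u - s) : ℝ) : ℂ) =
        Complex.I * ((η * u : ℝ) : ℂ) + ((-(η * s) : ℝ) : ℂ) * Complex.I by push_cast; ring,
        Complex.exp_add, Complex.exp_mul_I, ← Complex.ofReal_cos, ← Complex.ofReal_sin]
      simp [sub_eq_add_neg]
    simp only [mul_zero, hφ0, Complex.ofReal_one, mul_one]
    rw [ex, ← k0, show Real.sin (η * s) = -(2 * (η * s) * φ 1 (η ^ 2 * s ^ 2)) by linarith]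
    have k2c := congrArg (fun x : ℝ => (x : ℂ)) k2
    push_cast at k2c ⊢
    have hI : Complex.I ^ 2 = -1 := Complex.I_sq
    generalize Complex.exp (Complex.I * ((η : ℂ) * u)) = E at *
    linear_combination (c η * E * Complex.I * s * η) * k2c +
      (c η * E * 2 * η ^ 2 * s ^ 2 * (φ 1 (η ^ 2 * s ^ 2) : ℂ)) * hI

lemma fold_real (f : ℝ → ℝ) (hf : ContDiff ℝ (⊤ : ℕ∞) f) : ∃ A B : ℝ × ℝ → ℝ,
    ContDiff ℝ (⊤ : ℕ∞) A ∧ ContDiff ℝ (⊤ : ℕ∞) B ∧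
    ∀ᶠ p : ℝ × ℝ in 𝓝 0, f (p.1 - p.2) + p.2 * deriv f (p.1 - p.2) =
      A (p.1, p.2 ^ 2) + p.2 ^ 3 * B (p.1, p.2 ^ 2) := by
  let χ : ContDiffBump (0 : ℝ) := ⟨1, 2, by norm_num, by norm_num⟩
  let g : ℝ → ℝ := fun t => χ t * f t
  have hg : ContDiff ℝ (⊤ : ℕ∞) g := χ.contDiff.mul hf
  have hgs : HasCompactSupport g := χ.hasCompactSupport.mul_right
  let G : ℝ → ℂ := fun t => (g t : ℂ)
  have hG : ContDiff ℝ (⊤ : ℕ∞) G := Complex.ofRealCLM.contDiff.comp hg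
  have hGs : HasCompactSupport G := hgs.comp_left (g := fun x : ℝ => (x : ℂ)) (by simp)
  obtain ⟨A, B, hA, hB, hAB⟩ := fold_complex (hGs.toSchwartzMap hG)
  refine ⟨fun p => (A p).re, fun p => (B p).re, Complex.reCLM.contDiff.comp hA,
    Complex.reCLM.contDiff.comp hB, ?_⟩
  have e1 : g =ᶠ[𝓝 0] f := by
    filter_upwards [χ.eventuallyEq_one] with t ht
    simp [g, ht]
  have e2 := e1.deriv
  have ht : Tendsto (fun p : ℝ × ℝ => p.1 - p.2) (𝓝 0) (𝓝 0) := by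
    have : Continuous (fun p : ℝ × ℝ => p.1 - p.2) := by fun_prop
    simpa using this.tendsto 0
  filter_upwards [ht.eventually e1, ht.eventually e2] with p h1 h2
  rw [← h1, ← h2]
  have h3 := hAB p.1 p.2
  have h4 : deriv (hGs.toSchwartzMap hG) (p.1 - p.2) = ((deriv g (p.1 - p.2) : ℝ) : ℂ) := by
    have : HasDerivAt g (deriv g (p.1 - p.2)) (p.1 - p.2) :=
      (hg.differentiable (by simp)).differentiableAt.hasDerivAt
    exact this.ofReal_comp.deriv
  rw [h4] at h3
  have h5 := congrArg Complex.re h3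
  have h6 : (hGs.toSchwartzMap hG) (p.1 - p.2) = ((g (p.1 - p.2) : ℝ) : ℂ) := rfl
  rw [h6, ← Complex.ofReal_mul, ← Complex.ofReal_pow, Complex.add_re, Complex.add_re,
    Complex.ofReal_re, Complex.ofReal_re, Complex.re_ofReal_mul] at h5
  exact h5


lemma fold_jets (f : ℝ → ℝ) (hf : ContDiff ℝ (⊤ : ℕ∞) f) (A B : ℝ × ℝ → ℝ)
    (hA : ContDiff ℝ (⊤ : ℕ∞) A) (hB : ContDiff ℝ (⊤ : ℕ∞) B)
    (h : ∀ᶠ p : ℝ × ℝ in 𝓝 0, f (p.1 - p.2) + p.2 * deriv f (p.1 - p.2) =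
      A (p.1, p.2 ^ 2) + p.2 ^ 3 * B (p.1, p.2 ^ 2)) :
    A 0 = f 0 ∧ fderiv ℝ A 0 (1, 0) = iteratedDeriv 1 f 0 ∧
    fderiv ℝ A 0 (0, 1) = - (1 / 2) * iteratedDeriv 2 f 0 ∧ B 0 = (1 / 3) * iteratedDeriv 3 f 0 := by
  have hu : ∀ᶠ u : ℝ in 𝓝 0, f u = A (u, 0) := by
    have ht : Tendsto (fun u : ℝ => (u, (0 : ℝ))) (𝓝 0) (𝓝 0) := by
      have : Continuous (fun u : ℝ => (u, (0 : ℝ))) := by fun_prop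
      exact this.tendsto 0
    filter_upwards [ht.eventually h] with u hu
    simpa using hu
  have hs : ∀ᶠ s : ℝ in 𝓝 0, f (-s) + s * deriv f (-s) = A (0, s ^ 2) + s ^ 3 * B (0, s ^ 2) := by
    have ht : Tendsto (fun u : ℝ => ((0 : ℝ), u)) (𝓝 0) (𝓝 0) := by
      have : Continuous (fun u : ℝ => ((0 : ℝ), u)) := by fun_prop
      exact this.tendsto 0
    filter_upwards [ht.eventually h] with u hu
    simpa using hu
  have hAd : HasFDerivAt A (fderiv ℝ A 0) (0, 0) :=
    (hA.differentiable (by simp)).differentiableAt.hasFDerivAt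
  refine ⟨hu.self_of_nhds.symm, ?_, ?_⟩
  · have a := HasFDerivAt.comp_hasDerivAt (f := fun x : ℝ => (id x, (0 : ℝ))) (0 : ℝ) hAd ((hasDerivAt_id (0 : ℝ)).prodMk (hasDerivAt_const (0 : ℝ) (0 : ℝ)))
    rw [iteratedDeriv_one, (show f =ᶠ[𝓝 0] fun u => A (u, 0) from hu).deriv_eq]
    exact a.deriv.symm
  · set a : ℝ → ℝ := fun y => A (0, y) with ha
    set b : ℝ → ℝ := fun y => B (0, y) with hb
    have hac : ContDiff ℝ (⊤ : ℕ∞) a := hA.comp (contDiff_const.prodMk contDiff_id)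
    have hbc : ContDiff ℝ (⊤ : ℕ∞) b := hB.comp (contDiff_const.prodMk contDiff_id)
    have D : ∀ g : ℝ → ℝ, ContDiff ℝ (⊤ : ℕ∞) g → ∀ x, HasDerivAt g (deriv g x) x := fun g hg x =>
      (hg.differentiable (by simp)).differentiableAt.hasDerivAt
    have S : ∀ g : ℝ → ℝ, ContDiff ℝ (⊤ : ℕ∞) g → ContDiff ℝ (⊤ : ℕ∞) (deriv g) := fun g hg =>
      (contDiff_infty_iff_deriv.1 hg).2
    have hf1 := S f hf
    have hf2 := S _ hf1
    have ha1 := S _ hac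
    have hb1 := S _ hbc
    have hsq : ∀ θ : ℝ, HasDerivAt (fun θ : ℝ => θ ^ 2) (2 * θ) θ := by
      intro θ; simpa using hasDerivAt_pow 2 θ
    have hcu : ∀ θ : ℝ, HasDerivAt (fun θ : ℝ => θ ^ 3) (3 * θ ^ 2) θ := by
      intro θ; simpa using hasDerivAt_pow 3 θ
    have hn : ∀ (g : ℝ → ℝ), ContDiff ℝ (⊤ : ℕ∞) g → ∀ s,
        HasDerivAt (fun s => g (-s)) (- deriv g (-s)) s := by
      intro g hg s
      have := (D g hg (-s)).comp s (hasDerivAt_neg s)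
      rw [mul_neg_one] at this
      exact this
    have hq : ∀ (g : ℝ → ℝ), ContDiff ℝ (⊤ : ℕ∞) g → ∀ s,
        HasDerivAt (fun s => g (s ^ 2)) (deriv g (s ^ 2) * (2 * s)) s := by
      intro g hg s
      exact (D g hg (s ^ 2)).comp s (hsq s)
    have hs1 := (show (fun s => f (-s) + s * deriv f (-s)) =ᶠ[𝓝 0]
      fun s => a (s ^ 2) + s ^ 3 * b (s ^ 2) from hs).deriv
    have hs2 : ∀ᶠ s : ℝ in 𝓝[≠] 0, - deriv (deriv f) (-s) =
        2 * deriv a (s ^ 2) + (3 * s) * b (s ^ 2) + (2 * s ^ 3) * deriv b (s ^ 2) := by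
      filter_upwards [hs1.filter_mono nhdsWithin_le_nhds, self_mem_nhdsWithin] with s hs hne
      replace hs := (((hn f hf s).add ((hasDerivAt_id s).mul (hn _ hf1 s))).deriv.symm.trans hs).trans
        ((hq a hac s).add ((hcu s).mul (hq b hbc s))).deriv
      simp at hs
      have hne : s ≠ 0 := hne
      apply mul_left_cancel₀ hne
      linear_combination hs
    have hs3 : ∀ᶠ s : ℝ in 𝓝 0, - deriv (deriv f) (-s) =
        2 * deriv a (s ^ 2) + (3 * s) * b (s ^ 2) + (2 * s ^ 3) * deriv b (s ^ 2) := by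
      have c1 := hf2.continuous
      have c2 := ha1.continuous
      have c3 := hbc.continuous
      have c4 := hb1.continuous
      exact (ContinuousAt.eventuallyEq_nhds_iff_eventuallyEq_nhdsNE (by fun_prop)
        (by fun_prop)).1 hs2
    have r2 : iteratedDeriv 2 f 0 = deriv (deriv f) 0 := by
      rw [iteratedDeriv_succ, iteratedDeriv_one]
    have r3 : iteratedDeriv 3 f 0 = deriv (deriv (deriv f)) 0 := by
      rw [iteratedDeriv_succ, iteratedDeriv_succ, iteratedDeriv_one]
    constructor
    · have x := hAd.comp_hasDerivAt (0 : ℝ) ((hasDerivAt_const (0 : ℝ) (0 : ℝ)).prodMk (hasDerivAt_id (0 : ℝ)))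
      have y : deriv a 0 = fderiv ℝ A 0 (0, 1) := x.deriv
      have z := hs3.self_of_nhds
      simp at z
      rw [← y, r2]; linarith
    · have z := (show (fun s => - deriv (deriv f) (-s)) =ᶠ[𝓝 0] fun s =>
        2 * deriv a (s ^ 2) + (3 * s) * b (s ^ 2) + (2 * s ^ 3) * deriv b (s ^ 2) from hs3).deriv_eq
      replace z := ((hn _ hf2 0).neg.deriv.symm.trans z).trans ((((hq _ ha1 0).const_mul 2).add
        (((hasDerivAt_id (0:ℝ)).const_mul 3).mul (hq b hbc 0))).add
        (((hcu 0).const_mul 2).mul (hq _ hb1 0))).deriv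
      simp at z
      rw [r3, z]
      simp only [hb]
      rw [show ((0 : ℝ), (0 : ℝ)) = 0 from rfl]
      ring

lemma exists_basis_ext (n : ℕ) (v : Fin 3 → Fin (n + 3) → ℝ) (hv : LinearIndependent ℝ v) :
    ∃ bs : Module.Basis (Fin (n + 3)) ℝ (Fin (n + 3) → ℝ), bs 0 = v 0 ∧ bs 1 = v 1 ∧ bs 2 = v 2 := by
  obtain ⟨K, hK⟩ := Submodule.exists_isCompl (Submodule.span ℝ (Set.range v))
  have hfr := Submodule.finrank_add_eq_of_isCompl hK
  rw [finrank_span_eq_card hv] at hfr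
  simp at hfr
  let w := Module.finBasisOfFinrankEq ℝ K (n := n) (by omega)
  have hw : LinearIndependent ℝ (fun i => (w i : Fin (n + 3) → ℝ)) :=
    w.linearIndependent.map' K.subtype (Submodule.ker_subtype K)
  have hsum : LinearIndependent ℝ (Sum.elim v (fun i => (w i : Fin (n + 3) → ℝ))) := by
    refine hv.sum_type hw (hK.disjoint.mono_right ?_)
    rw [Submodule.span_le]
    rintro _ ⟨i, rfl⟩
    exact (w i).2
  let e : Fin 3 ⊕ Fin n ≃ Fin (n + 3) := finSumFinEquiv.trans (finCongr (add_comm 3 n))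
  have hl := hsum.comp e.symm e.symm.injective
  have key : ∀ i : Fin 3, e.symm (Fin.cast (add_comm 3 n) (Fin.castAdd n i)) = Sum.inl i := by
    intro i
    rw [Equiv.symm_apply_eq]
    simp [e]
  refine ⟨basisOfLinearIndependentOfCardEqFinrank hl (by simp), ?_, ?_, ?_⟩
  · have := key 0
    rw [coe_basisOfLinearIndependentOfCardEqFinrank, Function.comp_apply,
      show (0 : Fin (n + 3)) = Fin.cast (add_comm 3 n) (Fin.castAdd n 0) from Fin.ext (by simp), this]
    rfl
  · have := key 1
    rw [coe_basisOfLinearIndependentOfCardEqFinrank, Function.comp_apply,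
      show (1 : Fin (n + 3)) = Fin.cast (add_comm 3 n) (Fin.castAdd n 1) from Fin.ext (by simp), this]
    rfl
  · have := key 2
    rw [coe_basisOfLinearIndependentOfCardEqFinrank, Function.comp_apply,
      show (2 : Fin (n + 3)) = Fin.cast (add_comm 3 n) (Fin.castAdd n 2) from Fin.ext (by simp), this]
    rfl

lemma iteratedDeriv_comp_apply {m : ℕ} (γ : ℝ → Fin m → ℝ) (hγ : ContDiff ℝ (⊤ : ℕ∞) γ) (i : Fin m)
    (k : ℕ) : iteratedDeriv k (fun t => γ t i) = fun t => iteratedDeriv k γ t i := by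
  induction k with
  | zero => simp
  | succ k ih =>
    rw [iteratedDeriv_succ, ih, iteratedDeriv_succ]
    ext t
    have h : DifferentiableAt ℝ (iteratedDeriv k γ) t :=
      (hγ.differentiable_iteratedDeriv k (by exact_mod_cast WithTop.coe_lt_top _)).differentiableAt
    exact (hasDerivAt_pi.1 h.hasDerivAt i).deriv


lemma tangent_aux (n : ℕ)
    (γ : ℝ → Fin (n + 3) → ℝ) (hγ : ContDiff ℝ (⊤ : ℕ∞) γ)
    (htype : LinearIndependent ℝ
      ![iteratedDeriv 1 γ 0, iteratedDeriv 2 γ 0, iteratedDeriv 3 γ 0]) :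
    GermEquiv (fun p : ℝ × ℝ => γ p.2 + p.1 • deriv γ p.2) (0 : ℝ × ℝ)
      (fun p : ℝ × ℝ => fun i : Fin (n + 3) =>
        if (i : ℕ) = 0 then p.1
        else if (i : ℕ) = 1 then p.2 ^ 2
        else if (i : ℕ) = 2 then p.2 ^ 3
        else 0) (0 : ℝ × ℝ) := by
  obtain ⟨bs, hb0, hb1, hb2⟩ := exists_basis_ext n _ htype
  simp only [Matrix.cons_val_zero, Matrix.cons_val_one, Matrix.cons_val] at hb0 hb1 hb2
  have hγi : ∀ i, ContDiff ℝ (⊤ : ℕ∞) (fun t => γ t i) := fun i => contDiff_pi.1 hγ i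
  choose A B hA hB hAB using fun i => fold_real (fun t => γ t i) (hγi i)
  have hjet := fun i => fold_jets _ (hγi i) _ _ (hA i) (hB i) (hAB i)
  set w : Fin n → Fin (n + 3) := fun j => j.succ.succ.succ with hw
  let Φ : (Fin (n + 3) → ℝ) → Fin (n + 3) → ℝ := fun z i =>
    A i (z 0, z 1) + z 2 * B i (z 0, z 1) + ∑ j : Fin n, z (w j) * bs (w j) i
  have hc : ∀ j : Fin (n + 3), ContDiff ℝ (⊤ : ℕ∞) (fun z : Fin (n + 3) → ℝ => z j) :=
    fun j => contDiff_apply ℝ ℝ j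
  have hΦ : ContDiff ℝ (⊤ : ℕ∞) Φ := by
    refine contDiff_pi.2 fun i => ?_
    refine ContDiff.add (ContDiff.add ?_ (ContDiff.mul (hc 2) ?_)) ?_
    · exact (hA i).comp ((hc 0).prodMk (hc 1))
    · exact (hB i).comp ((hc 0).prodMk (hc 1))
    · exact ContDiff.sum fun j _ => (hc (w j)).mul contDiff_const
  -- the derivative at the origin
  let d : Fin (n + 3) → ℝ := Fin.cons 1 (Fin.cons (-(1 / 2)) (Fin.cons (1 / 3) fun _ => 1))
  have hd : ∀ j, d j ≠ 0 := by
    intro j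
    refine Fin.cases ?_ (fun j => ?_) j
    · simp [d]
    refine Fin.cases ?_ (fun j => ?_) j
    · simp [d]
    refine Fin.cases ?_ (fun j => ?_) j
    · change (1 / 3 : ℝ) ≠ 0
      norm_num
    · simp [d]
  let Tl : (Fin (n + 3) → ℝ) →ₗ[ℝ] (Fin (n + 3) → ℝ) :=
    ∑ j, (LinearMap.proj j : (Fin (n + 3) → ℝ) →ₗ[ℝ] ℝ).smulRight (d j • bs j)
  have hTl : ∀ z, Tl z = ∑ j, (z j * d j) • bs j := by
    intro z
    simp [Tl, LinearMap.sum_apply, smul_smul]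
  have hinj : Function.Injective Tl := by
    rw [← LinearMap.ker_eq_bot, LinearMap.ker_eq_bot']
    intro z hz
    rw [hTl] at hz
    have := Fintype.linearIndependent_iff.1 bs.linearIndependent _ hz
    ext j
    exact (mul_eq_zero.1 (this j)).resolve_right (hd j)
  let T : (Fin (n + 3) → ℝ) ≃L[ℝ] (Fin (n + 3) → ℝ) :=
    (LinearEquiv.ofInjectiveEndo Tl hinj).toContinuousLinearEquiv
  have hT : ∀ z i, T z i = z 0 * iteratedDeriv 1 γ 0 i + z 1 * (-(1 / 2) * iteratedDeriv 2 γ 0 i) +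
      z 2 * (1 / 3 * iteratedDeriv 3 γ 0 i) + ∑ j : Fin n, z (w j) * bs (w j) i := by
    intro z i
    have : T z = Tl z := rfl
    rw [this, hTl, Fin.sum_univ_succ, Fin.sum_univ_succ, Fin.sum_univ_succ]
    have e1 : Fin.succ (0 : Fin (n + 2)) = 1 := rfl
    have e2 : Fin.succ (Fin.succ (0 : Fin (n + 1))) = 2 := rfl
    rw [e2, e1, hb0, hb1, hb2]
    have d0 : d 0 = 1 := rfl
    have d1 : d 1 = -(1 / 2) := rfl
    have d2 : d 2 = 1 / 3 := rfl
    have d3 : ∀ j : Fin n, d j.succ.succ.succ = 1 := fun _ => rfl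
    simp only [d0, d1, d2, d3, hw, Pi.add_apply, Pi.smul_apply, smul_eq_mul, Finset.sum_apply]
    simp only [mul_one]
    ring
  have hΦ' : HasFDerivAt Φ (T : (Fin (n + 3) → ℝ) →L[ℝ] (Fin (n + 3) → ℝ)) 0 := by
    rw [hasFDerivAt_pi']
    intro i
    have p : ∀ j : Fin (n + 3), HasFDerivAt (fun z : Fin (n + 3) → ℝ => z j)
      (ContinuousLinearMap.proj j : (Fin (n + 3) → ℝ) →L[ℝ] ℝ) 0 := fun j => hasFDerivAt_apply j _
    have q := (p 0).prodMk (p 1)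
    have dA : HasFDerivAt (A i) (fderiv ℝ (A i) 0) ((0 : Fin (n + 3) → ℝ) 0, (0 : Fin (n + 3) → ℝ) 1) :=
      ((hA i).differentiable (by simp)).differentiableAt.hasFDerivAt
    have dB : HasFDerivAt (B i) (fderiv ℝ (B i) 0) ((0 : Fin (n + 3) → ℝ) 0, (0 : Fin (n + 3) → ℝ) 1) :=
      ((hB i).differentiable (by simp)).differentiableAt.hasFDerivAt
    have qA := HasFDerivAt.comp (f := fun z : Fin (n + 3) → ℝ => (z 0, z 1)) 0 dA q
    have qB := HasFDerivAt.comp (f := fun z : Fin (n + 3) → ℝ => (z 0, z 1)) 0 dB q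
    have qs := HasFDerivAt.fun_sum (u := Finset.univ) fun (j : Fin n) _ => (p (w j)).mul_const (bs (w j) i)
    have tot := (qA.add ((p 2).mul qB)).add qs
    refine HasFDerivAt.congr_fderiv tot ?_
    ext1 z
    obtain ⟨-, j1, j2, j3⟩ := hjet i
    rw [iteratedDeriv_comp_apply γ hγ] at j1 j2 j3
    have hz : fderiv ℝ (A i) 0 (z 0, z 1) =
        z 0 * fderiv ℝ (A i) 0 (1, 0) + z 1 * fderiv ℝ (A i) 0 (0, 1) := by
      rw [show ((z 0, z 1) : ℝ × ℝ) = z 0 • ((1 : ℝ), (0 : ℝ)) + z 1 • ((0 : ℝ), (1 : ℝ)) by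
        ext <;> simp, map_add, map_smul, map_smul]
      simp
    have hB0 : B i ((0 : ℝ), (0 : ℝ)) = 1 / 3 * iteratedDeriv 3 γ 0 i := j3
    have hTz := hT z i
    have j1' : fderiv ℝ (A i) 0 (1, 0) = iteratedDeriv 1 γ 0 i := j1
    have j2' : fderiv ℝ (A i) 0 (0, 1) = -(1 / 2) * iteratedDeriv 2 γ 0 i := j2
    rw [← j1', ← j2', ← hB0, ← hz] at hTz
    simp [hTz]
    simp only [mul_comm]
  have hΦat : ContDiffAt ℝ (⊤ : ℕ∞) Φ 0 := hΦ.contDiffAt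
  have hne : ((⊤ : ℕ∞) : WithTop ℕ∞) ≠ 0 := by simp
  have hstr := hΦat.hasStrictFDerivAt' hΦ' hne
  have hΦ0 : Φ 0 = γ 0 := by
    ext i
    have : A i ((0 : ℝ), (0 : ℝ)) = γ 0 i := (hjet i).1
    simp [Φ, this]
  set g : ℝ × ℝ → Fin (n + 3) → ℝ := (fun p : ℝ × ℝ => fun i : Fin (n + 3) =>
        if (i : ℕ) = 0 then p.1
        else if (i : ℕ) = 1 then p.2 ^ 2
        else if (i : ℕ) = 2 then p.2 ^ 3
        else 0) with hg
  have g0 : ∀ p, g p 0 = p.1 := fun p => by simp [hg]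
  have g1 : ∀ p, g p 1 = p.2 ^ 2 := fun p => by simp [hg]
  have g2 : ∀ p, g p 2 = p.2 ^ 3 := fun p => by
    have : ((2 : Fin (n + 3)) : ℕ) = 2 := rfl
    simp only [hg]
    rw [this]
    norm_num
  have g3 : ∀ p j, g p (w j) = 0 := fun p j => by simp [hg, hw]
  have hgz : g 0 = 0 := by
    ext i
    simp [hg]
  have hgc : Continuous g := by
    refine continuous_pi fun i => ?_
    simp only [hg]
    split_ifs <;> fun_prop
  have hΦg : ∀ q : ℝ × ℝ, ∀ i, Φ (g q) i = A i (q.1, q.2 ^ 2) + q.2 ^ 3 * B i (q.1, q.2 ^ 2) := by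
    intro q i
    simp [Φ, g0, g1, g2, g3]
  have hf0 : (fun p : ℝ × ℝ => γ p.2 + p.1 • deriv γ p.2) 0 = Φ 0 := by
    rw [hΦ0]; simp
  have hσ : ContDiff ℝ (⊤ : ℕ∞) (fun p : ℝ × ℝ => (p.1 + p.2, p.1)) := by fun_prop
  have hσ' : ContDiff ℝ (⊤ : ℕ∞) (fun p : ℝ × ℝ => (p.2, p.1 - p.2)) := by fun_prop
  refine ⟨fun p => (p.1 + p.2, p.1), fun p => (p.2, p.1 - p.2),
    hΦat.localInverse hΦ' hne, Φ, by simp, ?_, hσ.contDiffAt, hσ'.contDiffAt, ?_, ?_, ?_, ?_, ?_, ?_, ?_⟩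
  · rw [hf0, hgz]; exact hΦat.localInverse_apply_image hΦ' hne
  · rw [hf0]; exact hΦat.to_localInverse hΦ' hne
  · rw [hgz]; exact hΦat
  · exact Eventually.of_forall fun p => by simp
  · exact Eventually.of_forall fun p => by simp
  · rw [hf0]; exact hstr.eventually_right_inverse
  · rw [hgz]; exact hstr.eventually_left_inverse
  · have ht : Tendsto (fun p : ℝ × ℝ => (p.1 + p.2, p.1)) (𝓝 0) (𝓝 0) := by
      have := hσ.continuous.tendsto 0
      rw [show (((0 : ℝ × ℝ).1 + (0 : ℝ × ℝ).2, (0 : ℝ × ℝ).1) : ℝ × ℝ) = 0 by ext <;> simp] at this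
      exact this
    have htg : Tendsto g (𝓝 0) (𝓝 0) := by
      have := hgc.tendsto 0
      rwa [hgz] at this
    have hall := eventually_all.2 hAB
    filter_upwards [ht.eventually hall, (htg.comp ht).eventually hstr.eventually_left_inverse] with p h1 h2
    have : γ p.2 + p.1 • deriv γ p.2 = Φ (g (p.1 + p.2, p.1)) := by
      ext i
      rw [hΦg, ← h1 i]
      have hdi : deriv (fun t => γ t i) p.2 = deriv γ p.2 i :=
        (hasDerivAt_pi.1 (hγ.differentiable (by simp)).differentiableAt.hasDerivAt i).deriv
      simp [hdi]
    rw [this]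
    exact h2.symm


/-- In `ℝ^m`, `m ≥ 4`, the tangent variety to a finite-type curve `γ` of type
`(1,2,3,a₄,…,a_m)` at `0` is locally diffeomorphic to the higher-codimensional
cuspidal edge `(u, x) ↦ (u, x², x³, 0, …, 0)`. -/
theorem tangent_variety_type_123_higher_cuspidal_edge
    (m : ℕ) (hm : 4 ≤ m)
    (γ : ℝ → Fin m → ℝ) (hγ : ContDiff ℝ (⊤ : ℕ∞) γ)
    (hfin : Submodule.span ℝ
      (Set.range fun k : ℕ => iteratedDeriv (k + 1) γ 0) = (⊤ : Submodule ℝ (Fin m → ℝ)))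
    (htype : LinearIndependent ℝ
      ![iteratedDeriv 1 γ 0, iteratedDeriv 2 γ 0, iteratedDeriv 3 γ 0]) :
    GermEquiv (fun p : ℝ × ℝ => γ p.2 + p.1 • deriv γ p.2) (0 : ℝ × ℝ)
      (fun p : ℝ × ℝ => fun i : Fin m =>
        if (i : ℕ) = 0 then p.1
        else if (i : ℕ) = 1 then p.2 ^ 2
        else if (i : ℕ) = 2 then p.2 ^ 3
        else 0) (0 : ℝ × ℝ) := by
  obtain ⟨n, rfl⟩ : ∃ n, m = n + 3 := ⟨m - 3, by omega⟩
  exact tangent_aux n γ hγ htype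
end
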